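/- arXiv:2111.12692 — 3 statements merged into one kernel-verified Lean document; each statement's English description precedes it below -/
import Mathlib

section
/- There is a dimensional constant c_n ≥ 1 such that: if w is a weight on ℝⁿ with [w]_{A_∞}<∞ and 1<r_w<∞ is defined by r_w' = c_n [w]_{A_∞} (where r_w' = r_w/(r_w−1)), then for every cube Q one has (⨍_Q w^{r_w})^{1/r_w} ≤ 2 ⨍_Q w. -/
open MeasureTheory ENNReal NNReal Set

noncomputable section

/-- The conjugate exponent `p' = p/(p-1)`. -/
def conjExp (p : ℝ) : ℝ := p / (p - 1)
/-- An (open) axis-parallel cube in `ℝⁿ`. -/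
def IsCube (n : ℕ) (Q : Set (Fin n → ℝ)) : Prop :=
  ∃ (a : Fin n → ℝ) (r : ℝ), 0 < r ∧ Q = Set.univ.pi fun i => Set.Ioo (a i) (a i + r)

/-- An (open) axis-parallel rectangle in `ℝⁿ`. -/
def IsRect (n : ℕ) (R : Set (Fin n → ℝ)) : Prop :=
  ∃ a b : Fin n → ℝ, (∀ i, a i < b i) ∧ R = Set.univ.pi fun i => Set.Ioo (a i) (b i)

/-- The average `⨍_Q f` of a nonnegative function over a set. -/
def setAvg {n : ℕ} (Q : Set (Fin n → ℝ)) (f : (Fin n → ℝ) → ℝ≥0∞) : ℝ≥0∞ :=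
  (∫⁻ x in Q, f x) / volume Q

/-- The Hardy–Littlewood maximal operator (over axis-parallel cubes). -/
def maximal {n : ℕ} (f : (Fin n → ℝ) → ℝ≥0∞) (x : Fin n → ℝ) : ℝ≥0∞ :=
  ⨆ (Q : Set (Fin n → ℝ)) (_ : IsCube n Q) (_ : x ∈ Q), setAvg Q f

/-- The strong maximal operator (over axis-parallel rectangles). -/
def maximalR {n : ℕ} (f : (Fin n → ℝ) → ℝ≥0∞) (x : Fin n → ℝ) : ℝ≥0∞ :=
  ⨆ (R : Set (Fin n → ℝ)) (_ : IsRect n R) (_ : x ∈ R), setAvg R f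

/-- The dual weight `σ = w^{1-p'}`. -/
def dualWeight {n : ℕ} (p : ℝ) (w : (Fin n → ℝ) → ℝ≥0∞) : (Fin n → ℝ) → ℝ≥0∞ :=
  fun x => w x ^ (1 - conjExp p)

/-- The two-weight Muckenhoupt constant `[v,w]_{A_p}`. -/
def twoApConst (n : ℕ) (p : ℝ) (v w : (Fin n → ℝ) → ℝ≥0∞) : ℝ≥0∞ :=
  ⨆ (Q : Set (Fin n → ℝ)) (_ : IsCube n Q),
    setAvg Q v * setAvg Q (dualWeight p w) ^ (p - 1)

/-- The Muckenhoupt constant `[w]_{A_p}`. -/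
def ApConst (n : ℕ) (p : ℝ) (w : (Fin n → ℝ) → ℝ≥0∞) : ℝ≥0∞ := twoApConst n p w w

/-- The Fujii–Wilson constant `[w]_{A_∞}`. -/
def AinfConst (n : ℕ) (w : (Fin n → ℝ) → ℝ≥0∞) : ℝ≥0∞ :=
  ⨆ (Q : Set (Fin n → ℝ)) (_ : IsCube n Q),
    (∫⁻ x in Q, maximal (Q.indicator w) x) / ∫⁻ x in Q, w x

/-- The strong Muckenhoupt constant `[w]_{A_{p,ℛ}}`. -/
def ApRConst (n : ℕ) (p : ℝ) (w : (Fin n → ℝ) → ℝ≥0∞) : ℝ≥0∞ :=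
  ⨆ (R : Set (Fin n → ℝ)) (_ : IsRect n R),
    setAvg R w * setAvg R (dualWeight p w) ^ (p - 1)

/-- The strong Fujii–Wilson constant `[w]_{A_{∞,ℛ}}`. -/
def AinfRConst (n : ℕ) (w : (Fin n → ℝ) → ℝ≥0∞) : ℝ≥0∞ :=
  ⨆ (R : Set (Fin n → ℝ)) (_ : IsRect n R),
    (∫⁻ x in R, maximalR (R.indicator w) x) / ∫⁻ x in R, w x

namespace SRH

variable {n : ℕ}

/-- Half-open cube. -/
def C (a : Fin n → ℝ) (s : ℝ) : Set (Fin n → ℝ) :=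
  Set.univ.pi fun i => Set.Ico (a i) (a i + s)

/-- Corner of the dyadic child indexed by `d`. -/
def chd (a : Fin n → ℝ) (s : ℝ) (d : Fin n → Bool) : Fin n → ℝ :=
  fun i => a i + if d i then s / 2 else 0

/-- The child index selected by a point. -/
def pick (a : Fin n → ℝ) (s : ℝ) (x : Fin n → ℝ) : Fin n → Bool :=
  fun i => decide (a i + s / 2 ≤ x i)

/-- Truncated dyadic maximal function. -/
def F (w : (Fin n → ℝ) → ℝ≥0∞) : ℕ → (Fin n → ℝ) → ℝ → (Fin n → ℝ) → ℝ≥0∞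
  | 0, a, s, _ => setAvg (C a s) w
  | (N + 1), a, s, x =>
      max (setAvg (C a s) w) (F w N (chd a s (pick a s x)) (s / 2) x)

lemma mem_C {a : Fin n → ℝ} {s : ℝ} {x : Fin n → ℝ} :
    x ∈ C a s ↔ ∀ i, a i ≤ x i ∧ x i < a i + s := by
  simp [C, Set.mem_pi]

lemma meas_C (a : Fin n → ℝ) (s : ℝ) : MeasurableSet (C a s) :=
  MeasurableSet.univ_pi fun _ => measurableSet_Ico

lemma vol_C (a : Fin n → ℝ) (s : ℝ) : volume (C a s) = ENNReal.ofReal s ^ n := by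
  simp [C, Real.volume_pi_Ico]

lemma vol_C_ne_zero (a : Fin n → ℝ) {s : ℝ} (hs : 0 < s) : volume (C a s) ≠ 0 := by
  rw [vol_C]
  exact pow_ne_zero _ (by simpa using hs)

lemma vol_C_ne_top (a : Fin n → ℝ) (s : ℝ) : volume (C a s) ≠ ∞ := by
  rw [vol_C]
  exact ENNReal.pow_ne_top ENNReal.ofReal_ne_top

lemma vol_child (a b : Fin n → ℝ) (s : ℝ) :
    volume (C a s) = 2 ^ n * volume (C b (s / 2)) := by
  rw [vol_C, vol_C, ← mul_pow]
  congr 1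
  rw [ENNReal.ofReal_div_of_pos (by norm_num), ENNReal.ofReal_ofNat,
    ENNReal.mul_div_cancel (by norm_num) (by norm_num)]

lemma child_subset (a : Fin n → ℝ) {s : ℝ} (hs : 0 < s) (d : Fin n → Bool) :
    C (chd a s d) (s / 2) ⊆ C a s := by
  intro x hx
  rw [mem_C] at *
  intro i
  have := hx i
  simp only [chd] at this
  split_ifs at this <;> constructor <;> linarith [this.1, this.2]

lemma pick_child (a : Fin n → ℝ) {s : ℝ} (d : Fin n → Bool) {x : Fin n → ℝ}
    (hx : x ∈ C (chd a s d) (s / 2)) : pick a s x = d := by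
  rw [mem_C] at hx
  funext i
  have := hx i
  simp only [chd] at this
  simp only [pick]
  cases h : d i
  · simp only [h] at this
    simp at this ⊢
    linarith
  · simp only [h] at this
    simp at this ⊢
    linarith

lemma mem_child_pick (a : Fin n → ℝ) {s : ℝ} {x : Fin n → ℝ} (hx : x ∈ C a s) :
    x ∈ C (chd a s (pick a s x)) (s / 2) := by
  rw [mem_C] at *
  intro i
  have := hx i
  simp only [chd, pick, decide_eq_true_eq]
  split_ifs with h
  · constructor <;> linarith
  · push Not at h
    constructor <;> linarith

lemma iUnion_child (a : Fin n → ℝ) {s : ℝ} (hs : 0 < s) :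
    ⋃ d, C (chd a s d) (s / 2) = C a s := by
  apply subset_antisymm
  · exact iUnion_subset fun d => child_subset a hs d
  · intro x hx
    exact mem_iUnion.2 ⟨_, mem_child_pick a hx⟩

lemma disj_child (a : Fin n → ℝ) (s : ℝ) :
    Pairwise (Function.onFun Disjoint fun d => C (chd a s d) (s / 2)) := by
  intro d e hde
  refine Set.disjoint_left.2 fun x h1 h2 => hde ?_
  rw [← pick_child a d h1, ← pick_child a e h2]

lemma meas_pick (a : Fin n → ℝ) (s : ℝ) : Measurable (pick a s) := by
  refine measurable_pi_iff.2 fun i => ?_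
  refine measurable_to_bool ?_
  have : (fun x : Fin n → ℝ => pick a s x i) ⁻¹' {true} = {x | a i + s / 2 ≤ x i} := by
    ext x; simp [pick]
  rw [this]
  exact measurableSet_le measurable_const (measurable_pi_apply i)

lemma meas_F (w : (Fin n → ℝ) → ℝ≥0∞) (N : ℕ) :
    ∀ (a : Fin n → ℝ) (s : ℝ), Measurable (F w N a s) := by
  induction N with
  | zero => intro a s; exact measurable_const
  | succ N ih =>
    intro a s
    have h : Measurable (fun p : (Fin n → Bool) × (Fin n → ℝ) =>
        F w N (chd a s p.1) (s / 2) p.2) :=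
      measurable_from_prod_countable_right fun d => ih (chd a s d) (s / 2)
    exact measurable_const.max (h.comp ((meas_pick a s).prodMk measurable_id))

lemma avg_le_F (w : (Fin n → ℝ) → ℝ≥0∞) (N : ℕ) (a : Fin n → ℝ) (s : ℝ) (x : Fin n → ℝ) :
    setAvg (C a s) w ≤ F w N a s x := by
  cases N with
  | zero => exact le_rfl
  | succ N => exact le_max_left _ _

lemma F_succ_child (w : (Fin n → ℝ) → ℝ≥0∞) (N : ℕ) (a : Fin n → ℝ) (s : ℝ)
    (d : Fin n → Bool) {x : Fin n → ℝ} (hx : x ∈ C (chd a s d) (s / 2)) :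
    F w (N + 1) a s x = max (setAvg (C a s) w) (F w N (chd a s d) (s / 2) x) := by
  rw [F, pick_child a d hx]

lemma F_mono (w : (Fin n → ℝ) → ℝ≥0∞) (N : ℕ) :
    ∀ (a : Fin n → ℝ) (s : ℝ) (x : Fin n → ℝ), F w N a s x ≤ F w (N + 1) a s x := by
  induction N with
  | zero => intro a s x; exact le_max_left _ _
  | succ N ih => intro a s x; exact max_le_max le_rfl (ih _ _ _)

lemma setAvg_ne_top {w : (Fin n → ℝ) → ℝ≥0∞} {a : Fin n → ℝ} {s : ℝ} (hs : 0 < s)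
    (hw : ∫⁻ x in C a s, w x ≠ ∞) : setAvg (C a s) w ≠ ∞ :=
  ENNReal.div_ne_top hw (vol_C_ne_zero a hs)

lemma int_child_ne_top {w : (Fin n → ℝ) → ℝ≥0∞} {a : Fin n → ℝ} {s : ℝ} (hs : 0 < s)
    (hw : ∫⁻ x in C a s, w x ≠ ∞) (d : Fin n → Bool) :
    ∫⁻ x in C (chd a s d) (s / 2), w x ≠ ∞ :=
  ne_top_of_le_ne_top hw (lintegral_mono_set (child_subset a hs d))

lemma avg_mul {w : (Fin n → ℝ) → ℝ≥0∞} {a : Fin n → ℝ} {s : ℝ} (hs : 0 < s) :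
    setAvg (C a s) w * volume (C a s) = ∫⁻ x in C a s, w x :=
  ENNReal.div_mul_cancel (vol_C_ne_zero a hs) (vol_C_ne_top a s)

/-- Uniform bound. -/
lemma F_bdd (w : (Fin n → ℝ) → ℝ≥0∞) (N : ℕ) :
    ∀ (a : Fin n → ℝ) (s : ℝ), 0 < s → ∫⁻ x in C a s, w x ≠ ∞ →
      ∃ B : ℝ≥0∞, B ≠ ∞ ∧ ∀ x, F w N a s x ≤ B := by
  induction N with
  | zero =>
    intro a s hs hw
    exact ⟨_, setAvg_ne_top hs hw, fun x => le_rfl⟩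
  | succ N ih =>
    intro a s hs hw
    choose B hB hB' using fun d => ih (chd a s d) (s / 2) (by positivity) (int_child_ne_top hs hw d)
    refine ⟨setAvg (C a s) w + ∑ d, B d, ?_, fun x => ?_⟩
    · exact ENNReal.add_ne_top.2 ⟨setAvg_ne_top hs hw, ENNReal.sum_ne_top.2 fun d _ => hB d⟩
    · refine max_le le_self_add ((hB' _ x).trans ?_)
      exact (Finset.single_le_sum (f := B) (fun _ _ => zero_le) (Finset.mem_univ _)).trans
        le_add_self

/-- The weak-type recursion. -/
lemma weak (w : (Fin n → ℝ) → ℝ≥0∞)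
    (h : ℕ → (Fin n → ℝ) → ℝ → (Fin n → ℝ) → ℝ≥0∞) (K : ℝ≥0∞)
    (hK : ∀ N a s, 0 < s → ∫⁻ x in C a s, w x ≠ ∞ →
      ∫⁻ x in C a s, h N a s x ≤ K * ∫⁻ x in C a s, w x)
    (hstep : ∀ N a s d x, x ∈ C (chd a s d) (s / 2) →
      setAvg (C a s) w ≤ F w N (chd a s d) (s / 2) x →
      h (N + 1) a s x = h N (chd a s d) (s / 2) x) (l : ℝ≥0∞) (N : ℕ) :
    ∀ (a : Fin n → ℝ) (s : ℝ), 0 < s → ∫⁻ x in C a s, w x ≠ ∞ → setAvg (C a s) w ≤ l →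
      ∫⁻ x in C a s ∩ {x | l < F w N a s x}, h N a s x ≤
        K * 2 ^ n * l * volume (C a s ∩ {x | l < F w N a s x}) := by
  induction N with
  | zero =>
    intro a s hs hw hl
    have : {x : Fin n → ℝ | l < F w 0 a s x} = ∅ := by
      ext x; simpa [F] using hl
    simp [this]
  | succ N ih =>
    intro a s hs hw hl
    set S := {x : Fin n → ℝ | l < F w (N + 1) a s x} with hS
    have mS : MeasurableSet S := measurableSet_lt measurable_const (meas_F w _ a s)
    have hu : C a s ∩ S = ⋃ d, (C (chd a s d) (s / 2) ∩ S) := by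
      rw [← iUnion_inter, iUnion_child a hs]
    have hdisj : Pairwise (Function.onFun Disjoint fun d => C (chd a s d) (s / 2) ∩ S) :=
      fun d e hde => (disj_child a s hde).mono inter_subset_left inter_subset_left
    rw [hu, measure_iUnion hdisj (fun d => (meas_C _ _).inter mS), tsum_fintype]
    refine (lintegral_iUnion_le _ _).trans ?_
    rw [tsum_fintype, Finset.mul_sum]
    refine Finset.sum_le_sum fun d _ => ?_
    have hs2 : 0 < s / 2 := by positivity
    have hSd : C (chd a s d) (s / 2) ∩ S =
        C (chd a s d) (s / 2) ∩ {x | l < F w N (chd a s d) (s / 2) x} := by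
      ext x
      simp only [mem_inter_iff, hS, mem_ofPred_eq]
      refine and_congr_right fun hx => ?_
      rw [F_succ_child w N a s d hx, lt_max_iff]
      exact or_iff_right (not_lt.2 hl)
    have hint : ∫⁻ x in C (chd a s d) (s / 2) ∩ S, h (N + 1) a s x =
        ∫⁻ x in C (chd a s d) (s / 2) ∩ S, h N (chd a s d) (s / 2) x := by
      refine setLIntegral_congr_fun ((meas_C _ _).inter mS) fun x hx => ?_
      rw [hSd] at hx
      exact hstep N a s d x hx.1 (hl.trans hx.2.le)
    rw [hint, hSd]
    rcases le_or_gt (setAvg (C (chd a s d) (s / 2)) w) l with hc | hc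
    · exact ih _ _ hs2 (int_child_ne_top hs hw d) hc
    · have : {x | l < F w N (chd a s d) (s / 2) x} = univ := by
        ext x
        simpa using hc.trans_le (avg_le_F w N _ _ x)
      rw [this, inter_univ]
      refine (hK N _ _ hs2 (int_child_ne_top hs hw d)).trans ?_
      rw [mul_assoc, mul_assoc]
      gcongr
      calc ∫⁻ x in C (chd a s d) (s / 2), w x ≤ ∫⁻ x in C a s, w x :=
            lintegral_mono_set (child_subset a hs d)
        _ = setAvg (C a s) w * volume (C a s) := (avg_mul hs).symm
        _ ≤ l * volume (C a s) := by gcongr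
        _ = 2 ^ n * (l * volume (C (chd a s d) (s / 2))) := by
          rw [vol_child a (chd a s d) s]; ring

lemma Ioo_ae (a : Fin n → ℝ) (s : ℝ) :
    (Set.univ.pi fun i => Set.Ioo (a i) (a i + s)) =ᵐ[volume] C a s := by
  have h1 := Measure.univ_pi_Ioo_ae_eq_Icc (μ := fun _ : Fin n => (volume : Measure ℝ))
    (f := a) (g := fun i => a i + s)
  have h2 := Measure.univ_pi_Ico_ae_eq_Icc (μ := fun _ : Fin n => (volume : Measure ℝ))
    (f := a) (g := fun i => a i + s)
  exact h1.trans h2.symm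

lemma Icc_ae (a : Fin n → ℝ) (s : ℝ) :
    Set.Icc a (fun i => a i + s) =ᵐ[volume] C a s :=
  (Measure.univ_pi_Ico_ae_eq_Icc (μ := fun _ : Fin n => (volume : Measure ℝ))
    (f := a) (g := fun i => a i + s)).symm

lemma setAvg_congr_set {A B : Set (Fin n → ℝ)} (h : A =ᵐ[volume] B)
    (f : (Fin n → ℝ) → ℝ≥0∞) : setAvg A f = setAvg B f := by
  rw [setAvg, setAvg, setLIntegral_congr h, measure_congr h]

lemma setAvg_congr_fun (A : Set (Fin n → ℝ)) {f g : (Fin n → ℝ) → ℝ≥0∞}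
    (h : f =ᵐ[volume] g) : setAvg A f = setAvg A g := by
  rw [setAvg, setAvg, lintegral_congr_ae (ae_restrict_of_ae h)]

lemma maximal_mono {f g : (Fin n → ℝ) → ℝ≥0∞} (h : ∀ x, f x ≤ g x) (x : Fin n → ℝ) :
    maximal f x ≤ maximal g x := by
  refine iSup_mono fun Q => iSup_mono fun _ => iSup_mono fun _ => ?_
  exact ENNReal.div_le_div_right (lintegral_mono h) _

lemma maximal_congr {f g : (Fin n → ℝ) → ℝ≥0∞} (h : f =ᵐ[volume] g) :
    maximal f = maximal g := by
  funext x
  simp only [maximal, setAvg_congr_fun _ h]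

lemma F_le_maximal (w : (Fin n → ℝ) → ℝ≥0∞) (N : ℕ) :
    ∀ (a : Fin n → ℝ) (s : ℝ), 0 < s →
      ∀ᵐ x ∂(volume.restrict (C a s)), F w N a s x ≤ maximal ((C a s).indicator w) x := by
  have key : ∀ (a : Fin n → ℝ) (s : ℝ), 0 < s →
      ∀ᵐ x ∂(volume.restrict (C a s)),
        setAvg (C a s) w ≤ maximal ((C a s).indicator w) x := by
    intro a s hs
    rw [← Measure.restrict_congr_set (Ioo_ae a s)]
    refine ae_restrict_of_forall_mem (MeasurableSet.univ_pi fun _ => measurableSet_Ioo) ?_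
    intro x hx
    have h1 : setAvg (C a s) w = setAvg (Set.univ.pi fun i => Set.Ioo (a i) (a i + s))
        ((C a s).indicator w) := by
      rw [setAvg_congr_set (Ioo_ae a s), setAvg, setAvg]
      congr 1
      refine setLIntegral_congr_fun (meas_C a s) fun y hy => ?_
      simp [hy]
    rw [h1]
    exact le_iSup_of_le _ (le_iSup_of_le ⟨a, s, hs, rfl⟩ (le_iSup_of_le hx le_rfl))
  induction N with
  | zero => exact key
  | succ N ih =>
    intro a s hs
    have hk := key a s hs
    have hc : ∀ d, ∀ᵐ x ∂(volume.restrict (C (chd a s d) (s / 2))),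
        F w N (chd a s d) (s / 2) x ≤ maximal ((C a s).indicator w) x := by
      intro d
      filter_upwards [ih (chd a s d) (s / 2) (by positivity)] with x hx
      refine hx.trans (maximal_mono (fun y => ?_) x)
      exact Set.indicator_le_indicator_of_subset (child_subset a hs d) (fun _ => zero_le) y
    rw [← iUnion_child a hs, ae_restrict_iUnion_iff] at hk ⊢
    intro d
    filter_upwards [hc d, hk d, ae_restrict_mem (meas_C (chd a s d) (s / 2))] with x h1 h2 h3
    rw [iUnion_child a hs] at *
    rw [F_succ_child w N a s d h3]
    exact max_le h2 h1

lemma int_F_le (w : (Fin n → ℝ) → ℝ≥0∞) (hA : AinfConst n w ≠ ∞) (hA0 : AinfConst n w ≠ 0)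
    (N : ℕ) (a : Fin n → ℝ) (s : ℝ) (hs : 0 < s) (hw : ∫⁻ x in C a s, w x ≠ ∞) :
    ∫⁻ x in C a s, F w N a s x ≤ AinfConst n w * ∫⁻ x in C a s, w x := by
  refine (lintegral_mono_ae (F_le_maximal w N a s hs)).trans ?_
  rw [← ENNReal.div_le_iff_le_mul (Or.inr hA) (Or.inr hA0)]
  have hae := Ioo_ae a s
  have h1 : (∫⁻ x in C a s, maximal ((C a s).indicator w) x) / (∫⁻ x in C a s, w x) =
      (∫⁻ x in (Set.univ.pi fun i => Set.Ioo (a i) (a i + s)),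
        maximal ((Set.univ.pi fun i => Set.Ioo (a i) (a i + s)).indicator w) x) /
      (∫⁻ x in (Set.univ.pi fun i => Set.Ioo (a i) (a i + s)), w x) := by
    rw [setLIntegral_congr hae, setLIntegral_congr hae,
      maximal_congr (indicator_ae_eq_of_ae_eq_set hae)]
  rw [h1]
  exact le_iSup_of_le _ (le_iSup_of_le ⟨a, s, hs, rfl⟩ le_rfl)

/-- Layer cake. -/
lemma layer {X : Type*} [MeasurableSpace X] (μ ν : Measure X) (f : X → ℝ≥0∞)
    (hf : Measurable f) (hft : ∀ x, f x ≠ ∞) (α K : ℝ≥0∞) (hα : α ≠ ∞)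
    (hw : ∀ l, α ≤ l → ν {x | l < f x} ≤ K * l * μ {x | l < f x}) (e : ℝ) (he : 0 < e) :
    ∫⁻ x, f x ^ e ∂ν ≤ α ^ e * ν univ +
      ENNReal.ofReal (e / (1 + e)) * K * ∫⁻ x, f x ^ (1 + e) ∂μ := by
  have conv : ∀ (m : Measure X) (p : ℝ), 0 < p → ∫⁻ x, f x ^ p ∂m =
      ENNReal.ofReal p * ∫⁻ t in Ioi (0 : ℝ),
        m {x | ENNReal.ofReal t < f x} * ENNReal.ofReal (t ^ (p - 1)) := by
    intro m p hp
    have := lintegral_rpow_eq_lintegral_meas_lt_mul m (f := fun x => (f x).toReal)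
      (Filter.Eventually.of_forall fun x => ENNReal.toReal_nonneg) hf.ennreal_toReal.aemeasurable hp
    have h2 : ∀ x, ENNReal.ofReal ((f x).toReal ^ p) = f x ^ p := by
      intro x
      rw [← ENNReal.ofReal_rpow_of_nonneg ENNReal.toReal_nonneg hp.le, ENNReal.ofReal_toReal (hft x)]
    simp only [h2] at this
    rw [this]
    congr 1
    refine setLIntegral_congr_fun measurableSet_Ioi fun t ht => ?_
    simp only [ENNReal.ofReal_lt_iff_lt_toReal (le_of_lt ht) (hft _)]
  have hconst : α ^ e * ν univ = ENNReal.ofReal e * ∫⁻ t in Ioi (0 : ℝ),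
        ν {_x | ENNReal.ofReal t < α} * ENNReal.ofReal (t ^ (e - 1)) := by
    have := lintegral_rpow_eq_lintegral_meas_lt_mul ν (f := fun _ => α.toReal)
      (Filter.Eventually.of_forall fun x => ENNReal.toReal_nonneg) aemeasurable_const he
    rw [lintegral_const, ← ENNReal.ofReal_rpow_of_nonneg ENNReal.toReal_nonneg he.le,
      ENNReal.ofReal_toReal hα] at this
    rw [this]
    congr 1
    refine setLIntegral_congr_fun measurableSet_Ioi fun t ht => ?_
    simp only [ENNReal.ofReal_lt_iff_lt_toReal (le_of_lt ht) hα]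
  have hmeas : Measurable fun t : ℝ => ν {_x : X | ENNReal.ofReal t < α} * ENNReal.ofReal (t ^ (e - 1)) := by
    refine Measurable.mul ?_ (by fun_prop)
    refine Antitone.measurable fun t u htu => measure_mono fun x hx => ?_
    exact (ENNReal.ofReal_le_ofReal htu).trans_lt hx
  rw [hconst, conv ν e he, conv μ (1 + e) (by positivity)]
  have hpt : ∫⁻ t in Ioi (0 : ℝ), ν {x | ENNReal.ofReal t < f x} * ENNReal.ofReal (t ^ (e - 1)) ≤
      (∫⁻ t in Ioi (0 : ℝ), ν {_x | ENNReal.ofReal t < α} * ENNReal.ofReal (t ^ (e - 1))) +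
      K * ∫⁻ t in Ioi (0 : ℝ),
        μ {x | ENNReal.ofReal t < f x} * ENNReal.ofReal (t ^ (1 + e - 1)) := by
    have hmeas2 : Measurable fun t : ℝ =>
        μ {x : X | ENNReal.ofReal t < f x} * ENNReal.ofReal (t ^ (1 + e - 1)) := by
      refine Measurable.mul ?_ (by fun_prop)
      refine Antitone.measurable fun t u htu => measure_mono fun x hx => ?_
      exact (ENNReal.ofReal_le_ofReal htu).trans_lt hx
    rw [← lintegral_const_mul _ hmeas2, ← lintegral_add_left hmeas]
    refine setLIntegral_mono' measurableSet_Ioi fun t ht => ?_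
    have ht : 0 < t := ht
    rcases lt_or_ge (ENNReal.ofReal t) α with h | h
    · refine le_add_right ?_
      exact mul_le_mul_left (measure_mono fun x _ => h) _
    · refine le_add_left ?_
      calc _ ≤ (K * ENNReal.ofReal t * μ {x | ENNReal.ofReal t < f x}) *
            ENNReal.ofReal (t ^ (e - 1)) := by gcongr; exact hw _ h
        _ = K * (μ {x | ENNReal.ofReal t < f x} *
            (ENNReal.ofReal t * ENNReal.ofReal (t ^ (e - 1)))) := by ring
        _ = _ := by
          rw [← ENNReal.ofReal_mul ht.le]
          congr 4
          rw [← Real.rpow_one_add' ht.le (by linarith)]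
          congr 1; ring
  refine (mul_le_mul_right hpt (ENNReal.ofReal e)).trans (le_of_eq ?_)
  rw [mul_add]
  congr 1
  have : ENNReal.ofReal e = ENNReal.ofReal (e / (1 + e)) * ENNReal.ofReal (1 + e) := by
    rw [← ENNReal.ofReal_mul (by positivity)]
    congr 1
    field_simp
  rw [this]
  ring

lemma exists_cube (w : (Fin n → ℝ) → ℝ≥0∞) (N : ℕ) :
    ∀ (a : Fin n → ℝ) (s : ℝ), 0 < s → ∀ x ∈ C a s,
      ∃ b, x ∈ C b (s / 2 ^ N) ∧ C b (s / 2 ^ N) ⊆ C a s ∧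
        setAvg (C b (s / 2 ^ N)) w ≤ F w N a s x := by
  induction N with
  | zero => intro a s hs x hx; exact ⟨a, by simpa using hx, by simp, by simp [F]⟩
  | succ N ih =>
    intro a s hs x hx
    obtain ⟨b, h1, h2, h3⟩ := ih _ (s / 2) (by positivity) x (mem_child_pick a hx)
    have e : s / 2 / 2 ^ N = s / 2 ^ (N + 1) := by rw [pow_succ]; field_simp
    rw [e] at h1 h2 h3
    exact ⟨b, h1, h2.trans (child_subset a hs _), h3.trans (le_max_right _ _)⟩

lemma ae_le_iSup (w : (Fin n → ℝ) → ℝ≥0∞) (hm : Measurable w) (a : Fin n → ℝ) (s : ℝ)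
    (hs : 0 < s) (hw : ∫⁻ x in C a s, w x ≠ ∞) :
    ∀ᵐ x ∂(volume.restrict (C a s)), w x ≤ ⨆ N, F w N a s x := by
  have hd := (IsUnifLocDoublingMeasure.vitaliFamily (volume : Measure (Fin n → ℝ)) 1).ae_tendsto_lintegral_div
    (f := (C a s).indicator w) (hm.indicator (meas_C a s)).aemeasurable
    (by rwa [lintegral_indicator (meas_C a s)])
  rw [ae_restrict_iff' (meas_C a s)]
  filter_upwards [hd] with x hx hxC
  choose b h1 h2 h3 using fun N => exists_cube w N a s hs x hxC
  have hball : ∀ N, Metric.closedBall (fun i => b N i + s / 2 ^ N / 2) (s / 2 ^ N / 2) =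
      Set.Icc (b N) (fun i => b N i + s / 2 ^ N) := by
    intro N
    rw [closedBall_pi _ (by positivity), ← Set.pi_univ_Icc]
    congr 1
    funext i
    rw [Real.closedBall_eq_Icc]
    congr 1 <;> ring
  have hlim : Filter.Tendsto (fun N : ℕ => s / 2 ^ N / 2) Filter.atTop (nhdsWithin 0 (Ioi 0)) := by
    refine tendsto_nhdsWithin_iff.2 ⟨?_, Filter.Eventually.of_forall fun N => ?_⟩
    · have := (tendsto_pow_atTop_nhds_zero_of_lt_one (r := (1 / 2 : ℝ)) (by norm_num)
        (by norm_num)).const_mul (s / 2)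
      rw [mul_zero] at this
      refine this.congr fun N => ?_
      rw [one_div, inv_pow]; field_simp
    · simp only [mem_Ioi]; positivity
  have ht := hx.comp (IsUnifLocDoublingMeasure.tendsto_closedBall_filterAt (K := 1) (x := x) volume
    (fun N => fun i => b N i + s / 2 ^ N / 2) (fun N => s / 2 ^ N / 2) hlim
    (Filter.Eventually.of_forall fun N => by
      rw [one_mul, hball N]
      have := mem_C.1 (h1 N)
      exact ⟨fun i => (this i).1, fun i => (this i).2.le⟩))
  rw [Set.indicator_of_mem hxC] at ht
  refine le_of_tendsto' ht fun N => ?_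
  refine le_trans (le_of_eq ?_) ((h3 N).trans (le_iSup (fun N => F w N a s x) N))
  simp only [Function.comp]
  rw [hball N, setLIntegral_congr (Icc_ae _ _), measure_congr (Icc_ae _ _), setAvg]
  congr 1
  refine setLIntegral_congr_fun (meas_C _ _) fun y hy => ?_
  simp [h2 N hy]

/-- Main estimate at a finite level. -/
lemma level (w : (Fin n → ℝ) → ℝ≥0∞) (hm : Measurable w) (hA : AinfConst n w ≠ ∞)
    (e : ℝ) (he : 0 < e)
    (hr : ENNReal.ofReal (e / (1 + e)) * (AinfConst n w * 2 ^ n) = 2⁻¹)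
    (N : ℕ) (a : Fin n → ℝ) (s : ℝ) (hs : 0 < s) (hw : ∫⁻ x in C a s, w x ≠ ∞) :
    ∫⁻ x in C a s, F w N a s x ^ e * w x ≤
      2 * (setAvg (C a s) w ^ e * ∫⁻ x in C a s, w x) := by
  have hA0 : AinfConst n w ≠ 0 := by
    intro h
    rw [h, zero_mul, mul_zero] at hr
    exact ENNReal.inv_ne_zero.2 (by norm_num) hr.symm
  set A := AinfConst n w with hAdef
  set α := setAvg (C a s) w with hαdef
  have hα : α ≠ ∞ := setAvg_ne_top hs hw
  obtain ⟨B, hB, hFB⟩ := F_bdd w N a s hs hw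
  have hFt : ∀ x, F w N a s x ≠ ∞ := fun x => ne_top_of_le_ne_top hB (hFB x)
  have mF := meas_F w N a s
  have mset : ∀ l, MeasurableSet {x | l < F w N a s x} := fun l =>
    measurableSet_lt measurable_const mF
  have gen : ∀ (g : (Fin n → ℝ) → ℝ≥0∞) (K : ℝ≥0∞), Measurable g →
      (∀ l, α ≤ l → ∫⁻ x in C a s ∩ {x | l < F w N a s x}, g x ≤
        K * 2 ^ n * l * volume (C a s ∩ {x | l < F w N a s x})) →
      ∫⁻ x in C a s, F w N a s x ^ e * g x ≤ α ^ e * (∫⁻ x in C a s, g x) +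
        ENNReal.ofReal (e / (1 + e)) * (K * 2 ^ n) * ∫⁻ x in C a s, F w N a s x ^ (1 + e) := by
    intro g K hg hweak
    have := layer (volume.restrict (C a s)) ((volume.restrict (C a s)).withDensity g)
      (F w N a s) mF hFt α (K * 2 ^ n) hα ?_ e he
    · rw [withDensity_apply _ MeasurableSet.univ, Measure.restrict_univ,
        lintegral_withDensity_eq_lintegral_mul _ hg (mF.pow_const e)] at this
      refine le_trans (le_of_eq ?_) this
      refine lintegral_congr fun x => ?_
      simp [mul_comm]
    · intro l hl
      rw [withDensity_apply _ (mset l), Measure.restrict_restrict (mset l),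
        Measure.restrict_apply (mset l), inter_comm]
      exact hweak l hl
  have h1 := gen (F w N a s) A mF (fun l hl => weak w (F w) A
    (fun N a s hs hw => int_F_le w hA hA0 N a s hs hw)
    (fun N a s d x hx hle => by rw [F_succ_child w N a s d hx, max_eq_right hle]) l N a s hs hw hl)
  have h2 := gen w 1 hm (fun l hl => weak w (fun _ _ _ => w) 1
    (fun N a s hs hw => by rw [one_mul])
    (fun N a s d x hx hle => rfl) l N a s hs hw hl)
  have hpow : ∀ x, F w N a s x ^ e * F w N a s x = F w N a s x ^ (1 + e) := by
    intro x
    rw [ENNReal.rpow_add_of_nonneg _ _ zero_le_one he.le, ENNReal.rpow_one, mul_comm]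
  simp only [hpow] at h1
  set I := ∫⁻ x in C a s, F w N a s x ^ (1 + e) with hI
  have hIt : I ≠ ∞ := by
    refine ne_top_of_le_ne_top (b := B ^ (1 + e) * volume (C a s)) ?_ ?_
    · exact ENNReal.mul_ne_top (ENNReal.rpow_ne_top_of_nonneg (by positivity) hB) (vol_C_ne_top a s)
    · rw [← setLIntegral_const]
      exact lintegral_mono fun x => ENNReal.rpow_le_rpow (hFB x) (by positivity)
  rw [hr] at h1
  set W := ∫⁻ x in C a s, w x with hW
  have h3 : I ≤ 2 * (α ^ e * (A * W)) := by
    have h4 : α ^ e * (∫⁻ x in C a s, F w N a s x) ≤ α ^ e * (A * W) := by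
      gcongr
      exact int_F_le w hA hA0 N a s hs hw
    have h5 : 2⁻¹ * I + 2⁻¹ * I ≤ α ^ e * (A * W) + 2⁻¹ * I := by
      rw [← add_mul, ENNReal.inv_two_add_inv_two, one_mul]
      exact h1.trans (by gcongr)
    have h6 := (ENNReal.add_le_add_iff_right
      (ENNReal.mul_ne_top (by simp) hIt)).1 h5
    calc I = 2 * (2⁻¹ * I) := by
          rw [← mul_assoc, ENNReal.mul_inv_cancel (by norm_num) (by norm_num), one_mul]
      _ ≤ _ := by gcongr
  calc _ ≤ _ := h2
    _ ≤ α ^ e * W + ENNReal.ofReal (e / (1 + e)) * (1 * 2 ^ n) * (2 * (α ^ e * (A * W))) := by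
        gcongr
    _ = α ^ e * W + (ENNReal.ofReal (e / (1 + e)) * (A * 2 ^ n)) * 2 * (α ^ e * W) := by ring
    _ = _ := by
        rw [hr, ENNReal.inv_mul_cancel (by norm_num) (by norm_num)]; ring

lemma final (w : (Fin n → ℝ) → ℝ≥0∞) (hm : Measurable w) (hA : AinfConst n w ≠ ∞)
    (e : ℝ) (he : 0 < e)
    (hr : ENNReal.ofReal (e / (1 + e)) * (AinfConst n w * 2 ^ n) = 2⁻¹)
    (a : Fin n → ℝ) (s : ℝ) (hs : 0 < s) (hw : ∫⁻ x in C a s, w x ≠ ∞) :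
    ∫⁻ x in C a s, w x ^ (1 + e) ≤
      2 * (setAvg (C a s) w ^ e * ∫⁻ x in C a s, w x) := by
  have hmono : Monotone fun N => F w N a s :=
    monotone_nat_of_le_succ fun N x => F_mono w N a s x
  calc ∫⁻ x in C a s, w x ^ (1 + e)
      ≤ ∫⁻ x in C a s, ⨆ N, F w N a s x ^ e * w x := by
        refine lintegral_mono_ae ?_
        filter_upwards [ae_le_iSup w hm a s hs hw] with x hx
        rw [ENNReal.rpow_add_of_nonneg _ _ zero_le_one he.le, ENNReal.rpow_one, mul_comm,
          ← ENNReal.iSup_mul]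
        gcongr
        have := (ENNReal.orderIsoRpow e he).map_iSup (fun N => F w N a s x)
        simp only [ENNReal.orderIsoRpow_apply] at this
        rw [← this]
        exact ENNReal.rpow_le_rpow hx he.le
    _ = ⨆ N, ∫⁻ x in C a s, F w N a s x ^ e * w x := by
        refine lintegral_iSup (fun N => ((meas_F w N a s).pow_const e).mul hm) ?_
        intro N M hNM x
        have := ENNReal.rpow_le_rpow (hmono hNM x) he.le
        dsimp only
        gcongr
    _ ≤ _ := iSup_le fun N => level w hm hA e he hr N a s hs hw

end SRH

/-- Sharp reverse Hölder inequality: there is a dimensional constant `c_n ≥ 1` such that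
if `r_w' = c_n [w]_{A_∞}` then `(⨍_Q w^{r_w})^{1/r_w} ≤ 2 ⨍_Q w` for every cube `Q`. -/
theorem sharp_reverse_holder (n : ℕ) :
    ∃ c : ℝ, 1 ≤ c ∧
      ∀ w : (Fin n → ℝ) → ℝ≥0∞, Measurable w → AinfConst n w ≠ ∞ →
        ∀ r : ℝ, 1 < r →
          ENNReal.ofReal (r / (r - 1)) = ENNReal.ofReal c * AinfConst n w →
            ∀ Q : Set (Fin n → ℝ), IsCube n Q →
              (setAvg Q fun x => w x ^ r) ^ (1 / r) ≤ 2 * setAvg Q w := by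
  refine ⟨2 ^ (n + 1), one_le_pow₀ (by norm_num), ?_⟩
  intro w hm hA r hr1 hrA Q hQ
  obtain ⟨a, s, hs, rfl⟩ := hQ
  rw [SRH.setAvg_congr_set (SRH.Ioo_ae a s), SRH.setAvg_congr_set (SRH.Ioo_ae a s)]
  by_cases hw : ∫⁻ x in SRH.C a s, w x = ∞
  · rw [setAvg, setAvg, hw, ENNReal.top_div_of_ne_top (SRH.vol_C_ne_top a s)]
    simp
  obtain ⟨e, rfl⟩ : ∃ e, r = 1 + e := ⟨r - 1, by ring⟩
  have he : 0 < e := by linarith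
  have hr : ENNReal.ofReal (e / (1 + e)) * (AinfConst n w * 2 ^ n) = 2⁻¹ := by
    have h1 : ENNReal.ofReal (e / (1 + e)) * ENNReal.ofReal ((1 + e) / (1 + e - 1)) = 1 := by
      rw [← ENNReal.ofReal_mul (by positivity), ← ENNReal.ofReal_one]
      congr 1
      rw [add_sub_cancel_left]
      field_simp
    rw [hrA, ENNReal.ofReal_pow (by norm_num), ENNReal.ofReal_ofNat, pow_succ] at h1
    refine ENNReal.eq_inv_of_mul_eq_one_left ?_
    rw [← h1]; ring
  have hmain := SRH.final w hm hA e he hr a s hs hw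
  set α := setAvg (SRH.C a s) w with hα
  have h2 : (setAvg (SRH.C a s) fun x => w x ^ (1 + e)) ≤ 2 * α ^ (1 + e) := by
    rw [setAvg]
    refine ENNReal.div_le_of_le_mul (hmain.trans (le_of_eq ?_))
    rw [← SRH.avg_mul hs, ENNReal.rpow_add_of_nonneg _ _ zero_le_one he.le, ENNReal.rpow_one]
    ring
  calc _ ≤ (2 * α ^ (1 + e)) ^ (1 / (1 + e)) := ENNReal.rpow_le_rpow h2 (by positivity)
    _ = 2 ^ (1 / (1 + e)) * α := by
        rw [ENNReal.mul_rpow_of_nonneg _ _ (by positivity), ← ENNReal.rpow_mul,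
          mul_one_div_cancel (by positivity), ENNReal.rpow_one]
    _ ≤ 2 ^ (1 : ℝ) * α := by
        gcongr
        · norm_num
        · rw [div_le_one (by positivity)]; linarith
    _ = _ := by rw [ENNReal.rpow_one]
end
end

section
/- Let p ∈ (1,∞), q ∈ [1,∞], and let w be a weight on ℝⁿ. Then the Hardy–Littlewood maximal operator M is bounded on the weighted Lorentz space L^{p,q}(w), i.e. ‖M‖_{L^{p,q}(w)→L^{p,q}(w)} < ∞, if and only if [w]_{A_p} < ∞. -/
open MeasureTheory ENNReal NNReal Set

noncomputable section

/-- The weighted distribution function `w({|f| > s})`. -/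
def wDist {α : Type*} [MeasurableSpace α] (μ : Measure α) (w : α → ℝ≥0∞)
    (f : α → ℝ≥0∞) (s : ℝ) : ℝ≥0∞ :=
  ∫⁻ x in {x | ENNReal.ofReal s < f x}, w x ∂μ

/-- The weighted Lorentz quasinorm `‖f‖_{L^{p,q}(w)}`; for `q = ∞` it is the weak norm. -/
def lorentzNorm {α : Type*} [MeasurableSpace α] (μ : Measure α) (w : α → ℝ≥0∞)
    (p : ℝ) (q : ℝ≥0∞) (f : α → ℝ≥0∞) : ℝ≥0∞ :=
  if q = ∞ then ⨆ (s : ℝ) (_ : 0 < s), ENNReal.ofReal s * wDist μ w f s ^ (1 / p)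
  else (ENNReal.ofReal p * ∫⁻ s in Set.Ioi (0 : ℝ),
      ENNReal.ofReal s ^ q.toReal * wDist μ w f s ^ (q.toReal / p) / ENNReal.ofReal s) ^ (1 / q.toReal)

/-- `min(p,q)` for a real `p` and an extended-real `q`. -/
def minE (p : ℝ) (q : ℝ≥0∞) : ℝ := if q = ∞ then p else min p q.toReal


lemma isCube_iff_ball (n : ℕ) (Q : Set (Fin n → ℝ)) :
    IsCube n Q ↔ ∃ (c : Fin n → ℝ) (r : ℝ), 0 < r ∧ Q = Metric.ball c r := by
  constructor
  · rintro ⟨a, r, hr, rfl⟩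
    refine ⟨fun i => a i + r / 2, r / 2, by positivity, ?_⟩
    rw [ball_pi _ (by positivity)]
    congr 1
    ext i : 1
    rw [Real.ball_eq_Ioo]
    congr 1 <;> ring
  · rintro ⟨c, r, hr, rfl⟩
    refine ⟨fun i => c i - r, 2 * r, by positivity, ?_⟩
    rw [ball_pi _ (by positivity)]
    congr 1
    ext i : 1
    rw [Real.ball_eq_Ioo]
    congr 1; ring

lemma vol_cb {n : ℕ} (c : Fin n → ℝ) {r : ℝ} (hr : 0 ≤ r) :
    volume (Metric.closedBall c r) = ENNReal.ofReal ((2 * r) ^ n) := by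
  rw [Real.volume_pi_closedBall _ hr, Fintype.card_fin]

lemma vol_cb_mul {n : ℕ} (c d : Fin n → ℝ) {r k : ℝ} (hr : 0 ≤ r) (hk : 0 ≤ k) :
    volume (Metric.closedBall c (k * r)) = ENNReal.ofReal (k ^ n) * volume (Metric.closedBall d r) := by
  rw [vol_cb _ hr, vol_cb _ (by positivity), ← ENNReal.ofReal_mul (by positivity), ← mul_pow]
  congr 2; ring

lemma vol_cb_pos {n : ℕ} (c : Fin n → ℝ) {r : ℝ} (hr : 0 < r) :
    volume (Metric.closedBall c r) ≠ 0 := by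
  rw [vol_cb _ hr.le]
  simp only [ne_eq, ENNReal.ofReal_eq_zero, not_le]; positivity

lemma vol_cb_top {n : ℕ} (c : Fin n → ℝ) {r : ℝ} :
    volume (Metric.closedBall c r) ≠ ∞ := measure_closedBall_lt_top.ne

lemma ball_ae_cb {n : ℕ} (c : Fin n → ℝ) {r : ℝ} (hr : 0 < r) :
    (Metric.ball c r : Set (Fin n → ℝ)) =ᵐ[volume] Metric.closedBall c r := by
  refine ae_eq_of_subset_of_measure_ge Metric.ball_subset_closedBall ?_
    measurableSet_ball.nullMeasurableSet (vol_cb_top c)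
  rw [vol_cb _ hr.le, Real.volume_pi_ball _ hr, Fintype.card_fin]

lemma setAvg_ball {n : ℕ} (c : Fin n → ℝ) {r : ℝ} (hr : 0 < r) (f : (Fin n → ℝ) → ℝ≥0∞) :
    setAvg (Metric.ball c r) f = setAvg (Metric.closedBall c r) f := by
  unfold setAvg
  rw [measure_congr (ball_ae_cb c hr), Measure.restrict_congr_set (ball_ae_cb c hr)]

lemma lt_maximal_iff {n : ℕ} (f : (Fin n → ℝ) → ℝ≥0∞) (x : Fin n → ℝ) (a : ℝ≥0∞) :
    a < maximal f x ↔ ∃ (c : Fin n → ℝ) (r : ℝ), 0 < r ∧ x ∈ Metric.ball c r ∧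
      a < setAvg (Metric.closedBall c r) f := by
  unfold maximal
  simp only [lt_iSup_iff, isCube_iff_ball]
  constructor
  · rintro ⟨Q, ⟨c, r, hr, rfl⟩, hx, h⟩
    exact ⟨c, r, hr, hx, by rwa [← setAvg_ball c hr]⟩
  · rintro ⟨c, r, hr, hx, h⟩
    exact ⟨_, ⟨c, r, hr, rfl⟩, hx, by rwa [setAvg_ball c hr]⟩

lemma setAvg_le_maximal {n : ℕ} (f : (Fin n → ℝ) → ℝ≥0∞) {x c : Fin n → ℝ} {r : ℝ} (hr : 0 < r)
    (hx : x ∈ Metric.ball c r) : setAvg (Metric.closedBall c r) f ≤ maximal f x := by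
  by_contra h
  push Not at h
  exact lt_irrefl _ ((lt_maximal_iff f x _).2 ⟨c, r, hr, hx, h⟩)

lemma measurable_maximal {n : ℕ} (f : (Fin n → ℝ) → ℝ≥0∞) : Measurable (maximal f) := by
  refine measurable_of_Ioi fun a => ?_
  apply IsOpen.measurableSet
  have : maximal f ⁻¹' Ioi a = ⋃ (c : Fin n → ℝ) (r : ℝ)
      (_ : 0 < r ∧ a < setAvg (Metric.closedBall c r) f), Metric.ball c r := by
    ext x
    simp only [mem_preimage, mem_Ioi, lt_maximal_iff, mem_iUnion, exists_prop]
    constructor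
    · rintro ⟨c, r, h1, h2, h3⟩; exact ⟨c, r, ⟨h1, h3⟩, h2⟩
    · rintro ⟨c, r, ⟨h1, h3⟩, h2⟩; exact ⟨c, r, h1, h2, h3⟩
  rw [this]
  exact isOpen_iUnion fun c => isOpen_iUnion fun r => isOpen_iUnion fun _ => Metric.isOpen_ball

lemma setAvg_mono {n : ℕ} (Q : Set (Fin n → ℝ)) {f g : (Fin n → ℝ) → ℝ≥0∞} (h : ∀ x, f x ≤ g x) :
    setAvg Q f ≤ setAvg Q g := by
  unfold setAvg; gcongr; exact h _

lemma maximal_mono {n : ℕ} {f g : (Fin n → ℝ) → ℝ≥0∞} (h : ∀ x, f x ≤ g x) (x : Fin n → ℝ) :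
    maximal f x ≤ maximal g x := by
  unfold maximal; gcongr with Q; exact setAvg_mono Q h

lemma setAvg_indicator {n : ℕ} (Q : Set (Fin n → ℝ)) {E : Set (Fin n → ℝ)} (hE : MeasurableSet E) :
    setAvg Q (E.indicator 1) = volume (E ∩ Q) / volume Q := by
  unfold setAvg; rw [lintegral_indicator_one hE, Measure.restrict_apply hE]

/-- Stopping-time Vitali covering lemma. -/
lemma covering {n : ℕ} {E : Set (Fin n → ℝ)} {s : ℝ} (hs0 : 0 < s) (hs : s < 1)
    {R : ℝ} (hR : 0 < R) (hE : volume E ≤ ENNReal.ofReal (s * (2 * R) ^ n)) :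
    ∃ u : Set ((Fin n → ℝ) × ℝ), u.Countable ∧
      (∀ a ∈ u, a.1 ∈ E ∧ 0 < a.2 ∧ a.2 < R ∧
        ENNReal.ofReal s * volume (Metric.closedBall a.1 a.2) < volume (E ∩ Metric.closedBall a.1 a.2) ∧
        ∀ r, 2 * a.2 ≤ r → volume (E ∩ Metric.closedBall a.1 r) ≤
          ENNReal.ofReal s * volume (Metric.closedBall a.1 r)) ∧
      u.PairwiseDisjoint (fun a => Metric.closedBall a.1 (2 * a.2)) ∧
      volume (E \ ⋃ a ∈ u, Metric.closedBall a.1 (10 * a.2)) = 0 := by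
  set T : Set ((Fin n → ℝ) × ℝ) := {a | a.1 ∈ E ∧ 0 < a.2 ∧ a.2 < R ∧
        ENNReal.ofReal s * volume (Metric.closedBall a.1 a.2) < volume (E ∩ Metric.closedBall a.1 a.2) ∧
        ∀ r, 2 * a.2 ≤ r → volume (E ∩ Metric.closedBall a.1 r) ≤
          ENNReal.ofReal s * volume (Metric.closedBall a.1 r)} with hT
  obtain ⟨u, huT, hdis, hcov⟩ := Vitali.exists_disjoint_subfamily_covering_enlargement_closedBall
    T (fun a => a.1) (fun a => 2 * a.2) (2 * R) (fun a ha => by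
      have := ha.2.2.1; linarith) 5 (by norm_num)
  refine ⟨u, ?_, fun a ha => huT ha, hdis, ?_⟩
  · refine hdis.countable_of_nonempty_interior fun a ha => ?_
    have h2 := (huT ha).2.1
    refine ⟨a.1, Metric.ball_subset_interior_closedBall (Metric.mem_ball_self (by positivity))⟩
  · have hd := IsUnifLocDoublingMeasure.ae_tendsto_measure_inter_div
      (volume : Measure (Fin n → ℝ)) E 1
    have key : ∀ᵐ x ∂(volume.restrict E), x ∈ E → ∃ r, (x, r) ∈ T := by
      filter_upwards [hd] with x hx hxE
      have h1 := hx (l := nhdsWithin (0 : ℝ) (Ioi 0)) (fun _ => x) (fun δ => δ) Filter.tendsto_id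
        (by filter_upwards [self_mem_nhdsWithin] with δ hδ
            have : (0:ℝ) < δ := hδ
            simp [this.le])
      have h2 : ∀ᶠ δ in nhdsWithin (0 : ℝ) (Ioi 0), ENNReal.ofReal s <
          volume (E ∩ Metric.closedBall x δ) / volume (Metric.closedBall x δ) := by
        refine h1.eventually_const_lt ?_
        rw [ENNReal.ofReal_lt_one]; exact hs
      obtain ⟨r0, hr0, hr0'⟩ := (h2.and self_mem_nhdsWithin).exists
      have hr0p : 0 < r0 := hr0'
      set S : Set ℝ := {r | 0 < r ∧ ENNReal.ofReal s * volume (Metric.closedBall x r) <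
        volume (E ∩ Metric.closedBall x r)} with hS
      have hSR : ∀ r ∈ S, r < R := by
        rintro r ⟨hr, hr2⟩
        by_contra hcon
        push Not at hcon
        refine absurd hr2 (not_lt.2 ?_)
        calc volume (E ∩ Metric.closedBall x r) ≤ volume E := measure_mono inter_subset_left
          _ ≤ _ := hE
          _ ≤ _ := by
            rw [vol_cb _ hr.le, ← ENNReal.ofReal_mul hs0.le]
            gcongr
      have hr0S : r0 ∈ S := ⟨hr0p, by
        rwa [ENNReal.lt_div_iff_mul_lt (Or.inl (vol_cb_pos x hr0p)) (Or.inl (vol_cb_top x))] at hr0⟩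
      have hbdd : BddAbove S := ⟨R, fun r hr => (hSR r hr).le⟩
      have hsup : 0 < sSup S := hr0p.trans_le (le_csSup hbdd hr0S)
      obtain ⟨r, hrS, hr⟩ := exists_lt_of_lt_csSup ⟨r0, hr0S⟩ (half_lt_self hsup)
      refine ⟨r, hxE, hrS.1, hSR r hrS, hrS.2, fun r' hr' => ?_⟩
      by_contra hcon
      push Not at hcon
      have : r' ∈ S := ⟨by linarith [hrS.1], hcon⟩
      linarith [le_csSup hbdd this]
    have key2 : ∀ᵐ x ∂(volume.restrict E), x ∉ E \ ⋃ a ∈ u, Metric.closedBall a.1 (10 * a.2) := by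
      filter_upwards [key] with x hx
      rintro ⟨hxE, hxn⟩
      obtain ⟨r, hr⟩ := hx hxE
      obtain ⟨b, hb, hsub⟩ := hcov _ hr
      apply hxn
      simp only [mem_iUnion]
      refine ⟨b, hb, ?_⟩
      have := hsub (Metric.mem_closedBall_self (by have := hr.2.1; simp only at this ⊢; linarith))
      convert this using 2
      ring
    have := measure_eq_zero_iff_ae_notMem.2 key2
    rw [Measure.restrict_eq_self _ sdiff_subset] at this
    exact this


lemma level_lower {n : ℕ} {E : Set (Fin n → ℝ)} (hEm : MeasurableSet E) {z : Fin n → ℝ} {R : ℝ}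
    (hR : 0 < R) (hEQ : E ⊆ Metric.closedBall z R) {s : ℝ} (hs0 : 0 < s) (hs : s < 1)
    (hE : volume E ≤ ENNReal.ofReal s * volume (Metric.closedBall z R)) :
    volume E ≤ ENNReal.ofReal (s * 10 ^ n) *
      volume ({x | ENNReal.ofReal s ≤ maximal (E.indicator 1) x} ∩ Metric.closedBall z (2 * R)) := by
  obtain ⟨u, huc, hu, hdis, hcov⟩ := covering (E := E) hs0 hs hR (by
    rwa [vol_cb _ hR.le, ← ENNReal.ofReal_mul hs0.le] at hE)
  have hdis' : u.PairwiseDisjoint (fun a => Metric.ball a.1 a.2) := by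
    refine hdis.mono_on fun a ha => ?_
    have := (hu a ha).2.1
    exact Metric.ball_subset_closedBall.trans (Metric.closedBall_subset_closedBall (by linarith))
  have : Countable u := huc.to_subtype
  calc volume E ≤ volume (E ∩ ⋃ a ∈ u, Metric.closedBall a.1 (10 * a.2)) +
        volume (E \ ⋃ a ∈ u, Metric.closedBall a.1 (10 * a.2)) := measure_le_inter_add_sdiff _ _ _
    _ = volume (⋃ a ∈ u, E ∩ Metric.closedBall a.1 (10 * a.2)) := by
        rw [hcov, add_zero, inter_iUnion₂]
    _ ≤ ∑' a : u, volume (E ∩ Metric.closedBall a.1.1 (10 * a.1.2)) := measure_biUnion_le _ huc _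
    _ ≤ ∑' a : u, ENNReal.ofReal (s * 10 ^ n) * volume (Metric.ball a.1.1 a.1.2) := by
        refine ENNReal.tsum_le_tsum fun a => ?_
        have h := hu a.1 a.2
        refine (h.2.2.2.2 _ (by linarith [h.2.1])).trans ?_
        rw [vol_cb_mul a.1.1 a.1.1 h.2.1.le (by norm_num), measure_congr (ball_ae_cb _ h.2.1),
          ENNReal.ofReal_mul hs0.le, mul_assoc]
    _ = ENNReal.ofReal (s * 10 ^ n) * volume (⋃ a ∈ u, Metric.ball a.1 a.2) := by
        rw [ENNReal.tsum_mul_left, measure_biUnion huc hdis' fun a _ => measurableSet_ball]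
    _ ≤ _ := by
        gcongr
        refine iUnion₂_subset fun a ha x hx => ?_
        have h := hu a ha
        constructor
        · refine le_trans ?_ (setAvg_le_maximal _ h.2.1 hx)
          rw [setAvg_indicator _ hEm, ENNReal.le_div_iff_mul_le (Or.inl (vol_cb_pos _ h.2.1))
            (Or.inl (vol_cb_top _))]
          exact h.2.2.2.1.le
        · have h1 : dist a.1 z ≤ R := hEQ h.1
          have h2 : dist x a.1 < a.2 := hx
          have := dist_triangle x a.1 z
          rw [Metric.mem_closedBall]
          linarith [h.2.2.1]

lemma half_add (k : ℕ) : (2⁻¹ : ℝ≥0∞) ^ (k + 1) + 2⁻¹ ^ (k + 1) = 2⁻¹ ^ k := by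
  rw [pow_succ, ← mul_add, ENNReal.inv_two_add_inv_two, mul_one]

lemma layer_sum (g : ℝ≥0∞) (m : ℕ) :
    (2⁻¹ ^ m ≤ g → (∑ i ∈ Finset.range m, if 2⁻¹ ^ (i + 1) ≤ g then (2⁻¹ : ℝ≥0∞) ^ (i + 2) else 0)
        + 2⁻¹ ^ (m + 1) ≤ g) ∧
    (g < 2⁻¹ ^ m → (∑ i ∈ Finset.range m, if 2⁻¹ ^ (i + 1) ≤ g then (2⁻¹ : ℝ≥0∞) ^ (i + 2) else 0)
        = 0) := by
  induction m with
  | zero =>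
    refine ⟨fun h => ?_, fun _ => by simp⟩
    simp only [Finset.range_zero, Finset.sum_empty, zero_add, pow_one]
    refine le_trans ?_ h
    simp
  | succ m ih =>
    rw [Finset.sum_range_succ]
    have hanti : (2⁻¹ : ℝ≥0∞) ^ (m + 1) ≤ 2⁻¹ ^ m := by
      rw [← half_add m]; exact le_self_add
    constructor
    · intro h
      rw [if_pos h, add_assoc, half_add (m + 1)]
      rcases le_or_gt (2⁻¹ ^ m) g with h1 | h1
      · exact ih.1 h1
      · rw [ih.2 h1, zero_add]; exact h
    · intro h
      rw [if_neg (not_le.2 h), ih.2 (h.trans_le hanti), zero_add]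

lemma layer_sum_le (g : ℝ≥0∞) (m : ℕ) :
    (∑ i ∈ Finset.range m, if 2⁻¹ ^ (i + 1) ≤ g then (2⁻¹ : ℝ≥0∞) ^ (i + 2) else 0) ≤ g := by
  rcases le_or_gt (2⁻¹ ^ m) g with h1 | h1
  · exact le_self_add.trans ((layer_sum g m).1 h1)
  · rw [(layer_sum g m).2 h1]; exact zero_le

lemma log_lower {n : ℕ} {E : Set (Fin n → ℝ)} (hEm : MeasurableSet E) {z : Fin n → ℝ} {R : ℝ}
    (hR : 0 < R) (hEQ : E ⊆ Metric.closedBall z R) (m : ℕ)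
    (hE : 2 ^ m * volume E ≤ volume (Metric.closedBall z R)) (x : Fin n → ℝ)
    (hx : x ∈ Metric.closedBall z R) :
    (m : ℝ≥0∞) * volume E ≤ ENNReal.ofReal (2 * 20 ^ n) * volume (Metric.closedBall z R) *
      maximal (maximal (E.indicator 1)) x := by
  set g := maximal (E.indicator (1 : (Fin n → ℝ) → ℝ≥0∞)) with hg
  have hgm : Measurable g := measurable_maximal _
  have h2 : ∀ k : ℕ, ENNReal.ofReal ((1 / 2 : ℝ) ^ k) = 2⁻¹ ^ k := fun k => by
    rw [ENNReal.ofReal_pow (by norm_num), one_div, ENNReal.ofReal_inv_of_pos (by norm_num)]; simp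
  have hcancel : ∀ k : ℕ, (2 : ℝ≥0∞) ^ k * 2⁻¹ ^ k = 1 := fun k => by
    rw [← mul_pow, ENNReal.mul_inv_cancel (by norm_num) (by norm_num), one_pow]
  have hlev : ∀ i ∈ Finset.range m, volume E ≤ ENNReal.ofReal (2 * 10 ^ n) *
      ∫⁻ y in Metric.closedBall z (2 * R), if 2⁻¹ ^ (i + 1) ≤ g y then (2⁻¹ : ℝ≥0∞) ^ (i + 2) else 0 := by
    intro i hi
    have hi' : i + 1 ≤ m := Finset.mem_range.1 hi
    have hsm : MeasurableSet {x | (2⁻¹ : ℝ≥0∞) ^ (i + 1) ≤ g x} := measurableSet_le measurable_const hgm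
    have h := level_lower hEm hR hEQ (s := (1 / 2) ^ (i + 1)) (by positivity)
      (pow_lt_one₀ (by norm_num) (by norm_num) (by simp)) (by
        rw [h2]
        calc volume E = 2⁻¹ ^ (i + 1) * (2 ^ (i + 1) * volume E) := by
              rw [← mul_assoc, mul_comm (2⁻¹ ^ (i + 1)), hcancel, one_mul]
          _ ≤ 2⁻¹ ^ (i + 1) * (2 ^ m * volume E) := by
              gcongr; norm_num
          _ ≤ _ := by gcongr)
    rw [h2] at h
    refine h.trans (le_of_eq ?_)
    have : (fun y => if 2⁻¹ ^ (i + 1) ≤ g y then (2⁻¹ : ℝ≥0∞) ^ (i + 2) else 0) =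
      {x | (2⁻¹ : ℝ≥0∞) ^ (i + 1) ≤ g x}.indicator (fun _ => (2⁻¹ : ℝ≥0∞) ^ (i + 2)) := by
      ext y; simp [indicator]
    rw [this, lintegral_indicator_const hsm, Measure.restrict_apply hsm, ← mul_assoc]
    congr 1
    rw [ENNReal.ofReal_mul (by positivity), h2, ENNReal.ofReal_mul (by norm_num), pow_succ 2⁻¹ (i+1),
      ENNReal.ofReal_ofNat]
    have : (2 : ℝ≥0∞) * 2⁻¹ = 1 := ENNReal.mul_inv_cancel (by norm_num) (by norm_num)
    calc _ = (2⁻¹ : ℝ≥0∞) ^ (i + 1) * ENNReal.ofReal (10 ^ n) * (2 * 2⁻¹) := by rw [this, mul_one]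
      _ = _ := by ring
  have hsum : (m : ℝ≥0∞) * volume E ≤ ENNReal.ofReal (2 * 10 ^ n) *
      ∫⁻ y in Metric.closedBall z (2 * R), g y := by
    calc (m : ℝ≥0∞) * volume E = ∑ i ∈ Finset.range m, volume E := by simp
      _ ≤ _ := Finset.sum_le_sum hlev
      _ = ENNReal.ofReal (2 * 10 ^ n) * ∫⁻ y in Metric.closedBall z (2 * R),
          ∑ i ∈ Finset.range m, if 2⁻¹ ^ (i + 1) ≤ g y then (2⁻¹ : ℝ≥0∞) ^ (i + 2) else 0 := by
        rw [lintegral_finset_sum, Finset.mul_sum]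
        intro i _
        exact Measurable.ite (measurableSet_le measurable_const hgm) measurable_const measurable_const
      _ ≤ _ := by gcongr; exact layer_sum_le _ _
  have hR2 : 0 < 2 * R := by positivity
  have hx2 : x ∈ Metric.ball z (2 * R) := by
    have : dist x z ≤ R := hx
    rw [Metric.mem_ball]; linarith
  have hav := setAvg_le_maximal g hR2 hx2
  unfold setAvg at hav
  rw [ENNReal.div_le_iff (vol_cb_pos _ hR2) (vol_cb_top _)] at hav
  refine hsum.trans ?_
  calc _ ≤ ENNReal.ofReal (2 * 10 ^ n) * (maximal g x * volume (Metric.closedBall z (2 * R))) := by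
        gcongr
    _ = _ := by
      rw [vol_cb_mul z z hR.le (by norm_num)]
      have : ENNReal.ofReal (2 * 20 ^ n) = ENNReal.ofReal (2 * 10 ^ n) * ENNReal.ofReal (2 ^ n) := by
        rw [← ENNReal.ofReal_mul (by positivity), mul_assoc, ← mul_pow]; norm_num
      rw [this]; ring

lemma simple_lower {n : ℕ} {E : Set (Fin n → ℝ)} (hEm : MeasurableSet E) {z : Fin n → ℝ} {R : ℝ}
    (hR : 0 < R) (hEQ : E ⊆ Metric.closedBall z R) (x : Fin n → ℝ)
    (hx : x ∈ Metric.ball z R) :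
    volume E ≤ volume (Metric.closedBall z R) * maximal (E.indicator 1) x := by
  have hav := setAvg_le_maximal (E.indicator 1) hR hx
  rw [setAvg_indicator _ hEm, ENNReal.div_le_iff (vol_cb_pos _ hR) (vol_cb_top _),
    inter_eq_left.2 hEQ, mul_comm] at hav
  exact hav


lemma wDist_mono {n : ℕ} (w : (Fin n → ℝ) → ℝ≥0∞) {f g : (Fin n → ℝ) → ℝ≥0∞} (h : ∀ x, f x ≤ g x)
    (s : ℝ) : wDist volume w f s ≤ wDist volume w g s := by
  unfold wDist
  exact lintegral_mono_set fun x hx => lt_of_lt_of_le hx (h x)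

lemma lorentz_mono {n : ℕ} (w : (Fin n → ℝ) → ℝ≥0∞) {p : ℝ} (hp : 1 < p) (q : ℝ≥0∞)
    {f g : (Fin n → ℝ) → ℝ≥0∞} (h : ∀ x, f x ≤ g x) :
    lorentzNorm volume w p q f ≤ lorentzNorm volume w p q g := by
  unfold lorentzNorm
  have hp0 : 0 ≤ 1 / p := by positivity
  have hq0 : 0 ≤ q.toReal / p := by positivity
  have hq1 : 0 ≤ 1 / q.toReal := by positivity
  split_ifs
  · gcongr with s _; exact wDist_mono w h _
  · gcongr with s _; exact wDist_mono w h _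

lemma wDist_indicator {n : ℕ} (w : (Fin n → ℝ) → ℝ≥0∞) (E : Set (Fin n → ℝ)) {c s : ℝ} 
    (hs : 0 < s) : wDist volume w (E.indicator fun _ => ENNReal.ofReal c) s =
      if s < c then ∫⁻ x in E, w x else 0 := by
  unfold wDist
  split_ifs with h
  · congr 2
    ext x
    by_cases hx : x ∈ E
    · simp [hx, ENNReal.ofReal_lt_ofReal_iff (hs.trans h), h]
    · simp [hx]
  · have : {x | ENNReal.ofReal s < E.indicator (fun _ => ENNReal.ofReal c) x} = ∅ := by
      ext x
      by_cases hx : x ∈ E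
      · simp [hx]; exact ENNReal.ofReal_le_ofReal (not_lt.1 h)
      · simp [hx]
    rw [this]; simp

lemma lint_rpow {Q c : ℝ} (hQ : 1 ≤ Q) (hc : 0 < c) :
    ∫⁻ s in Ioo 0 c, ENNReal.ofReal (s ^ (Q - 1)) = ENNReal.ofReal (c ^ Q / Q) := by
  rw [← ofReal_integral_eq_lintegral_ofReal]
  · congr 1
    rw [← integral_Ioc_eq_integral_Ioo, ← intervalIntegral.integral_of_le hc.le,
      integral_rpow (Or.inl (by linarith))]
    rw [Real.zero_rpow (by linarith)]; simp
  · have := (intervalIntegral.intervalIntegrable_rpow' (a := 0) (b := c) (r := Q - 1) (by linarith))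
    rw [intervalIntegrable_iff_integrableOn_Ioo_of_le hc.le] at this
    exact this
  · filter_upwards [ae_restrict_mem measurableSet_Ioo] with s hs
    exact Real.rpow_nonneg hs.1.le _

lemma lorentz_indicator {p : ℝ} (hp : 1 < p) {q : ℝ≥0∞} (hq : 1 ≤ q) :
    ∃ κ₁ κ₂ : ℝ, 0 < κ₁ ∧ 0 < κ₂ ∧ ∀ {n : ℕ} (w : (Fin n → ℝ) → ℝ≥0∞) (E : Set (Fin n → ℝ)) (c : ℝ),
      0 < c → ENNReal.ofReal (κ₁ * c) * (∫⁻ x in E, w x) ^ (1 / p) ≤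
        lorentzNorm volume w p q (E.indicator fun _ => ENNReal.ofReal c) ∧ 
        lorentzNorm volume w p q (E.indicator fun _ => ENNReal.ofReal c) ≤
        ENNReal.ofReal (κ₂ * c) * (∫⁻ x in E, w x) ^ (1 / p) := by
  have hp0 : 0 < 1 / p := by positivity
  by_cases hqt : q = ∞
  · refine ⟨1 / 2, 1, by norm_num, by norm_num, fun w E c hc => ?_⟩
    unfold lorentzNorm
    rw [if_pos hqt]
    constructor
    · have hc2 : 0 < 1 / 2 * c := by positivity
      refine le_trans ?_ (le_iSup₂ (1 / 2 * c) hc2)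
      rw [wDist_indicator w E hc2, if_pos (by linarith)]
    · refine iSup₂_le fun s hs => ?_
      rw [wDist_indicator w E hs]
      split_ifs with h
      · gcongr; linarith
      · simp [ENNReal.zero_rpow_of_pos, zero_lt_one.trans hp]
  · set Q := q.toReal with hQdef
    have hQ : 1 ≤ Q := by
      rw [hQdef, ← ENNReal.toReal_one]; exact ENNReal.toReal_mono hqt hq
    have hQ0 : 0 < Q := by linarith
    have hpp : 0 < p := by linarith
    have hpQ : 0 < p / Q := by positivity
    refine ⟨(p / Q) ^ (1 / Q), (p / Q) ^ (1 / Q), by positivity, by positivity, fun w E c hc => ?_⟩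
    suffices h : lorentzNorm volume w p q (E.indicator fun _ => ENNReal.ofReal c) =
        ENNReal.ofReal ((p / Q) ^ (1 / Q) * c) * (∫⁻ x in E, w x) ^ (1 / p) from ⟨h.ge, h.le⟩
    unfold lorentzNorm
    rw [if_neg hqt]
    set W := ∫⁻ x in E, w x
    have h1 : ∫⁻ s in Ioi (0 : ℝ), ENNReal.ofReal s ^ Q *
        wDist volume w (E.indicator fun _ => ENNReal.ofReal c) s ^ (Q / p) / ENNReal.ofReal s =
        ENNReal.ofReal (c ^ Q / Q) * W ^ (Q / p) := by
      rw [← lint_rpow hQ hc, ← lintegral_mul_const _ (by fun_prop),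
        ← lintegral_indicator measurableSet_Ioi, ← lintegral_indicator measurableSet_Ioo]
      congr 1
      ext s
      by_cases hs : 0 < s
      · rw [indicator_of_mem (show s ∈ Ioi (0:ℝ) from hs), wDist_indicator w E hs]
        by_cases hsc : s < c
        · rw [indicator_of_mem (show s ∈ Ioo (0:ℝ) c from ⟨hs, hsc⟩), if_pos hsc,
            ENNReal.mul_div_right_comm, ← ENNReal.ofReal_rpow_of_pos hs]
          congr 1
          rw [ENNReal.rpow_sub _ _ (by simpa using hs) ENNReal.ofReal_ne_top, ENNReal.rpow_one]
        · rw [indicator_of_notMem (fun h : s ∈ Ioo (0:ℝ) c => hsc h.2), if_neg hsc,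
            ENNReal.zero_rpow_of_pos (by positivity)]
          simp
      · rw [indicator_of_notMem (by simpa using hs), indicator_of_notMem (fun h : s ∈ Ioo (0:ℝ) c => hs h.1)]
    rw [h1, ← mul_assoc, ← ENNReal.ofReal_mul hpp.le, ENNReal.mul_rpow_of_nonneg _ _ (by positivity),
      ← ENNReal.rpow_mul, ENNReal.ofReal_rpow_of_nonneg (by positivity) (by positivity)]
    congr 2
    · rw [show p * (c ^ Q / Q) = p / Q * c ^ Q by ring, Real.mul_rpow hpQ.le (by positivity),
        ← Real.rpow_mul hc.le, mul_one_div_cancel hQ0.ne', Real.rpow_one]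
    · rw [← hQdef]; field_simp

/-- Key consequence of boundedness. -/
lemma bounded_consequence {n : ℕ} {p : ℝ} (hp : 1 < p) {q : ℝ≥0∞} (hq : 1 ≤ q)
    {w : (Fin n → ℝ) → ℝ≥0∞} {C : ℝ≥0∞} (hC : C ≠ ∞)
    (H : ∀ f : (Fin n → ℝ) → ℝ≥0∞, Measurable f →
        lorentzNorm volume w p q (maximal f) ≤ C * lorentzNorm volume w p q f) :
    ∃ K : ℝ, 0 < K ∧ ∀ (z : Fin n → ℝ) (R : ℝ), 0 < R → ∀ E : Set (Fin n → ℝ), MeasurableSet E →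
      E ⊆ Metric.closedBall z R → ∀ m : ℕ, 2 ^ m * volume E ≤ volume (Metric.closedBall z R) →
      ((m : ℝ≥0∞) + 1) * volume E * (∫⁻ x in Metric.closedBall z R, w x) ^ (1 / p) ≤
        ENNReal.ofReal K * volume (Metric.closedBall z R) * (∫⁻ x in E, w x) ^ (1 / p) := by
  obtain ⟨κ₁, κ₂, hκ₁, hκ₂, hκ⟩ := lorentz_indicator hp hq
  -- generic step: if a real constant lower bounds `g` on the ball
  have gen : ∀ (z : Fin n → ℝ) (R : ℝ), 0 < R → ∀ (E : Set (Fin n → ℝ)) (k K' : ℝ) (D : ℝ≥0∞)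
      (g : (Fin n → ℝ) → ℝ≥0∞),  0 < K' → 0 ≤ k → E ⊆ Metric.closedBall z R → 
      (∀ x ∈ Metric.ball z R, ENNReal.ofReal k * volume E ≤ ENNReal.ofReal K' *
        volume (Metric.closedBall z R) * g x) →
      lorentzNorm volume w p q g ≤ D * lorentzNorm volume w p q (E.indicator 1) →
      ENNReal.ofReal k * volume E * (∫⁻ x in Metric.closedBall z R, w x) ^ (1 / p) ≤
        D * ENNReal.ofReal (κ₂ / κ₁ * K') * volume (Metric.closedBall z R) *
          (∫⁻ x in E, w x) ^ (1 / p) := by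
    intro z R hR E k K' D g hK' hk hE hg hn
    have hEt : volume E ≠ ∞ := ne_top_of_le_ne_top (vol_cb_top z) (measure_mono hE)
    obtain ⟨v, hv0, hv⟩ : ∃ v : ℝ, 0 ≤ v ∧ volume E = ENNReal.ofReal v :=
      ⟨_, ENNReal.toReal_nonneg, (ENNReal.ofReal_toReal hEt).symm⟩
    obtain ⟨V, hVp, hV⟩ : ∃ V : ℝ, 0 < V ∧ volume (Metric.closedBall z R) = ENNReal.ofReal V :=
      ⟨_, ENNReal.toReal_pos (vol_cb_pos z hR) (vol_cb_top z),
        (ENNReal.ofReal_toReal (vol_cb_top z)).symm⟩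
    rw [hv, hV] at hg ⊢
    rcases (mul_nonneg hk hv0).eq_or_lt with h0 | h0
    · rw [← ENNReal.ofReal_mul hk, ← h0]; simp
    set c := k * v / (K' * V) with hc
    have hcp : 0 < c := by positivity
    have h1 : ∀ x, (Metric.ball z R).indicator (fun _ => ENNReal.ofReal c) x ≤ g x := by
      intro x
      by_cases hx : x ∈ Metric.ball z R
      · rw [indicator_of_mem hx, hc, ENNReal.ofReal_div_of_pos (by positivity)]
        refine ENNReal.div_le_of_le_mul ?_
        rw [ENNReal.ofReal_mul hk, ENNReal.ofReal_mul hK'.le, mul_comm (g x)]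
        exact hg x hx
      · rw [indicator_of_notMem hx]; exact zero_le
    have h2 := (hκ w (Metric.ball z R) c hcp).1.trans ((lorentz_mono w hp q h1).trans hn)
    have h3 : E.indicator (1 : (Fin n → ℝ) → ℝ≥0∞) = E.indicator fun _ => ENNReal.ofReal 1 := by
      rw [ENNReal.ofReal_one]; rfl
    rw [h3] at h2
    have h4 := h2.trans (mul_le_mul_right (hκ w E 1 one_pos).2 D)
    rw [Measure.restrict_congr_set (ball_ae_cb z hR)] at h4
    calc _ = ENNReal.ofReal (K' * V / κ₁) * (ENNReal.ofReal (κ₁ * c) * 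
          (∫⁻ x in Metric.closedBall z R, w x) ^ (1 / p)) := by
          rw [← mul_assoc, ← ENNReal.ofReal_mul hk,
            ← ENNReal.ofReal_mul (p := K' * V / κ₁) (by positivity)]
          congr 2; rw [hc]; field_simp
      _ ≤ _ := mul_le_mul_right h4 _
      _ = _ := by
        rw [mul_one κ₂, show κ₂ / κ₁ * K' = κ₂ * (K' / κ₁) by ring, ENNReal.ofReal_mul (by positivity),
          show K' * V / κ₁ = K' / κ₁ * V by ring, ENNReal.ofReal_mul (by positivity)]
        ring
  set K₁ := κ₂ / κ₁ * 1 * C.toReal 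
  set K₂ := κ₂ / κ₁ * (2 * 20 ^ n) * (C.toReal * C.toReal)
  have hCr : C = ENNReal.ofReal C.toReal := (ENNReal.ofReal_toReal hC).symm
  have hC0 : 0 ≤ C.toReal := ENNReal.toReal_nonneg
  refine ⟨K₁ + K₂ + 1, by positivity, fun z R hR E hEm hE m hm => ?_⟩
  have hind : Measurable (E.indicator (1 : (Fin n → ℝ) → ℝ≥0∞)) := measurable_one.indicator hEm
  have a1 := gen z R hR E 1 1 C (maximal (E.indicator 1)) one_pos zero_le_one hE (fun x hx => by
    simpa using simple_lower hEm hR hE x hx) (H _ hind)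
  have a2 := gen z R hR E m (2 * 20 ^ n) (C * C) (maximal (maximal (E.indicator 1))) (by positivity)
    (by positivity) hE (fun x hx => by
      rw [ENNReal.ofReal_natCast]
      exact log_lower hEm hR hE m hm x (Metric.ball_subset_closedBall hx))
    ((H _ (measurable_maximal _)).trans (by rw [mul_assoc]; exact mul_le_mul_right (H _ hind) _))
  calc _ = ENNReal.ofReal m * volume E * (∫⁻ x in Metric.closedBall z R, w x) ^ (1 / p) + 
        ENNReal.ofReal 1 * volume E * (∫⁻ x in Metric.closedBall z R, w x) ^ (1 / p) := by
        rw [ENNReal.ofReal_one, ENNReal.ofReal_natCast]; ring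
    _ ≤ _ := add_le_add a2 a1
    _ = ENNReal.ofReal (K₁ + K₂) * volume (Metric.closedBall z R) * (∫⁻ x in E, w x) ^ (1 / p) := by
        rw [ENNReal.ofReal_add (by positivity) (by positivity), ENNReal.ofReal_mul (q := C.toReal) (by positivity),
          ENNReal.ofReal_mul (q := C.toReal * C.toReal) (by positivity), ENNReal.ofReal_mul hC0, ← hCr]
        ring
    _ ≤ _ := by
        refine mul_le_mul_left (mul_le_mul_left (ENNReal.ofReal_le_ofReal ?_) _) _
        linarith


lemma dyadic_le (y : ℝ≥0∞) : y ≤ 1 + ∑' k : ℕ, if (2 : ℝ≥0∞) ^ k ≤ y then (2 : ℝ≥0∞) ^ (k + 1) else 0 := by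
  rcases eq_or_ne y ∞ with rfl | hy
  · have : (∑' k : ℕ, if (2 : ℝ≥0∞) ^ k ≤ ∞ then (2 : ℝ≥0∞) ^ (k + 1) else 0) = ∞ := by
      exact eq_top_iff.2 ((ENNReal.tsum_const_eq_top_of_ne_zero (α := ℕ) (c := 1) one_ne_zero).symm.le.trans
        (ENNReal.tsum_le_tsum fun k => by rw [if_pos le_top]; exact one_le_pow₀ (by norm_num)))
    rw [this]; simp
  · rcases le_total y 1 with h | h
    · exact h.trans le_self_add
    · lift y to ℝ≥0 using hy
      have h' : 1 ≤ y := by exact_mod_cast h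
      obtain ⟨k, hk1, hk2⟩ := exists_nat_pow_near h' (show (1 : ℝ≥0) < 2 by norm_num)
      refine le_trans ?_ (le_trans (ENNReal.le_tsum k) le_add_self)
      rw [if_pos (by exact_mod_cast hk1)]
      exact_mod_cast hk2.le

lemma real_step {p K ε t M : ℝ} (hp : 1 < p) (hK : 0 < K) (hε : 0 ≤ ε) (ht : 0 < t) (hM : 1 ≤ M)
    (h : M * ε ≤ K * (t ^ (p - 1) * ε) ^ (1 / p)) :
    ε ≤ K ^ (p / (p - 1)) * M ^ (-(p / (p - 1))) * t := by
  have hM0 : 0 < M := by linarith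
  rcases hε.eq_or_lt with rfl | hε
  · positivity
  have hp0 : 0 < p := by linarith
  have hp1 : 0 < p - 1 := by linarith
  have hE : ε = ε ^ ((p - 1) / p) * ε ^ (1 / p) := by
    rw [← Real.rpow_add hε, ← add_div, sub_add_cancel, div_self hp0.ne', Real.rpow_one]
  rw [Real.mul_rpow (by positivity) hε.le, ← Real.rpow_mul ht.le] at h
  have h2 : M * ε ^ ((p - 1) / p) ≤ K * t ^ ((p - 1) * (1 / p)) := by
    have : 0 < ε ^ (1 / p) := by positivity
    refine le_of_mul_le_mul_right ?_ this
    calc _ = M * ε := by rw [mul_assoc, ← hE]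
      _ ≤ _ := h
      _ = _ := by ring
  have h3 := Real.rpow_le_rpow (by positivity) h2 (show 0 ≤ p / (p - 1) by positivity)
  rw [Real.mul_rpow hM0.le (by positivity), Real.mul_rpow hK.le (by positivity), ← Real.rpow_mul hε.le,
    ← Real.rpow_mul ht.le] at h3
  rw [show (p - 1) / p * (p / (p - 1)) = 1 by field_simp,
    show (p - 1) * (1 / p) * (p / (p - 1)) = 1 by field_simp, Real.rpow_one, Real.rpow_one] at h3
  rw [Real.rpow_neg hM0.le]
  have : 0 < M ^ (p / (p - 1)) := by positivity
  field_simp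
  linarith

lemma one_sub_conj {p : ℝ} (hp : 1 < p) : 1 - conjExp p = -(1 / (p - 1)) := by
  have : p - 1 ≠ 0 := by linarith
  unfold conjExp; field_simp; ring

lemma necessity_finite {n : ℕ} {p : ℝ} (hp : 1 < p) {K : ℝ} (hK : 0 < K) :
    ∃ S : ℝ, 0 ≤ S ∧ ∀ (w : (Fin n → ℝ) → ℝ≥0∞) (_ : Measurable w) (Q : Set (Fin n → ℝ)) (_ : MeasurableSet Q) (V W : ℝ),
    0 < V → 0 < W → volume Q = ENNReal.ofReal V → ∫⁻ x in Q, w x = ENNReal.ofReal W →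
    (∀ E : Set (Fin n → ℝ), MeasurableSet E → E ⊆ Q → ∀ m : ℕ, 2 ^ m * volume E ≤ volume Q →
      ((m : ℝ≥0∞) + 1) * volume E * (∫⁻ x in Q, w x) ^ (1 / p) ≤
        ENNReal.ofReal K * volume Q * (∫⁻ x in E, w x) ^ (1 / p)) →
    ∫⁻ x in Q, dualWeight p w x ≤ ENNReal.ofReal (S * V * (W / V) ^ (-(1 / (p - 1)))) := by
  have hp1 : 0 < p - 1 := by linarith
  have hp0 : 0 < p := by linarith
  set p' := p / (p - 1) with hp'
  have hp'1 : 1 < p' := by rw [hp', lt_div_iff₀ hp1]; linarith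
  set K₀ := K ^ p' with hK0
  have hK0p : 0 < K₀ := by positivity
  obtain ⟨k₁, hk₁⟩ := pow_unbounded_of_one_lt K₀ (show (1:ℝ) < 2 by norm_num)
  set L := K₀ * ((k₁ : ℝ) + 1) ^ p' with hL
  have hLp : 0 < L := by positivity
  have hsum : Summable fun k : ℕ => 2 * L * ((k : ℝ) + 1) ^ (-p') := by
    apply Summable.mul_left
    have h := (Real.summable_nat_rpow (p := -p')).2 (by linarith)
    have := (_root_.summable_nat_add_iff 1).2 h
    simpa using this
  set T := ∑' k : ℕ, 2 * L * ((k : ℝ) + 1) ^ (-p') with hT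
  have hT0 : 0 ≤ T := tsum_nonneg fun k => by positivity
  refine ⟨1 + T, by positivity, fun w hw Q hQ V W hV hW hQV hQW H => ?_⟩
  set A := W / V with hA
  have hAp : 0 < A := by positivity
  set B := A ^ (-(1 / (p - 1))) with hB
  have hBp : 0 < B := by positivity
  set σ := dualWeight p w with hσ
  have hσm : Measurable σ := by unfold σ dualWeight; fun_prop
  set E : ℕ → Set (Fin n → ℝ) := fun k => {x | (2 : ℝ≥0∞) ^ k ≤ σ x / ENNReal.ofReal B} ∩ Q with hE
  have hEm0 : ∀ k, MeasurableSet {x | (2 : ℝ≥0∞) ^ k ≤ σ x / ENNReal.ofReal B} := fun k =>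
    measurableSet_le measurable_const (hσm.div_const _)
  have hEm : ∀ k, MeasurableSet (E k) := fun k => (hEm0 k).inter hQ
  have hEw : ∀ k, ∀ x ∈ E k, w x ≤ ENNReal.ofReal (((1 / 2 : ℝ) ^ k) ^ (p - 1) * A) := by
    rintro k x ⟨hx, -⟩
    simp only [mem_ofPred_eq] at hx
    rw [ENNReal.le_div_iff_mul_le (Or.inl (by simpa using hBp)) (Or.inl ENNReal.ofReal_ne_top)] at hx
    have h2B : (2 : ℝ≥0∞) ^ k * ENNReal.ofReal B = ENNReal.ofReal (2 ^ k * B) := by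
      rw [ENNReal.ofReal_mul (by positivity), ENNReal.ofReal_pow (by norm_num)]; simp
    rw [h2B] at hx
    have hwx : w x = ((σ x) ^ (p - 1))⁻¹ := by
      rw [hσ, dualWeight, one_sub_conj hp, ← ENNReal.rpow_neg, ← ENNReal.rpow_mul]
      rw [show -(1 / (p - 1)) * -(p - 1) = 1 by field_simp, ENNReal.rpow_one]
    rw [hwx]
    refine (ENNReal.inv_le_inv.2 (ENNReal.rpow_le_rpow hx hp1.le)).trans (le_of_eq ?_)
    rw [ENNReal.ofReal_rpow_of_pos (by positivity), ← ENNReal.ofReal_inv_of_pos (by positivity)]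
    congr 1
    rw [Real.mul_rpow (by positivity) hBp.le, hB, ← Real.rpow_mul hAp.le,
      show -(1 / (p - 1)) * (p - 1) = -1 by field_simp, Real.rpow_neg_one, mul_inv, inv_inv,
      one_div, inv_pow, Real.inv_rpow (by positivity)]
  have hEsmall : ∀ k, 2 ^ (k + 1) * volume (E k) ≤
      ENNReal.ofReal (2 * L * ((k : ℝ) + 1) ^ (-p')) * ENNReal.ofReal V := by
    intro k
    have hfin : volume (E k) ≠ ∞ := ne_top_of_le_ne_top (by rw [hQV]; exact ENNReal.ofReal_ne_top)
      (measure_mono (inter_subset_right : E k ⊆ Q))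
    obtain ⟨e, he0, he⟩ : ∃ e : ℝ, 0 ≤ e ∧ volume (E k) = ENNReal.ofReal e :=
      ⟨_, ENNReal.toReal_nonneg, (ENNReal.ofReal_toReal hfin).symm⟩
    have hle : e ≤ V := by
      have := measure_mono (μ := volume) (inter_subset_right : E k ⊆ Q)
      rw [hQV, he] at this
      exact (ENNReal.ofReal_le_ofReal_iff hV.le).1 this
    have hwE : ∫⁻ x in E k, w x ≤ ENNReal.ofReal (((1 / 2 : ℝ) ^ k) ^ (p - 1) * A * e) := by
      refine (setLIntegral_mono measurable_const (hEw k)).trans ?_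
      rw [lintegral_const, Measure.restrict_apply_univ, he, ← ENNReal.ofReal_mul (by positivity)]
    have step : ∀ m : ℕ, 2 ^ m * (e / V) ≤ 1 →
        e / V ≤ K₀ * ((m : ℝ) + 1) ^ (-p') * (1 / 2) ^ k := by
      intro m hm
      have h := H (E k) (hEm k) inter_subset_right m (by
        rw [hQV, he, show (2 : ℝ≥0∞) = ENNReal.ofReal 2 by simp, ← ENNReal.ofReal_pow (by norm_num),
          ← ENNReal.ofReal_mul (by positivity)]
        apply ENNReal.ofReal_le_ofReal
        rw [← mul_div_assoc, div_le_one hV] at hm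
        exact hm)
      have h' := h.trans (mul_le_mul_right (ENNReal.rpow_le_rpow hwE (by positivity : 0 ≤ 1 / p)) _)
      rw [hQV, hQW, he, ENNReal.ofReal_rpow_of_pos hW, ENNReal.ofReal_rpow_of_nonneg (by positivity) (by positivity),
        show (m : ℝ≥0∞) + 1 = ENNReal.ofReal ((m : ℝ) + 1) by
          rw [ENNReal.ofReal_add (by positivity) (by norm_num)]; simp,
        ← ENNReal.ofReal_mul (by positivity), ← ENNReal.ofReal_mul (by positivity),
        ← ENNReal.ofReal_mul (by positivity), ← ENNReal.ofReal_mul (by positivity),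
        ENNReal.ofReal_le_ofReal_iff (by positivity)] at h'
      refine real_step hp hK (by positivity) (by positivity) (by linarith [(Nat.cast_nonneg m : (0:ℝ) ≤ m)]) ?_
      have hWp : 0 < W ^ (1 / p) := by positivity
      have : (((1 / 2 : ℝ) ^ k) ^ (p - 1) * A * e) ^ (1 / p) =
        (((1 / 2 : ℝ) ^ k) ^ (p - 1) * (e / V)) ^ (1 / p) * W ^ (1 / p) := by
        rw [← Real.mul_rpow (by positivity) hW.le]
        congr 1; rw [hA]; field_simp
      rw [this] at h'
      have h3 : ((m : ℝ) + 1) * e ≤ K * V * (((1 / 2 : ℝ) ^ k) ^ (p - 1) * (e / V)) ^ (1 / p) := by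
        refine le_of_mul_le_mul_right ?_ hWp
        linarith
      rw [← mul_div_assoc, div_le_iff₀ hV]
      linarith
    have s0 := step 0 (by rw [pow_zero, one_mul, div_le_one hV]; exact hle)
    simp only [Nat.cast_zero, zero_add, Real.one_rpow, mul_one] at s0
    have s1 := step (k - k₁) (by
      rcases le_total k k₁ with hk | hk
      · rw [Nat.sub_eq_zero_of_le hk, pow_zero, one_mul, div_le_one hV]; exact hle
      · have hkk : (2:ℝ) ^ k = 2 ^ (k - k₁) * 2 ^ k₁ := by rw [← pow_add, Nat.sub_add_cancel hk]
        calc (2:ℝ) ^ (k - k₁) * (e / V) ≤ 2 ^ (k - k₁) * (2 ^ k₁ * (1 / 2) ^ k) := by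
              gcongr; exact s0.trans (by gcongr)
          _ = 1 := by rw [← mul_assoc, ← hkk, ← mul_pow]; norm_num)
    have s2 : ((k - k₁ : ℕ) + 1 : ℝ) ^ (-p') ≤ ((k₁ : ℝ) + 1) ^ p' * ((k : ℝ) + 1) ^ (-p') := by
      have : ((k:ℝ) + 1) ≤ ((k₁ : ℝ) + 1) * ((k - k₁ : ℕ) + 1 : ℝ) := by
        have h1 : k ≤ (k - k₁) + k₁ := by omega
        have h1' : (k : ℝ) ≤ (k - k₁ : ℕ) + k₁ := by exact_mod_cast h1
        have h2 : 0 ≤ (k₁ : ℝ) * (k - k₁ : ℕ) := by positivity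
        linarith
      have h4 := Real.rpow_le_rpow (by positivity) this (show 0 ≤ p' by linarith)
      rw [Real.mul_rpow (by positivity) (by positivity)] at h4
      rw [Real.rpow_neg (by positivity), Real.rpow_neg (by positivity), ← div_eq_mul_inv,
        inv_le_comm₀ (by positivity) (by positivity), inv_div, div_le_iff₀ (by positivity), mul_comm]
      exact h4
    rw [he, show (2 : ℝ≥0∞) = ENNReal.ofReal 2 by simp, ← ENNReal.ofReal_pow (by norm_num),
      ← ENNReal.ofReal_mul (by positivity), ← ENNReal.ofReal_mul (by positivity)]
    apply ENNReal.ofReal_le_ofReal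
    have s3 : e / V ≤ L * ((k : ℝ) + 1) ^ (-p') * (1 / 2) ^ k := by
      have s4 : K₀ * ((k - k₁ : ℕ) + 1 : ℝ) ^ (-p') ≤ L * ((k : ℝ) + 1) ^ (-p') := by
        rw [hL, mul_assoc]; exact mul_le_mul_of_nonneg_left s2 hK0p.le
      exact s1.trans (by gcongr)
    rw [div_le_iff₀ hV] at s3
    calc (2:ℝ) ^ (k + 1) * e ≤ 2 ^ (k + 1) * (L * ((k : ℝ) + 1) ^ (-p') * (1 / 2) ^ k * V) := by gcongr
      _ = 2 * L * ((k : ℝ) + 1) ^ (-p') * V * (2 ^ k * (1 / 2) ^ k) := by ring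
      _ = _ := by rw [← mul_pow]; norm_num
  have hpt : ∀ x, σ x ≤ ENNReal.ofReal B * (1 + ∑' k : ℕ,
      {x | (2 : ℝ≥0∞) ^ k ≤ σ x / ENNReal.ofReal B}.indicator (fun _ => (2 : ℝ≥0∞) ^ (k + 1)) x) := by
    intro x
    have h := dyadic_le (σ x / ENNReal.ofReal B)
    rw [ENNReal.div_le_iff (by simpa using hBp) ENNReal.ofReal_ne_top, mul_comm] at h
    refine h.trans (le_of_eq ?_)
    simp [indicator]
  calc ∫⁻ x in Q, σ x ≤ ∫⁻ x in Q, ENNReal.ofReal B * (1 + ∑' k : ℕ,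
      {x | (2 : ℝ≥0∞) ^ k ≤ σ x / ENNReal.ofReal B}.indicator (fun _ => (2 : ℝ≥0∞) ^ (k + 1)) x) :=
        lintegral_mono hpt
    _ = ENNReal.ofReal B * (volume Q + ∑' k : ℕ, 2 ^ (k + 1) * volume (E k)) := by
        have hmi : ∀ k : ℕ, Measurable ({x | (2 : ℝ≥0∞) ^ k ≤ σ x / ENNReal.ofReal B}.indicator
          (fun _ => (2 : ℝ≥0∞) ^ (k + 1))) := fun k => measurable_const.indicator (hEm0 k)
        rw [lintegral_const_mul' _ _ ENNReal.ofReal_ne_top, lintegral_add_left measurable_const,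
          lintegral_tsum fun k => (hmi k).aemeasurable]
        congr 2
        · simp
        · congr 1; ext k
          rw [lintegral_indicator_const (hEm0 k), Measure.restrict_apply (hEm0 k)]
    _ ≤ ENNReal.ofReal B * (ENNReal.ofReal V + ∑' k : ℕ, 
        ENNReal.ofReal (2 * L * ((k : ℝ) + 1) ^ (-p')) * ENNReal.ofReal V) := by
        rw [hQV]; exact mul_le_mul' le_rfl (add_le_add le_rfl (ENNReal.tsum_le_tsum hEsmall))
    _ = ENNReal.ofReal ((1 + T) * V * B) := by
        rw [ENNReal.tsum_mul_right, ← ENNReal.ofReal_tsum_of_nonneg (fun k => by positivity) hsum,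
          ← ENNReal.ofReal_mul hT0, ← ENNReal.ofReal_add hV.le (by positivity),
          ← ENNReal.ofReal_mul hBp.le]
        congr 1; ring

theorem necessity {n : ℕ} {p : ℝ} (hp : 1 < p) {q : ℝ≥0∞} (hq : 1 ≤ q)
    {w : (Fin n → ℝ) → ℝ≥0∞} (hw : Measurable w) {C : ℝ≥0∞} (hC : C ≠ ∞)
    (H : ∀ f : (Fin n → ℝ) → ℝ≥0∞, Measurable f →
        lorentzNorm volume w p q (maximal f) ≤ C * lorentzNorm volume w p q f) :
    ApConst n p w ≠ ∞ := by
  have hp1 : 0 < p - 1 := by linarith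
  have hp0 : 0 < p := by linarith
  obtain ⟨K, hK, hcons⟩ := bounded_consequence hp hq hC H
  obtain ⟨S, hS, hfin⟩ := necessity_finite (n := n) hp hK
  refine ne_top_of_le_ne_top (ENNReal.ofReal_ne_top (r := S ^ (p - 1))) ?_
  unfold ApConst twoApConst
  refine iSup₂_le fun Q hQ => ?_
  obtain ⟨z, R, hR, rfl⟩ := (isCube_iff_ball n Q).1 hQ
  rw [setAvg_ball z hR, setAvg_ball z hR]
  have hc := hcons z R hR
  have hV0 := vol_cb_pos z hR
  have hVt := vol_cb_top z (r := R)
  set Q := Metric.closedBall z R with hQdef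
  have hQm : MeasurableSet Q := Metric.isClosed_closedBall.measurableSet
  rcases eq_or_ne (∫⁻ x in Q, w x) 0 with h0 | h0
  · simp [setAvg, h0]
  rcases eq_or_ne (∫⁻ x in Q, w x) ∞ with ht | ht
  · have hz : ∀ N : ℕ, volume ({x | w x ≤ N} ∩ Q) = 0 := by
      intro N
      have hm : MeasurableSet {x | w x ≤ N} := measurableSet_le hw measurable_const
      have h := hc ({x | w x ≤ N} ∩ Q) (hm.inter hQm) inter_subset_right 0 (by
        rw [pow_zero, one_mul]; exact measure_mono inter_subset_right)
      by_contra hne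
      rw [ht, ENNReal.top_rpow_of_pos (by positivity), Nat.cast_zero, zero_add, one_mul,
        ENNReal.mul_top hne, top_le_iff] at h
      refine absurd h (ENNReal.mul_ne_top (ENNReal.mul_ne_top ENNReal.ofReal_ne_top hVt)
        (ENNReal.rpow_ne_top_of_nonneg (by positivity) ?_))
      refine ne_top_of_le_ne_top ?_ (setLIntegral_mono (g := fun _ => (N : ℝ≥0∞)) measurable_const fun x hx => hx.1)
      rw [lintegral_const, Measure.restrict_apply_univ]
      exact ENNReal.mul_ne_top (by simp) (ne_top_of_le_ne_top hVt (measure_mono inter_subset_right))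
    have hσ : ∫⁻ x in Q, dualWeight p w x = 0 := by
      have : ∀ᵐ x ∂(volume.restrict Q), ∀ N : ℕ, ¬ w x ≤ N := by
        rw [ae_all_iff]
        intro N
        rw [ae_iff]
        simp only [not_not]
        rw [Measure.restrict_apply (measurableSet_le hw measurable_const)]
        exact hz N
      rw [lintegral_eq_zero_iff (by unfold dualWeight; fun_prop)]
      filter_upwards [this] with x hx
      have hwt : w x = ∞ := by
        by_contra hne
        obtain ⟨N, hN⟩ := ENNReal.exists_nat_gt hne
        exact hx N hN.le
      simp only [dualWeight, hwt, one_sub_conj hp, Pi.zero_apply]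
      exact ENNReal.top_rpow_of_neg (by simpa using hp1)
    simp [setAvg, hσ, hp1]
  · have hV : 0 < (volume Q).toReal := ENNReal.toReal_pos hV0 hVt
    have hW : 0 < (∫⁻ x in Q, w x).toReal := ENNReal.toReal_pos h0 ht
    have e1 := (ENNReal.ofReal_toReal hVt).symm
    have e2 := (ENNReal.ofReal_toReal ht).symm
    have h := hfin w hw Q hQm _ _ hV hW e1 e2 hc
    generalize (volume Q).toReal = V at *
    generalize (∫⁻ x in Q, w x).toReal = W at *
    unfold setAvg
    rw [e1, e2]
    calc _ ≤ ENNReal.ofReal W / ENNReal.ofReal V * (ENNReal.ofReal 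
          (S * V * (W / V) ^ (-(1 / (p - 1)))) / ENNReal.ofReal V) ^ (p - 1) := by gcongr
      _ = _ := by
        rw [← ENNReal.ofReal_div_of_pos hV, ← ENNReal.ofReal_div_of_pos hV,
          ENNReal.ofReal_rpow_of_nonneg (by positivity) hp1.le, ← ENNReal.ofReal_mul (by positivity)]
        congr 1
        have hA : 0 < W / V := by positivity
        rw [show S * V * (W / V) ^ (-(1 / (p - 1))) / V = S * (W / V) ^ (-(1 / (p - 1))) by field_simp,
          Real.mul_rpow hS (by positivity), ← Real.rpow_mul hA.le,
          show -(1 / (p - 1)) * (p - 1) = -1 by field_simp, Real.rpow_neg_one]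
        field_simp


lemma biUnion_sdiff_aux {α ι : Type*} (u : Set ι) (Q : ι → Set α) (E : Set α) :
    (⋃ a ∈ u, (Q a \ E)) = (⋃ a ∈ u, Q a) \ E := by
  ext x; simp only [mem_iUnion, mem_sdiff, exists_prop]
  constructor
  · rintro ⟨a, h1, h2, h3⟩; exact ⟨⟨a, h1, h2⟩, h3⟩
  · rintro ⟨⟨a, h1, h2⟩, h3⟩; exact ⟨a, h1, h2, h3⟩

set_option maxHeartbeats 800000 in
lemma one_step {n : ℕ} (μ : Measure (Fin n → ℝ)) (hμ : μ ≪ volume) {D : ℝ≥0∞}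
    (hD : ∀ (z : Fin n → ℝ) (R : ℝ), 0 < R → ∀ G, MeasurableSet G → G ⊆ Metric.closedBall z R →
      volume (Metric.closedBall z R) ≤ ENNReal.ofReal (11 ^ n * 2) * volume G → μ (Metric.closedBall z R) ≤ D * μ G)
    {z : Fin n → ℝ} {R : ℝ} (hR : 0 < R) {E : Set (Fin n → ℝ)} (hE : MeasurableSet E)
    (hEQ : E ⊆ Metric.closedBall z R)
    (hsm : volume E ≤ ENNReal.ofReal ((1 / 2) ^ (n + 1)) * volume (Metric.closedBall z R)) :
    ∃ E', MeasurableSet E' ∧ E' ⊆ Metric.closedBall z R ∧ volume E' ≤ ENNReal.ofReal (1 + 2 ^ (n + 1)) * volume E ∧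
      (1 + D) * μ E ≤ D * μ E' := by
  set s : ℝ := (1 / 2) ^ (n + 1) with hs
  have hs0 : 0 < s := by positivity
  have hs1 : s < 1 := pow_lt_one₀ (by norm_num) (by norm_num) (by omega)
  obtain ⟨u, huc, hu, hud, hucov⟩ := covering hs0 hs1 hR (E := E) (by
    rwa [vol_cb _ hR.le, ← ENNReal.ofReal_mul hs0.le] at hsm)
  set y : (Fin n → ℝ) × ℝ → (Fin n → ℝ) := fun a => a.1 + (a.2 / R) • (z - a.1) with hy
  have hyx : ∀ a ∈ u, dist (y a) a.1 ≤ a.2 := by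
    intro a ha
    obtain ⟨h1, h2, h3, -⟩ := hu a ha
    have h4 : ‖z - a.1‖ ≤ R := by
      have := hEQ h1
      rw [Metric.mem_closedBall, dist_comm, dist_eq_norm] at this
      exact this
    rw [dist_eq_norm, hy]
    simp only [add_sub_cancel_left, norm_smul, Real.norm_eq_abs, abs_of_pos (div_pos h2 hR)]
    calc a.2 / R * ‖z - a.1‖ ≤ a.2 / R * R := by gcongr
      _ = a.2 := by field_simp
  have hyz : ∀ a ∈ u, dist (y a) z ≤ R - a.2 := by
    intro a ha
    obtain ⟨h1, h2, h3, -⟩ := hu a ha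
    have h4 : ‖a.1 - z‖ ≤ R := by
      have := hEQ h1
      rw [Metric.mem_closedBall, dist_eq_norm] at this
      exact this
    have h5 : 0 ≤ 1 - a.2 / R := by rw [sub_nonneg, div_le_one hR]; exact h3.le
    have h6 : y a - z = (1 - a.2 / R) • (a.1 - z) := by
      rw [hy]; ext i; simp; ring
    rw [dist_eq_norm, h6, norm_smul, Real.norm_eq_abs, abs_of_nonneg h5]
    calc (1 - a.2 / R) * ‖a.1 - z‖ ≤ (1 - a.2 / R) * R := by gcongr
      _ = R - a.2 := by field_simp
  set Q : (Fin n → ℝ) × ℝ → Set (Fin n → ℝ) := fun a => Metric.closedBall (y a) a.2 with hQ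
  have hQm : ∀ a, MeasurableSet (Q a) := fun a => Metric.isClosed_closedBall.measurableSet
  have hQ2 : ∀ a ∈ u, Q a ⊆ Metric.closedBall a.1 (2 * a.2) := fun a ha =>
    Metric.closedBall_subset_closedBall' (by have := hyx a ha; linarith)
  have hQ0 : ∀ a ∈ u, Q a ⊆ Metric.closedBall z R := fun a ha =>
    Metric.closedBall_subset_closedBall' (by have := hyz a ha; linarith)
  have hQd : u.PairwiseDisjoint Q := fun a ha b hb hab =>
    (hud ha hb hab).mono (hQ2 a ha) (hQ2 b hb)
  have hEQa : ∀ a ∈ u, volume (E ∩ Q a) ≤ ENNReal.ofReal (1 / 2) * volume (Q a) := by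
    intro a ha
    obtain ⟨h1, h2, h3, h4, h5⟩ := hu a ha
    calc volume (E ∩ Q a) ≤ volume (E ∩ Metric.closedBall a.1 (2 * a.2)) :=
          measure_mono (inter_subset_inter_right _ (hQ2 a ha))
      _ ≤ _ := h5 _ le_rfl
      _ = _ := by
        rw [vol_cb_mul a.1 (y a) h2.le (by norm_num), ← mul_assoc, ← ENNReal.ofReal_mul hs0.le]
        congr 2
        rw [hs, pow_succ, mul_right_comm, ← mul_pow]; norm_num
  have hbig : ∀ a ∈ u, μ (Metric.closedBall a.1 (10 * a.2)) ≤ D * μ (Q a \ E) := by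
    intro a ha
    obtain ⟨h1, h2, h3, h4, h5⟩ := hu a ha
    refine (measure_mono (Metric.closedBall_subset_closedBall' ?_ :
      _ ⊆ Metric.closedBall (y a) (11 * a.2))).trans ?_
    · have := hyx a ha; rw [dist_comm] at this; linarith
    refine hD _ _ (by positivity) _ ((hQm a).diff hE) ?_ ?_
    · exact sdiff_subset.trans (Metric.closedBall_subset_closedBall (by linarith))
    · rw [vol_cb_mul (y a) (y a) h2.le (by norm_num), ENNReal.ofReal_mul (by positivity), mul_assoc]
      refine mul_le_mul' le_rfl ?_
      have hfin : volume (Q a) ≠ ∞ := vol_cb_top _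
      have h6 : volume (Q a) = volume (E ∩ Q a) + volume (Q a \ E) := by
        rw [inter_comm, measure_inter_add_sdiff _ hE]
      have h7 := hEQa a ha
      have hf1 : volume (E ∩ Q a) ≠ ∞ := ne_top_of_le_ne_top hfin (measure_mono inter_subset_right)
      have hf2 : volume (Q a \ E) ≠ ∞ := ne_top_of_le_ne_top hfin (measure_mono sdiff_subset)
      change volume (Q a) ≤ _
      rw [← ENNReal.ofReal_toReal hfin, ← ENNReal.ofReal_toReal hf1, ← ENNReal.ofReal_mul (by norm_num),
        ENNReal.ofReal_le_ofReal_iff (by positivity)] at h7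
      rw [← ENNReal.toReal_eq_toReal_iff' hfin (by simp [hf1, hf2]), ENNReal.toReal_add hf1 hf2] at h6
      rw [← ENNReal.ofReal_toReal hfin, ← ENNReal.ofReal_toReal hf2, ← ENNReal.ofReal_mul (by norm_num)]
      apply ENNReal.ofReal_le_ofReal
      linarith
  have hUm : MeasurableSet (⋃ a ∈ u, Q a) := MeasurableSet.biUnion huc fun a _ => hQm a
  refine ⟨E ∪ ⋃ a ∈ u, Q a, hE.union hUm, union_subset hEQ (iUnion₂_subset hQ0), ?_, ?_⟩
  · refine (measure_union_le _ _).trans ?_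
    rw [ENNReal.ofReal_add (by norm_num) (by positivity), add_mul, ENNReal.ofReal_one, one_mul]
    refine add_le_add le_rfl ((measure_biUnion_le _ huc _).trans ?_)
    have hd1 : u.PairwiseDisjoint fun a => E ∩ Metric.closedBall a.1 a.2 := fun a ha b hb hab =>
      (hud ha hb hab).mono (inter_subset_right.trans (Metric.closedBall_subset_closedBall (by
        have := (hu a ha).2.1; linarith))) (inter_subset_right.trans (Metric.closedBall_subset_closedBall (by
        have := (hu b hb).2.1; linarith)))
    have h8 : ∑' a : u, volume (E ∩ Metric.closedBall (a : (Fin n → ℝ) × ℝ).1 (a : (Fin n → ℝ) × ℝ).2) ≤ volume E := by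
      rw [← measure_biUnion huc hd1 fun a _ => hE.inter Metric.isClosed_closedBall.measurableSet]
      exact measure_mono (iUnion₂_subset fun a _ => inter_subset_left)
    refine le_trans ?_ (mul_le_mul' le_rfl h8)
    rw [← ENNReal.tsum_mul_left]
    refine ENNReal.tsum_le_tsum fun a => ?_
    obtain ⟨h1, h2, h3, h4, h5⟩ := hu a a.2
    have e1 : volume (Q a) = volume (Metric.closedBall (a : (Fin n → ℝ) × ℝ).1 (a : (Fin n → ℝ) × ℝ).2) := by
      exact (vol_cb _ h2.le).trans (vol_cb _ h2.le).symm
    rw [e1]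
    refine le_trans (le_of_eq ?_) (mul_le_mul' le_rfl h4.le)
    rw [← mul_assoc, ← ENNReal.ofReal_mul (by positivity), hs, ← mul_pow]
    norm_num
  · have h9 : μ E ≤ D * μ ((⋃ a ∈ u, Q a) \ E) := by
      calc μ E ≤ μ ((E \ ⋃ a ∈ u, Metric.closedBall a.1 (10 * a.2)) ∪ ⋃ a ∈ u, Metric.closedBall a.1 (10 * a.2)) :=
            measure_mono (by rw [sdiff_union_self]; exact subset_union_left)
        _ ≤ _ := measure_union_le _ _
        _ = μ (⋃ a ∈ u, Metric.closedBall a.1 (10 * a.2)) := by rw [hμ hucov, zero_add]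
        _ ≤ _ := measure_biUnion_le _ huc _
        _ ≤ ∑' a : u, D * μ (Q a \ E) := ENNReal.tsum_le_tsum fun a => hbig a a.2
        _ = D * μ (⋃ a ∈ u, (Q a \ E)) := by
          rw [ENNReal.tsum_mul_left, measure_biUnion huc (fun a ha b hb hab =>
            (hQd ha hb hab).mono sdiff_subset sdiff_subset) fun a _ => (hQm a).diff hE]
        _ = _ := by rw [biUnion_sdiff_aux]
    have h10 : μ (E ∪ ⋃ a ∈ u, Q a) = μ E + μ ((⋃ a ∈ u, Q a) \ E) := by
      rw [← union_sdiff_self, measure_union disjoint_sdiff_right (hUm.diff hE)]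
    rw [h10, add_mul, one_mul, mul_add, add_comm]
    exact add_le_add le_rfl h9

lemma iter_step {n : ℕ} (μ : Measure (Fin n → ℝ)) (hμ : μ ≪ volume) {D : ℝ≥0∞}
    (hD : ∀ (z : Fin n → ℝ) (R : ℝ), 0 < R → ∀ G, MeasurableSet G → G ⊆ Metric.closedBall z R →
      volume (Metric.closedBall z R) ≤ ENNReal.ofReal (11 ^ n * 2) * volume G → μ (Metric.closedBall z R) ≤ D * μ G)
    {z : Fin n → ℝ} {R : ℝ} (hR : 0 < R) (k : ℕ) {E : Set (Fin n → ℝ)} (hE : MeasurableSet E)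
    (hEQ : E ⊆ Metric.closedBall z R)
    (hsm : ENNReal.ofReal (1 + 2 ^ (n + 1)) ^ k * volume E ≤
      ENNReal.ofReal ((1 / 2) ^ (n + 1)) * volume (Metric.closedBall z R)) :
    (1 + D) ^ k * μ E ≤ D ^ k * μ (Metric.closedBall z R) := by
  induction k generalizing E with
  | zero => simpa using measure_mono hEQ
  | succ k ih =>
    have hK : 1 ≤ ENNReal.ofReal (1 + 2 ^ (n + 1)) := by
      rw [ENNReal.one_le_ofReal]; have : (0:ℝ) < 2 ^ (n + 1) := by positivity
      linarith
    obtain ⟨E', h1, h2, h3, h4⟩ := one_step μ hμ hD hR hE hEQ (le_trans (by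
      calc volume E = 1 * volume E := (one_mul _).symm
        _ ≤ _ := by gcongr; exact one_le_pow₀ hK) hsm)
    have h5 := ih h1 h2 (le_trans (by
      calc _ ≤ ENNReal.ofReal (1 + 2 ^ (n + 1)) ^ k * (ENNReal.ofReal (1 + 2 ^ (n + 1)) * volume E) := by gcongr
        _ = _ := by rw [pow_succ _ k, mul_assoc]) hsm)
    calc (1 + D) ^ (k + 1) * μ E = (1 + D) ^ k * ((1 + D) * μ E) := by rw [pow_succ, mul_assoc]
      _ ≤ (1 + D) ^ k * (D * μ E') := by gcongr
      _ = D * ((1 + D) ^ k * μ E') := by ring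
      _ ≤ D * (D ^ k * μ (Metric.closedBall z R)) := by gcongr
      _ = _ := by ring

lemma ainf_power {n : ℕ} (μ : Measure (Fin n → ℝ)) (hμ : μ ≪ volume) {D : ℝ} (hD0 : 0 < D)
    (hD : ∀ (z : Fin n → ℝ) (R : ℝ), 0 < R → ∀ G, MeasurableSet G → G ⊆ Metric.closedBall z R →
      volume (Metric.closedBall z R) ≤ ENNReal.ofReal (11 ^ n * 2) * volume G →
      μ (Metric.closedBall z R) ≤ ENNReal.ofReal D * μ G) {ε : ℝ} (hε : 0 < ε) :
    ∃ δ, 0 < δ ∧ δ < ε ∧ ∃ C : ℝ, 0 < C ∧ ∀ (z : Fin n → ℝ) (R : ℝ), 0 < R → ∀ E, MeasurableSet E →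
      E ⊆ Metric.closedBall z R → ∀ e V : ℝ, 0 < e → 0 < V → volume E = ENNReal.ofReal e →
      volume (Metric.closedBall z R) = ENNReal.ofReal V →
      μ E ≤ ENNReal.ofReal (C * (e / V) ^ δ) * μ (Metric.closedBall z R) := by
  set K : ℝ := 1 + 2 ^ (n + 1) with hK
  have hK1 : 1 < K := by have : (0:ℝ) < 2 ^ (n + 1) := by positivity
                         linarith
  have hK0 : 0 < K := by linarith
  set s : ℝ := (1 / 2) ^ (n + 1) with hs
  have hs0 : 0 < s := by positivity
  set ρ : ℝ := (1 + D) / D with hρ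
  have hρ1 : 1 < ρ := by rw [hρ, lt_div_iff₀ hD0]; linarith
  have hρ0 : 0 < ρ := by linarith
  set δ := min (Real.log ρ / Real.log K) (ε / 2) with hδ
  have hlK := Real.log_pos hK1
  have hlρ := Real.log_pos hρ1
  have hδ0 : 0 < δ := lt_min (by positivity) (by positivity)
  have hKδ : K ^ δ ≤ ρ := by
    rw [Real.rpow_def_of_pos hK0, ← Real.le_log_iff_exp_le hρ0]
    calc _ ≤ Real.log K * (Real.log ρ / Real.log K) := by gcongr; exact min_le_left _ _
      _ = _ := by field_simp
  refine ⟨δ, hδ0, (min_le_right _ _).trans_lt (by linarith), (K / s) ^ δ, by positivity, ?_⟩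
  intro z R hR E hE hEQ e V he hV heE hVQ
  rw [← Real.mul_rpow (by positivity) (by positivity)]
  rcases lt_or_ge (s * V / e) 1 with hlt | hge
  · refine (measure_mono hEQ).trans ?_
    rw [← one_mul (μ (Metric.closedBall z R)), ← mul_assoc, mul_one]
    refine mul_le_mul' ?_ le_rfl
    rw [ENNReal.one_le_ofReal]
    refine Real.one_le_rpow ?_ hδ0.le
    rw [div_lt_one he] at hlt
    rw [div_mul_div_comm, le_div_iff₀ (by positivity)]
    nlinarith
  · obtain ⟨k, hk1, hk2⟩ := exists_nat_pow_near hge hK1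
    have h := iter_step μ hμ hD hR k hE hEQ (by
      rw [heE, hVQ, ← ENNReal.ofReal_pow hK0.le, ← ENNReal.ofReal_mul (by positivity), ← ENNReal.ofReal_mul hs0.le]
      apply ENNReal.ofReal_le_ofReal
      rwa [le_div_iff₀ he] at hk1)
    rw [show (1 : ℝ≥0∞) + ENNReal.ofReal D = ENNReal.ofReal (1 + D) by
      rw [ENNReal.ofReal_add (by norm_num) hD0.le, ENNReal.ofReal_one], ← ENNReal.ofReal_pow (by positivity),
      ← ENNReal.ofReal_pow (by positivity)] at h
    have h1 : μ E ≤ ENNReal.ofReal ((ρ ^ k)⁻¹) * μ (Metric.closedBall z R) := by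
      have h2 := mul_le_mul' (le_refl (ENNReal.ofReal (((1 + D) ^ k)⁻¹))) h
      rw [← mul_assoc, ← mul_assoc, ← ENNReal.ofReal_mul (by positivity), ← ENNReal.ofReal_mul (by positivity),
        inv_mul_cancel₀ (by positivity), ENNReal.ofReal_one, one_mul] at h2
      refine h2.trans (le_of_eq ?_)
      congr 2
      rw [hρ, div_pow]; field_simp
    refine h1.trans (mul_le_mul' (ENNReal.ofReal_le_ofReal ?_) le_rfl)
    have h3 : (K ^ δ) ^ k ≤ ρ ^ k := by gcongr
    have h4 : ((K ^ k : ℝ)) ^ δ = (K ^ δ) ^ k := by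
      rw [← Real.rpow_natCast, ← Real.rpow_natCast, ← Real.rpow_mul hK0.le, ← Real.rpow_mul hK0.le, mul_comm]
    rw [← h4] at h3
    refine (inv_anti₀ (by positivity) h3).trans ?_
    rw [← Real.inv_rpow (by positivity)]
    refine Real.rpow_le_rpow (by positivity) ?_ hδ0.le
    rw [div_lt_iff₀ he, pow_succ] at hk2
    rw [div_mul_div_comm, inv_le_iff_one_le_mul₀ (by positivity), div_mul_eq_mul_div, le_div_iff₀ (by positivity)]
    linarith


lemma exists_big_ball {n : ℕ} (w : (Fin n → ℝ) → ℝ≥0∞) (hw : Measurable w) (h : ¬ w =ᵐ[volume] 0)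
    (z : Fin n → ℝ) (R : ℝ) : ∃ R', R ≤ R' ∧ 0 < R' ∧ ∫⁻ x in Metric.closedBall z R', w x ≠ 0 := by
  by_contra! hcon
  apply h
  rw [← lintegral_eq_zero_iff hw, ← setLIntegral_univ, ← Metric.iUnion_closedBall_nat z]
  rw [← withDensity_apply', measure_iUnion_null_iff]
  intro N
  rw [withDensity_apply']
  have h1 := hcon (max R (N + 1)) (le_max_left _ _) (lt_max_of_lt_right (by positivity))
  refine le_antisymm (le_trans (lintegral_mono_set (Metric.closedBall_subset_closedBall ?_)) h1.le) bot_le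
  exact (by linarith : (N : ℝ) ≤ N + 1).trans (le_max_right _ _)

lemma ap_ball {n : ℕ} {p : ℝ} (hp : 1 < p) (w : (Fin n → ℝ) → ℝ≥0∞) (z : Fin n → ℝ) {R : ℝ} (hR : 0 < R) :
    (∫⁻ x in Metric.closedBall z R, w x) * (∫⁻ x in Metric.closedBall z R, dualWeight p w x) ^ (p - 1) ≤
      ApConst n p w * volume (Metric.closedBall z R) ^ p := by
  have h : setAvg (Metric.closedBall z R) w * setAvg (Metric.closedBall z R) (dualWeight p w) ^ (p - 1) ≤
      ApConst n p w := by
    rw [← setAvg_ball z hR, ← setAvg_ball z hR]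
    unfold ApConst twoApConst
    exact le_iSup₂_of_le (Metric.ball z R) ((isCube_iff_ball n _).2 ⟨z, R, hR, rfl⟩) le_rfl
  have hV0 := vol_cb_pos z hR
  have hVt := vol_cb_top z (r := R)
  have h2 := mul_le_mul' h (le_refl (volume (Metric.closedBall z R) ^ p))
  refine le_trans (le_of_eq ?_) h2
  unfold setAvg
  generalize volume (Metric.closedBall z R) = V at *
  have e : V ^ p = V * V ^ (p - 1) := by
    conv_rhs => rw [← ENNReal.rpow_one V, ← ENNReal.rpow_mul, one_mul, ← ENNReal.rpow_add _ _ hV0 hVt]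
    congr 1; ring
  have hp1 : 0 ≤ p - 1 := by linarith
  rw [e, mul_mul_mul_comm, ENNReal.div_mul_cancel hV0 hVt, ← ENNReal.mul_rpow_of_nonneg _ _ hp1,
    ENNReal.div_mul_cancel hV0 hVt]

lemma holder_ap {n : ℕ} {p : ℝ} (hp : 1 < p) (w : (Fin n → ℝ) → ℝ≥0∞) (hw : Measurable w)
    (h0 : ∀ᵐ x, w x ≠ 0) (ht : ∀ᵐ x, w x ≠ ∞) (E : Set (Fin n → ℝ)) :
    volume E ^ p ≤ (∫⁻ x in E, w x) * (∫⁻ x in E, dualWeight p w x) ^ (p - 1) := by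
  have hp1 : 0 < p - 1 := by linarith
  have hp0 : 0 < p := by linarith
  have hpq : p.HolderConjugate (p / (p - 1)) := Real.HolderConjugate.conjExponent hp
  have hσm : Measurable (dualWeight p w) := by unfold dualWeight; fun_prop
  have h := ENNReal.lintegral_mul_le_Lp_mul_Lq (volume.restrict E) hpq
    (f := fun x => w x ^ (1 / p)) (g := fun x => dualWeight p w x ^ ((p - 1) / p))
    (by fun_prop) (by fun_prop)
  have e1 : ∫⁻ x in E, ((fun x => w x ^ (1 / p)) * (fun x => dualWeight p w x ^ ((p - 1) / p))) x = volume E := by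
    rw [← setLIntegral_one]
    refine lintegral_congr_ae ?_
    filter_upwards [ae_restrict_of_ae h0, ae_restrict_of_ae ht] with x hx0 hxt
    simp only [Pi.mul_apply, dualWeight, one_sub_conj hp]
    rw [← ENNReal.rpow_mul, ← ENNReal.rpow_add _ _ hx0 hxt]
    rw [show 1 / p + -(1 / (p - 1)) * ((p - 1) / p) = 0 by field_simp; ring, ENNReal.rpow_zero]
  rw [e1] at h
  simp only [← ENNReal.rpow_mul] at h
  rw [show 1 / p * p = 1 by field_simp, show (p - 1) / p * (p / (p - 1)) = 1 by field_simp] at h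
  simp only [ENNReal.rpow_one] at h
  have h2 := ENNReal.rpow_le_rpow h hp0.le
  rw [ENNReal.mul_rpow_of_nonneg _ _ hp0.le, ← ENNReal.rpow_mul, ← ENNReal.rpow_mul,
    show 1 / p * p = 1 by field_simp, show 1 / (p / (p - 1)) * p = p - 1 by field_simp, ENNReal.rpow_one] at h2
  exact h2

theorem Ap_Ps {n : ℕ} {p : ℝ} (hp : 1 < p) {w : (Fin n → ℝ) → ℝ≥0∞} (hw : Measurable w)
    (hA : ApConst n p w ≠ ∞) :
    ∃ s, 0 < s ∧ s < p ∧ ∃ C : ℝ, 0 < C ∧ ∀ (z : Fin n → ℝ) (R : ℝ), 0 < R → ∀ E, MeasurableSet E →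
      E ⊆ Metric.closedBall z R →
      (volume E / volume (Metric.closedBall z R)) ^ s * ∫⁻ x in Metric.closedBall z R, w x ≤
        ENNReal.ofReal C * ∫⁻ x in E, w x := by
  have hp1 : 0 < p - 1 := by linarith
  have hp0 : 0 < p := by linarith
  have hσm : Measurable (dualWeight p w) := by unfold dualWeight; fun_prop
  by_cases hw0 : w =ᵐ[volume] 0
  · refine ⟨1, one_pos, hp, 1, one_pos, fun z R hR E hE hEQ => ?_⟩
    have : ∫⁻ x in Metric.closedBall z R, w x = 0 := by
      rw [lintegral_eq_zero_iff hw]; exact ae_restrict_of_ae hw0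
    rw [this, mul_zero]; exact bot_le
  have hσfin : ∀ (z : Fin n → ℝ) (R : ℝ), ∫⁻ x in Metric.closedBall z R, dualWeight p w x ≠ ∞ := by
    intro z R
    obtain ⟨R', h1, h2, h3⟩ := exists_big_ball w hw hw0 z R
    have h4 := ap_ball hp w z h2
    refine ne_top_of_le_ne_top ?_ (lintegral_mono_set (Metric.closedBall_subset_closedBall h1))
    intro h5
    rw [h5, ENNReal.top_rpow_of_pos hp1, ENNReal.mul_top h3, top_le_iff] at h4
    exact ENNReal.mul_ne_top hA (ENNReal.rpow_ne_top_of_nonneg hp0.le (vol_cb_top z)) h4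
  have hae : ∀ (f : (Fin n → ℝ) → ℝ≥0∞), Measurable f →
      (∀ (z : Fin n → ℝ) (R : ℝ), ∫⁻ x in Metric.closedBall z R, f x ≠ ∞) → ∀ᵐ x, f x ≠ ∞ := by
    intro f hf h
    have h1 : ∀ᵐ x, ∀ N : ℕ, x ∈ Metric.closedBall (0 : Fin n → ℝ) N → f x < ∞ := by
      rw [ae_all_iff]
      intro N
      exact (ae_restrict_iff' Metric.isClosed_closedBall.measurableSet).1 (ae_lt_top hf (h 0 N))
    filter_upwards [h1] with x hx
    have : x ∈ ⋃ N : ℕ, Metric.closedBall (0 : Fin n → ℝ) N := by rw [Metric.iUnion_closedBall_nat]; trivial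
    obtain ⟨N, hN⟩ := mem_iUnion.1 this
    exact (hx N hN).ne
  have hwne : ∀ᵐ x, w x ≠ 0 := by
    filter_upwards [hae _ hσm hσfin] with x hx h0
    apply hx
    rw [dualWeight, h0, one_sub_conj hp]
    exact ENNReal.zero_rpow_of_neg (by simpa using hp1)
  by_cases hσ0 : dualWeight p w =ᵐ[volume] 0
  · have hwt : ∀ᵐ x, w x = ∞ := by
      filter_upwards [hσ0] with x hx
      rw [dualWeight, one_sub_conj hp, Pi.zero_apply, ENNReal.rpow_eq_zero_iff] at hx
      rcases hx with hx | hx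
      · have : 0 < 1 / (p - 1) := by positivity
        linarith [hx.2]
      · exact hx.1
    refine ⟨1, one_pos, hp, 1, one_pos, fun z R hR E hE hEQ => ?_⟩
    by_cases hE0 : volume E = 0
    · simp [hE0]
    · have : ∫⁻ x in E, w x = ∞ := by
        rw [lintegral_congr_ae (g := fun _ => ∞) (ae_restrict_of_ae hwt), lintegral_const,
          Measure.restrict_apply_univ, ENNReal.top_mul hE0]
      rw [this]; simp
  have hwfin : ∀ (z : Fin n → ℝ) (R : ℝ), ∫⁻ x in Metric.closedBall z R, w x ≠ ∞ := by
    intro z R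
    obtain ⟨R', h1, h2, h3⟩ := exists_big_ball _ hσm hσ0 z R
    have h4 := ap_ball hp w z h2
    refine ne_top_of_le_ne_top ?_ (lintegral_mono_set (Metric.closedBall_subset_closedBall h1))
    intro h5
    rw [h5, ENNReal.top_mul (by simp [h3, hp1.le, hp.le]), top_le_iff] at h4
    exact ENNReal.mul_ne_top hA (ENNReal.rpow_ne_top_of_nonneg hp0.le (vol_cb_top z)) h4
  have hwt := hae w hw hwfin
  have hH := holder_ap hp w hw hwne hwt
  set A := ApConst n p w with hAdef
  set σ := dualWeight p w with hσ
  set μ := volume.withDensity σ with hμ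
  have hμE : ∀ E, μ E = ∫⁻ x in E, σ x := fun E => withDensity_apply' _ _
  have hcmp : ∀ (z : Fin n → ℝ) (R : ℝ), 0 < R → ∀ G, MeasurableSet G → G ⊆ Metric.closedBall z R →
      volume G ^ p * μ (Metric.closedBall z R) ^ (p - 1) ≤
        A * volume (Metric.closedBall z R) ^ p * μ G ^ (p - 1) := by
    intro z R hR G hG hGQ
    have h1 := ap_ball hp w z hR
    rw [← hσ, ← hμE] at h1
    calc _ ≤ ((∫⁻ x in G, w x) * μ G ^ (p - 1)) * μ (Metric.closedBall z R) ^ (p - 1) := by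
          gcongr; rw [hμE]; exact hH G
      _ ≤ ((∫⁻ x in Metric.closedBall z R, w x) * μ G ^ (p - 1)) * μ (Metric.closedBall z R) ^ (p - 1) := by
          gcongr
      _ = ((∫⁻ x in Metric.closedBall z R, w x) * μ (Metric.closedBall z R) ^ (p - 1)) * μ G ^ (p - 1) := by ring
      _ ≤ _ := by gcongr
  set κ := ENNReal.ofReal (11 ^ n * 2) with hκ
  set D0 := (A * κ ^ p) ^ (1 / (p - 1)) with hD0
  have hD0t : D0 ≠ ∞ := ENNReal.rpow_ne_top_of_nonneg (by positivity)
    (ENNReal.mul_ne_top hA (ENNReal.rpow_ne_top_of_nonneg hp0.le ENNReal.ofReal_ne_top))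
  have hDD : ∀ (z : Fin n → ℝ) (R : ℝ), 0 < R → ∀ G, MeasurableSet G → G ⊆ Metric.closedBall z R →
      volume (Metric.closedBall z R) ≤ κ * volume G →
      μ (Metric.closedBall z R) ≤ ENNReal.ofReal (D0.toReal + 1) * μ G := by
    intro z R hR G hG hGQ hκG
    have h1 := hcmp z R hR G hG hGQ
    have hG0 : volume G ≠ 0 := by
      intro h; rw [h, mul_zero] at hκG
      exact vol_cb_pos z hR (le_antisymm hκG bot_le)
    have hGt : volume G ≠ ∞ := ne_top_of_le_ne_top (vol_cb_top z) (measure_mono hGQ)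
    have h2 : volume G ^ p * μ (Metric.closedBall z R) ^ (p - 1) ≤
        volume G ^ p * (A * κ ^ p * μ G ^ (p - 1)) := by
      refine h1.trans ?_
      calc _ ≤ A * (κ * volume G) ^ p * μ G ^ (p - 1) := by gcongr
        _ = _ := by rw [ENNReal.mul_rpow_of_nonneg _ _ hp0.le]; ring
    rw [ENNReal.mul_le_mul_iff_right (by simp [hG0, hGt]) (ENNReal.rpow_ne_top_of_nonneg hp0.le hGt)] at h2
    have h3 := ENNReal.rpow_le_rpow h2 (show 0 ≤ 1 / (p - 1) by positivity)
    rw [ENNReal.mul_rpow_of_nonneg _ _ (by positivity), ← ENNReal.rpow_mul, ← ENNReal.rpow_mul,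
      show (p - 1) * (1 / (p - 1)) = 1 by field_simp, ENNReal.rpow_one, ENNReal.rpow_one] at h3
    refine h3.trans (mul_le_mul' ?_ le_rfl)
    rw [ENNReal.ofReal_add ENNReal.toReal_nonneg (by norm_num), ENNReal.ofReal_toReal hD0t]
    exact le_self_add
  obtain ⟨δ, hδ0, hδ1, C, hC, hpow⟩ := ainf_power μ (withDensity_absolutelyContinuous _ _)
    (show 0 < D0.toReal + 1 by positivity) hDD (show 0 < p / (p - 1) by positivity)
  rw [lt_div_iff₀ hp1] at hδ1
  refine ⟨p - δ * (p - 1), by linarith, by nlinarith, C ^ (p - 1) * A.toReal + 1, by positivity, ?_⟩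
  intro z R hR E hE hEQ
  rcases eq_or_ne (volume E) 0 with hE0 | hE0
  · rw [hE0, ENNReal.zero_div, ENNReal.zero_rpow_of_pos (by linarith), zero_mul]; exact bot_le
  have hV0 := vol_cb_pos z hR
  have hVt := vol_cb_top z (r := R)
  have hEt : volume E ≠ ∞ := ne_top_of_le_ne_top hVt (measure_mono hEQ)
  have he : 0 < (volume E).toReal := ENNReal.toReal_pos hE0 hEt
  have hV : 0 < (volume (Metric.closedBall z R)).toReal := ENNReal.toReal_pos hV0 hVt
  have ee := (ENNReal.ofReal_toReal hEt).symm
  have eV := (ENNReal.ofReal_toReal hVt).symm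
  have h1 := hpow z R hR E hE hEQ _ _ he hV ee eV
  have h2 := ap_ball hp w z hR
  have h3 := hH E
  rw [← hσ, ← hμE] at h2
  rw [← hμE] at h3
  generalize (volume E).toReal = e at *
  generalize (volume (Metric.closedBall z R)).toReal = V at *
  rw [ee] at h3 ⊢
  rw [eV] at h2 ⊢
  rw [ENNReal.ofReal_rpow_of_pos he] at h3
  rw [ENNReal.ofReal_rpow_of_pos hV] at h2
  have hr : 0 < e / V := by positivity
  have h4 : ENNReal.ofReal (e ^ p) * ∫⁻ x in Metric.closedBall z R, w x ≤
      ENNReal.ofReal (C ^ (p - 1) * (e / V) ^ (δ * (p - 1)) * V ^ p) * (A * ∫⁻ x in E, w x) := by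
    calc _ ≤ ((∫⁻ x in E, w x) * μ E ^ (p - 1)) * ∫⁻ x in Metric.closedBall z R, w x := by gcongr
      _ ≤ ((∫⁻ x in E, w x) * (ENNReal.ofReal (C * (e / V) ^ δ) * μ (Metric.closedBall z R)) ^ (p - 1)) *
          ∫⁻ x in Metric.closedBall z R, w x := by gcongr
      _ = (∫⁻ x in E, w x) * ENNReal.ofReal (C ^ (p - 1) * (e / V) ^ (δ * (p - 1))) *
          ((∫⁻ x in Metric.closedBall z R, w x) * μ (Metric.closedBall z R) ^ (p - 1)) := by
          rw [ENNReal.mul_rpow_of_nonneg _ _ hp1.le, ENNReal.ofReal_rpow_of_pos (by positivity),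
            Real.mul_rpow hC.le (by positivity), ← Real.rpow_mul hr.le]
          ring
      _ ≤ (∫⁻ x in E, w x) * ENNReal.ofReal (C ^ (p - 1) * (e / V) ^ (δ * (p - 1))) *
          (A * ENNReal.ofReal (V ^ p)) := by gcongr
      _ = _ := by rw [ENNReal.ofReal_mul (q := V ^ p) (by positivity)]; ring
  have h5 := mul_le_mul' (le_refl (ENNReal.ofReal ((e / V) ^ (-(δ * (p - 1))) * (V ^ p)⁻¹))) h4
  rw [← mul_assoc, ← mul_assoc, ← ENNReal.ofReal_mul (by positivity), ← ENNReal.ofReal_mul (by positivity)] at h5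
  have e1 : (e / V) ^ (-(δ * (p - 1))) * (V ^ p)⁻¹ * e ^ p = (e / V) ^ (p - δ * (p - 1)) := by
    rw [show p - δ * (p - 1) = -(δ * (p - 1)) + p by ring, Real.rpow_add hr, Real.div_rpow he.le hV.le p]; field_simp
  have e2 : (e / V) ^ (-(δ * (p - 1))) * (V ^ p)⁻¹ * (C ^ (p - 1) * (e / V) ^ (δ * (p - 1)) * V ^ p) = C ^ (p - 1) := by
    rw [Real.rpow_neg hr.le]
    have : 0 < (e / V) ^ (δ * (p - 1)) := by positivity
    have : 0 < V ^ p := by positivity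
    generalize (e / V) ^ (δ * (p - 1)) = X at *
    generalize V ^ p = Y at *
    field_simp
  rw [e1, e2] at h5
  rw [← ENNReal.ofReal_div_of_pos hV, ENNReal.ofReal_rpow_of_pos hr]
  refine h5.trans ?_
  rw [← mul_assoc]
  refine mul_le_mul' ?_ le_rfl
  rw [ENNReal.ofReal_add (by positivity) (by norm_num), ENNReal.ofReal_mul (by positivity), ENNReal.ofReal_toReal hA]
  exact le_self_add


theorem rwt {n : ℕ} {w : (Fin n → ℝ) → ℝ≥0∞} {s : ℝ} (hs : 0 < s) {C : ℝ} (hC : 0 < C)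
    (hP : ∀ (z : Fin n → ℝ) (R : ℝ), 0 < R → ∀ E, MeasurableSet E →
      E ⊆ Metric.closedBall z R →
      (volume E / volume (Metric.closedBall z R)) ^ s * ∫⁻ x in Metric.closedBall z R, w x ≤
        ENNReal.ofReal C * ∫⁻ x in E, w x) :
    ∃ C' : ℝ, 0 < C' ∧ ∀ F, MeasurableSet F → ∀ t : ℝ, 0 < t →
      ∫⁻ x in {x | ENNReal.ofReal t < maximal (F.indicator 1) x}, w x ≤
        ENNReal.ofReal (C' * t ^ (-s)) * ∫⁻ x in F, w x := by
  refine ⟨C * ((5 : ℝ) ^ n) ^ s, by positivity, fun F hF t ht => ?_⟩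
  have ht0 : 0 < t ^ s := by positivity
  have h50 : 0 < ((5 : ℝ) ^ n) ^ s := by positivity
  set μ := volume.withDensity w with hμ
  have hμE : ∀ E, ∫⁻ x in E, w x = μ E := fun E => (withDensity_apply' _ _).symm
  simp only [hμE] at hP ⊢
  set U : ℕ → Set (Fin n → ℝ) := fun N => {x | ∃ c r, 0 < r ∧ r ≤ (N : ℝ) ∧ x ∈ Metric.ball c r ∧
    ENNReal.ofReal t < setAvg (Metric.closedBall c r) (F.indicator 1)} with hU
  have hUU : {x | ENNReal.ofReal t < maximal (F.indicator 1) x} ⊆ ⋃ N, U N := by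
    intro x hx
    obtain ⟨c, r, h1, h2, h3⟩ := (lt_maximal_iff _ _ _).1 hx
    obtain ⟨N, hN⟩ := exists_nat_ge r
    exact mem_iUnion.2 ⟨N, c, r, h1, hN, h2, h3⟩
  have hmono : Monotone U := by
    rintro N N' h x ⟨c, r, h1, h2, h3⟩
    exact ⟨c, r, h1, h2.trans (by exact_mod_cast h), h3⟩
  refine (measure_mono hUU).trans ?_
  rw [hmono.measure_iUnion]
  refine iSup_le fun N => ?_
  set T : Set ((Fin n → ℝ) × ℝ) := {a | 0 < a.2 ∧ a.2 ≤ (N : ℝ) ∧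
    ENNReal.ofReal t < setAvg (Metric.closedBall a.1 a.2) (F.indicator 1)} with hT
  obtain ⟨u, huT, hdis, hcov⟩ := Vitali.exists_disjoint_subfamily_covering_enlargement_closedBall
    T (fun a => a.1) (fun a => a.2) N (fun a ha => ha.2.1) 5 (by norm_num)
  have huc : u.Countable := hdis.countable_of_nonempty_interior fun a ha =>
    ⟨a.1, Metric.ball_subset_interior_closedBall (Metric.mem_ball_self (huT ha).1)⟩
  have hsub : U N ⊆ ⋃ a ∈ u, Metric.closedBall a.1 (5 * a.2) := by
    rintro x ⟨c, r, h1, h2, h3, h4⟩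
    obtain ⟨b, hb, hb2⟩ := hcov (c, r) ⟨h1, h2, h4⟩
    exact mem_iUnion₂.2 ⟨b, hb, hb2 (Metric.ball_subset_closedBall h3)⟩
  have hd2 : u.PairwiseDisjoint fun a => F ∩ Metric.closedBall a.1 a.2 := fun a ha b hb hab =>
    (hdis ha hb hab).mono inter_subset_right inter_subset_right
  have key : ∀ a ∈ u, μ (Metric.closedBall a.1 (5 * a.2)) ≤
      ENNReal.ofReal (C * ((5 : ℝ) ^ n) ^ s * t ^ (-s)) * μ (F ∩ Metric.closedBall a.1 a.2) := by
    intro a ha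
    obtain ⟨h1, h2, h3⟩ := huT ha
    rw [setAvg_indicator _ hF] at h3
    have hV0 := vol_cb_pos a.1 h1
    have hVt := vol_cb_top a.1 (r := a.2)
    have h := hP a.1 (5 * a.2) (by positivity) (F ∩ Metric.closedBall a.1 a.2)
      (hF.inter Metric.isClosed_closedBall.measurableSet)
      (inter_subset_right.trans (Metric.closedBall_subset_closedBall (by linarith)))
    have h4 : ENNReal.ofReal (t / 5 ^ n) ≤ volume (F ∩ Metric.closedBall a.1 a.2) /
        volume (Metric.closedBall a.1 (5 * a.2)) := by
      rw [vol_cb_mul a.1 a.1 h1.le (by norm_num), mul_comm (ENNReal.ofReal _), ENNReal.ofReal_div_of_pos (by positivity),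
        div_eq_mul_inv _ (_ * _), ENNReal.mul_inv (Or.inl hV0) (Or.inl hVt), ← mul_assoc, ← div_eq_mul_inv,
        ← div_eq_mul_inv]
      gcongr
    have h5 := (mul_le_mul' (ENNReal.rpow_le_rpow h4 hs.le) le_rfl).trans h
    rw [ENNReal.ofReal_rpow_of_pos (by positivity)] at h5
    have h6 := mul_le_mul' (le_refl (ENNReal.ofReal (((t / 5 ^ n) ^ s)⁻¹))) h5
    rw [← mul_assoc, ← mul_assoc, ← ENNReal.ofReal_mul (by positivity), ← ENNReal.ofReal_mul (by positivity),
      inv_mul_cancel₀ (by positivity), ENNReal.ofReal_one, one_mul] at h6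
    refine h6.trans (le_of_eq ?_)
    congr 2
    rw [Real.div_rpow ht.le (by positivity), Real.rpow_neg ht.le]
    field_simp
  calc μ (U N) ≤ _ := measure_mono hsub
    _ ≤ _ := measure_biUnion_le _ huc _
    _ ≤ ∑' a : u, ENNReal.ofReal (C * ((5 : ℝ) ^ n) ^ s * t ^ (-s)) *
        μ (F ∩ Metric.closedBall (a : (Fin n → ℝ) × ℝ).1 (a : (Fin n → ℝ) × ℝ).2) :=
        ENNReal.tsum_le_tsum fun a => key a a.2
    _ = ENNReal.ofReal (C * ((5 : ℝ) ^ n) ^ s * t ^ (-s)) * μ (⋃ a ∈ u, F ∩ Metric.closedBall a.1 a.2) := by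
        rw [ENNReal.tsum_mul_left, measure_biUnion huc hd2 fun a _ => hF.inter Metric.isClosed_closedBall.measurableSet]
    _ ≤ _ := mul_le_mul' le_rfl (measure_mono (iUnion₂_subset fun a _ => inter_subset_left))


lemma geo_summable {γ : ℝ} (hγ : γ < 0) : Summable fun k : ℕ => (2 : ℝ) ^ ((k : ℝ) * γ) := by
  have h : (fun k : ℕ => (2 : ℝ) ^ ((k : ℝ) * γ)) = fun k : ℕ => ((2 : ℝ) ^ γ) ^ k := by
    ext k; rw [← Real.rpow_natCast, ← Real.rpow_mul (by norm_num), mul_comm]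
  rw [h]
  exact summable_geometric_of_lt_one (by positivity) (Real.rpow_lt_one_of_one_lt_of_neg (by norm_num) hγ)

lemma geo_ne_top {γ : ℝ} (hγ : γ < 0) : ∑' k : ℕ, ENNReal.ofReal ((2 : ℝ) ^ ((k : ℝ) * γ)) ≠ ∞ := by
  rw [← ENNReal.ofReal_tsum_of_nonneg (fun k => by positivity) (geo_summable hγ)]
  exact ENNReal.ofReal_ne_top

lemma scaling_lint {Q a : ℝ} (ha : 0 < a) (h : ℝ → ℝ≥0∞) :
    ∫⁻ x in Ioi (0 : ℝ), ENNReal.ofReal x ^ Q * h (a * x) / ENNReal.ofReal x =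
      ENNReal.ofReal (a ^ (-Q)) * ∫⁻ x in Ioi (0 : ℝ), ENNReal.ofReal x ^ Q * h x / ENNReal.ofReal x := by
  have him : (fun x => a * x) '' Ioi (0 : ℝ) = Ioi 0 := by
    ext y; simp only [mem_image, mem_Ioi]
    constructor
    · rintro ⟨x, hx, rfl⟩; positivity
    · intro hy; exact ⟨y / a, by positivity, by field_simp⟩
  have hcv := lintegral_image_eq_lintegral_abs_deriv_mul (s := Ioi (0 : ℝ)) (f := fun x => a * x) (f' := fun _ => a)
    measurableSet_Ioi (fun x _ => by simpa using ((hasDerivAt_id x).const_mul a).hasDerivWithinAt)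
    (fun x _ y _ hxy => mul_left_cancel₀ ha.ne' hxy)
    (fun x => ENNReal.ofReal x ^ Q * h x / ENNReal.ofReal x)
  rw [him] at hcv
  rw [hcv, ← lintegral_const_mul' _ _ ENNReal.ofReal_ne_top]
  refine setLIntegral_congr_fun measurableSet_Ioi fun x hx => ?_
  have hx : 0 < x := hx
  rw [ENNReal.ofReal_rpow_of_pos hx, ENNReal.ofReal_rpow_of_pos (by positivity), abs_of_pos ha,
    div_eq_mul_inv, div_eq_mul_inv, ← ENNReal.ofReal_inv_of_pos hx, ← ENNReal.ofReal_inv_of_pos (by positivity)]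
  have e1 : x ^ Q * x⁻¹ = a ^ (-Q) * a * ((a * x) ^ Q * (a * x)⁻¹) := by
    rw [Real.mul_rpow ha.le hx.le, Real.rpow_neg ha.le]
    have : 0 < a ^ Q := by positivity
    field_simp
  calc _ = ENNReal.ofReal (x ^ Q * x⁻¹) * h (a * x) := by
        rw [ENNReal.ofReal_mul (by positivity)]; ring
    _ = _ := by
        rw [e1, ENNReal.ofReal_mul (by positivity), ENNReal.ofReal_mul (by positivity),
          ENNReal.ofReal_mul (p := (a * x) ^ Q) (by positivity)]; ring

lemma tsum_rpow_le {θ η : ℝ} (hθ : 0 < θ) (hη : 0 < η) :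
    ∃ B : ℝ≥0∞, B ≠ ∞ ∧ ∀ a : ℕ → ℝ≥0∞,
      (∑' k, a k) ^ θ ≤ B * ∑' k : ℕ, ENNReal.ofReal ((2 : ℝ) ^ ((k : ℝ) * η)) * a k ^ θ := by
  refine ⟨(∑' k : ℕ, ENNReal.ofReal ((2 : ℝ) ^ ((k : ℝ) * (-(η / θ))))) ^ θ,
    ENNReal.rpow_ne_top_of_nonneg hθ.le (geo_ne_top (by simp only [Left.neg_neg_iff]; positivity)), fun a => ?_⟩
  set M := ∑' k : ℕ, ENNReal.ofReal ((2 : ℝ) ^ ((k : ℝ) * η)) * a k ^ θ with hM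
  have h1 : ∀ k, a k ≤ ENNReal.ofReal ((2 : ℝ) ^ ((k : ℝ) * (-(η / θ)))) * M ^ (1 / θ) := by
    intro k
    have h2 : ENNReal.ofReal ((2 : ℝ) ^ ((k : ℝ) * η)) * a k ^ θ ≤ M := ENNReal.le_tsum k
    have h3 := ENNReal.rpow_le_rpow h2 (show 0 ≤ 1 / θ by positivity)
    rw [ENNReal.mul_rpow_of_nonneg _ _ (by positivity), ← ENNReal.rpow_mul, ENNReal.ofReal_rpow_of_pos (by positivity),
      ← Real.rpow_mul (by norm_num), show θ * (1 / θ) = 1 by field_simp, ENNReal.rpow_one] at h3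
    have h4 := mul_le_mul' (le_refl (ENNReal.ofReal ((2 : ℝ) ^ ((k : ℝ) * (-(η / θ)))))) h3
    rw [← mul_assoc, ← ENNReal.ofReal_mul (by positivity), ← Real.rpow_add (by norm_num),
      show (k : ℝ) * (-(η / θ)) + k * η * (1 / θ) = 0 by ring, Real.rpow_zero, ENNReal.ofReal_one, one_mul] at h4
    exact h4
  calc (∑' k, a k) ^ θ ≤ ((∑' k : ℕ, ENNReal.ofReal ((2 : ℝ) ^ ((k : ℝ) * (-(η / θ))))) * M ^ (1 / θ)) ^ θ := by
        refine ENNReal.rpow_le_rpow ?_ hθ.le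
        rw [← ENNReal.tsum_mul_right]
        exact ENNReal.tsum_le_tsum h1
    _ = _ := by
        rw [ENNReal.mul_rpow_of_nonneg _ _ hθ.le, ← ENNReal.rpow_mul, show 1 / θ * θ = 1 by field_simp, ENNReal.rpow_one]

lemma dist_maximal {n : ℕ} {p : ℝ} {w : (Fin n → ℝ) → ℝ≥0∞} {s : ℝ} (hs : 0 < s) (hsp : s < p) {C : ℝ} (hC : 0 < C)
    (hR : ∀ F, MeasurableSet F → ∀ t : ℝ, 0 < t →
      ∫⁻ x in {x | ENNReal.ofReal t < maximal (F.indicator 1) x}, w x ≤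
        ENNReal.ofReal (C * t ^ (-s)) * ∫⁻ x in F, w x) :
    ∃ e C' : ℝ, 0 < e ∧ e < p ∧ 0 < C' ∧ ∀ f : (Fin n → ℝ) → ℝ≥0∞, Measurable f → ∀ l : ℝ, 0 < l →
      wDist volume w (maximal f) l ≤
        ∑' k : ℕ, ENNReal.ofReal (C' * (2 : ℝ) ^ ((k : ℝ) * e)) * wDist volume w f ((2 : ℝ) ^ k / 4 * l) := by
  set δ := (p / s - 1) / 2 with hδ
  have hδ0 : 0 < δ := by
    have : 1 < p / s := by rw [lt_div_iff₀ hs]; linarith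
    rw [hδ]; linarith
  have he : (1 + δ) * s = (p + s) / 2 := by rw [hδ]; field_simp; ring
  set S := ∑' k : ℕ, (2 : ℝ) ^ ((k : ℝ) * (-δ)) with hS
  have hSum : Summable fun k : ℕ => (2 : ℝ) ^ ((k : ℝ) * (-δ)) := geo_summable (by linarith)
  have hS0 : 0 < S := hSum.tsum_pos (fun k => by positivity) 0 (by positivity)
  set c := 1 / (2 * S) with hc
  have hc0 : 0 < c := by positivity
  set t : ℕ → ℝ := fun k => c * (2 : ℝ) ^ ((k : ℝ) * (-(1 + δ))) with ht
  have ht0 : ∀ k, 0 < t k := fun k => by positivity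
  have htsum : ∑' k : ℕ, (2 : ℝ≥0∞) ^ (k + 1) * ENNReal.ofReal (t k) = 1 := by
    have : ∀ k : ℕ, (2 : ℝ≥0∞) ^ (k + 1) * ENNReal.ofReal (t k) =
        ENNReal.ofReal (2 * c * (2 : ℝ) ^ ((k : ℝ) * (-δ))) := by
      intro k
      rw [show (2 : ℝ≥0∞) = ENNReal.ofReal 2 by simp, ← ENNReal.ofReal_pow (by norm_num),
        ← ENNReal.ofReal_mul (by positivity)]
      congr 1
      rw [ht, pow_succ]
      simp only []
      rw [show (k : ℝ) * (-δ) = k + k * (-(1 + δ)) by ring, Real.rpow_add (by norm_num), Real.rpow_natCast]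
      ring
    simp only [this]
    rw [← ENNReal.ofReal_tsum_of_nonneg (fun k => by positivity) (hSum.mul_left _), _root_.tsum_mul_left, ← hS, hc,
      ← ENNReal.ofReal_one]
    congr 1; field_simp
  refine ⟨(1 + δ) * s, C * c ^ (-s), by positivity, by rw [he]; linarith, by positivity, fun f hf l hl => ?_⟩
  set F : ℕ → Set (Fin n → ℝ) := fun k => {x | (2 : ℝ≥0∞) ^ k ≤ f x / ENNReal.ofReal (l / 2)} with hF
  have hFm : ∀ k, MeasurableSet (F k) := fun k => measurableSet_le measurable_const (hf.div_const _)
  have hpt : ∀ x, f x ≤ ENNReal.ofReal (l / 2) * (1 + ∑' k : ℕ, 2 ^ (k + 1) * (F k).indicator 1 x) := by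
    intro x
    have h := dyadic_le (f x / ENNReal.ofReal (l / 2))
    rw [ENNReal.div_le_iff (by simpa using hl) ENNReal.ofReal_ne_top, mul_comm] at h
    refine h.trans (le_of_eq ?_)
    simp [indicator, hF]
  have hsub : {x | ENNReal.ofReal l < maximal f x} ⊆
      ⋃ k, {x | ENNReal.ofReal (t k) < maximal ((F k).indicator 1) x} := by
    intro x hx
    by_contra hcon
    simp only [mem_iUnion, mem_ofPred_eq, not_exists, not_lt] at hcon
    obtain ⟨z, r, h1, h2, h3⟩ := (lt_maximal_iff _ _ _).1 hx
    refine absurd h3 (not_lt.2 ?_)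
    have hV0 := vol_cb_pos z h1
    have hVt := vol_cb_top z (r := r)
    have h4 : ∀ k, ∫⁻ y in Metric.closedBall z r, (F k).indicator 1 y ≤
        ENNReal.ofReal (t k) * volume (Metric.closedBall z r) := by
      intro k
      have h5 := (setAvg_le_maximal ((F k).indicator 1) h1 h2).trans (hcon k)
      rwa [setAvg, ENNReal.div_le_iff hV0 hVt] at h5
    rw [setAvg, ENNReal.div_le_iff hV0 hVt]
    have hmi : ∀ k, Measurable ((F k).indicator (1 : (Fin n → ℝ) → ℝ≥0∞)) := fun k => measurable_one.indicator (hFm k)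
    calc ∫⁻ y in Metric.closedBall z r, f y ≤ ∫⁻ y in Metric.closedBall z r,
          ENNReal.ofReal (l / 2) * (1 + ∑' k : ℕ, 2 ^ (k + 1) * (F k).indicator 1 y) := lintegral_mono hpt
      _ = ENNReal.ofReal (l / 2) * (volume (Metric.closedBall z r) +
          ∑' k : ℕ, 2 ^ (k + 1) * ∫⁻ y in Metric.closedBall z r, (F k).indicator 1 y) := by
          rw [lintegral_const_mul' _ _ ENNReal.ofReal_ne_top, lintegral_add_left measurable_const,
            lintegral_tsum fun k => ((hmi k).const_mul _).aemeasurable]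
          congr 2
          · simp
          · congr 1; ext k
            rw [lintegral_const_mul _ (hmi k)]
      _ ≤ ENNReal.ofReal (l / 2) * (volume (Metric.closedBall z r) +
          ∑' k : ℕ, 2 ^ (k + 1) * (ENNReal.ofReal (t k) * volume (Metric.closedBall z r))) :=
          mul_le_mul' le_rfl (add_le_add le_rfl (ENNReal.tsum_le_tsum fun k => mul_le_mul' le_rfl (h4 k)))
      _ = _ := by
          simp only [← mul_assoc]
          rw [ENNReal.tsum_mul_right, htsum, one_mul, ← two_mul, ← mul_assoc,
            show (2 : ℝ≥0∞) = ENNReal.ofReal 2 by simp, ← ENNReal.ofReal_mul (by positivity)]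
          congr 2; ring
  unfold wDist
  set μ := volume.withDensity w with hμ
  have hμE : ∀ E, ∫⁻ x in E, w x = μ E := fun E => (withDensity_apply' _ _).symm
  simp only [hμE] at hR ⊢
  refine (measure_mono hsub).trans ((measure_iUnion_le _).trans (ENNReal.tsum_le_tsum fun k => ?_))
  refine (hR (F k) (hFm k) (t k) (ht0 k)).trans (mul_le_mul' (ENNReal.ofReal_le_ofReal (le_of_eq ?_)) (measure_mono ?_))
  · rw [ht]
    simp only []
    rw [Real.mul_rpow hc0.le (by positivity), ← Real.rpow_mul (by norm_num),
      show (k : ℝ) * (-(1 + δ)) * -s = k * ((1 + δ) * s) by ring]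
    ring
  · intro x hx
    have hx : (2 : ℝ≥0∞) ^ k ≤ f x / ENNReal.ofReal (l / 2) := hx
    rw [ENNReal.le_div_iff_mul_le (Or.inl (by simpa using hl)) (Or.inl ENNReal.ofReal_ne_top),
      show (2 : ℝ≥0∞) = ENNReal.ofReal 2 by simp, ← ENNReal.ofReal_pow (by norm_num),
      ← ENNReal.ofReal_mul (by positivity)] at hx
    refine lt_of_lt_of_le ((ENNReal.ofReal_lt_ofReal_iff (by positivity)).2 ?_) hx
    have : (0:ℝ) < 2 ^ k * l := by positivity
    linarith

theorem sufficiency {n : ℕ} {p : ℝ} (hp : 1 < p) {q : ℝ≥0∞} (hq : 1 ≤ q)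
    {w : (Fin n → ℝ) → ℝ≥0∞} (hw : Measurable w) (hA : ApConst n p w ≠ ∞) :
    ∃ C : ℝ≥0∞, C ≠ ∞ ∧ ∀ f : (Fin n → ℝ) → ℝ≥0∞, Measurable f →
        lorentzNorm volume w p q (maximal f) ≤ C * lorentzNorm volume w p q f := by
  have hp0 : 0 < p := by linarith
  obtain ⟨s, hs, hsp, C0, hC0, hP⟩ := Ap_Ps hp hw hA
  obtain ⟨C1, hC1, hR⟩ := rwt hs hC0 hP
  obtain ⟨e, C, he, hep, hC, hdist⟩ := dist_maximal hs hsp hC1 hR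
  unfold lorentzNorm
  rcases eq_or_ne q ∞ with rfl | hqt
  · simp only [if_true]
    set S := ∑' k : ℕ, ENNReal.ofReal ((2 : ℝ) ^ ((k : ℝ) * (e - p))) with hS
    have hSt : S ≠ ∞ := geo_ne_top (by linarith)
    refine ⟨ENNReal.ofReal 4 * (ENNReal.ofReal C * S) ^ (1 / p) , ENNReal.mul_ne_top ENNReal.ofReal_ne_top
      (ENNReal.rpow_ne_top_of_nonneg (by positivity) (ENNReal.mul_ne_top ENNReal.ofReal_ne_top hSt)), fun f hf => ?_⟩
    set N := ⨆ (s : ℝ) (_ : 0 < s), ENNReal.ofReal s * wDist volume w f s ^ (1 / p) with hN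
    refine iSup₂_le fun l hl => ?_
    have h1 : ∀ m : ℝ, 0 < m → wDist volume w f m ≤ ENNReal.ofReal (m ^ (-p)) * N ^ p := by
      intro m hm
      have h2 : ENNReal.ofReal m * wDist volume w f m ^ (1 / p) ≤ N := le_iSup₂_of_le m hm le_rfl
      have h3 := ENNReal.rpow_le_rpow h2 hp0.le
      rw [ENNReal.mul_rpow_of_nonneg _ _ hp0.le, ← ENNReal.rpow_mul, show 1 / p * p = 1 by field_simp,
        ENNReal.rpow_one, ENNReal.ofReal_rpow_of_pos hm] at h3
      have h4 := mul_le_mul' (le_refl (ENNReal.ofReal (m ^ (-p)))) h3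
      rwa [← mul_assoc, ← ENNReal.ofReal_mul (by positivity), ← Real.rpow_add hm, neg_add_cancel, Real.rpow_zero,
        ENNReal.ofReal_one, one_mul] at h4
    have h5 : wDist volume w (maximal f) l ≤ ENNReal.ofReal ((4 / l) ^ p) * (ENNReal.ofReal C * S) * N ^ p := by
      refine (hdist f hf l hl).trans ?_
      calc _ ≤ ∑' k : ℕ, ENNReal.ofReal (C * (2 : ℝ) ^ ((k : ℝ) * e)) *
            (ENNReal.ofReal (((2 : ℝ) ^ k / 4 * l) ^ (-p)) * N ^ p) :=
            ENNReal.tsum_le_tsum fun k => mul_le_mul' le_rfl (h1 _ (by positivity))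
        _ = ∑' k : ℕ, ENNReal.ofReal ((4 / l) ^ p) * (ENNReal.ofReal C *
            ENNReal.ofReal ((2 : ℝ) ^ ((k : ℝ) * (e - p)))) * N ^ p := by
            refine tsum_congr fun k => ?_
            rw [← mul_assoc, ← ENNReal.ofReal_mul (by positivity), ← ENNReal.ofReal_mul (by positivity),
              ← ENNReal.ofReal_mul (by positivity)]
            congr 2
            rw [show (2 : ℝ) ^ k / 4 * l = 2 ^ (k : ℝ) * (4 / l)⁻¹ by rw [Real.rpow_natCast]; field_simp,
              Real.mul_rpow (by positivity) (by positivity), Real.inv_rpow (by positivity), Real.rpow_neg (show (0:ℝ) ≤ 4 / l by positivity) p,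
              inv_inv, ← Real.rpow_mul (by norm_num), mul_sub, sub_eq_add_neg, Real.rpow_add (by norm_num)]
            rw [mul_neg]; ring
        _ = _ := by rw [ENNReal.tsum_mul_right, ENNReal.tsum_mul_left, ENNReal.tsum_mul_left]
    calc ENNReal.ofReal l * wDist volume w (maximal f) l ^ (1 / p) ≤ ENNReal.ofReal l *
          (ENNReal.ofReal ((4 / l) ^ p) * (ENNReal.ofReal C * S) * N ^ p) ^ (1 / p) := by gcongr
      _ = _ := by
        rw [ENNReal.mul_rpow_of_nonneg _ _ (by positivity), ENNReal.mul_rpow_of_nonneg _ _ (by positivity),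
          ← ENNReal.rpow_mul, show p * (1 / p) = 1 by field_simp, ENNReal.rpow_one,
          ENNReal.ofReal_rpow_of_pos (by positivity), ← Real.rpow_mul (by positivity),
          show p * (1 / p) = 1 by field_simp, Real.rpow_one, ← mul_assoc, ← mul_assoc,
          ← ENNReal.ofReal_mul hl.le]
        congr 3; field_simp
  · simp only [hqt, if_false]
    have hQ1 : 1 ≤ q.toReal := by
      rw [← ENNReal.toReal_one]; exact ENNReal.toReal_mono hqt hq
    generalize q.toReal = Q at *
    have hQ0 : 0 < Q := by linarith
    set θ := Q / p with hθ
    have hθ0 : 0 < θ := by positivity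
    set η := (Q - e * θ) / 2 with hη
    have heθ : e * θ < Q := by
      rw [hθ, ← mul_div_assoc, div_lt_iff₀ hp0]; nlinarith
    have hη0 : 0 < η := by rw [hη]; linarith
    obtain ⟨B, hB, hBs⟩ := tsum_rpow_le hθ0 hη0
    set S := ∑' k : ℕ, ENNReal.ofReal ((2 : ℝ) ^ ((k : ℝ) * (-η))) with hS
    have hSt : S ≠ ∞ := geo_ne_top (by linarith)
    set A := B * (ENNReal.ofReal (C ^ θ * 4 ^ Q) * S) with hAA
    have hAt : A ≠ ∞ := ENNReal.mul_ne_top hB (ENNReal.mul_ne_top ENNReal.ofReal_ne_top hSt)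
    refine ⟨A ^ (1 / Q), ENNReal.rpow_ne_top_of_nonneg (by positivity) hAt, fun f hf => ?_⟩
    rw [← ENNReal.mul_rpow_of_nonneg _ _ (by positivity)]
    refine ENNReal.rpow_le_rpow ?_ (by positivity)
    rw [mul_left_comm]
    refine mul_le_mul' le_rfl ?_
    have hanti : Antitone (wDist volume w f) := fun a b hab =>
      lintegral_mono_set fun x hx => lt_of_le_of_lt (ENNReal.ofReal_le_ofReal hab) hx
    have hmeas : Measurable (wDist volume w f) := hanti.measurable
    have h1 : ∀ l ∈ Ioi (0 : ℝ), ENNReal.ofReal l ^ Q * wDist volume w (maximal f) l ^ θ / ENNReal.ofReal l ≤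
        B * ∑' k : ℕ, ENNReal.ofReal (C ^ θ * (2 : ℝ) ^ ((k : ℝ) * (η + e * θ))) *
          (ENNReal.ofReal l ^ Q * wDist volume w f ((2 : ℝ) ^ k / 4 * l) ^ θ / ENNReal.ofReal l) := by
      intro l hl
      have hl : 0 < l := hl
      have h2 := (ENNReal.rpow_le_rpow (hdist f hf l hl) hθ0.le).trans (hBs _)
      calc _ ≤ ENNReal.ofReal l ^ Q * (B * ∑' k : ℕ, ENNReal.ofReal ((2 : ℝ) ^ ((k : ℝ) * η)) *
            (ENNReal.ofReal (C * (2 : ℝ) ^ ((k : ℝ) * e)) * wDist volume w f ((2 : ℝ) ^ k / 4 * l)) ^ θ) /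
            ENNReal.ofReal l := by gcongr
        _ = _ := by
          rw [div_eq_mul_inv, mul_left_comm, mul_assoc]
          congr 1
          rw [← ENNReal.tsum_mul_left, ← ENNReal.tsum_mul_right]
          refine tsum_congr fun k => ?_
          have e1 : ENNReal.ofReal ((2 : ℝ) ^ ((k : ℝ) * η)) * ENNReal.ofReal (C * (2 : ℝ) ^ ((k : ℝ) * e)) ^ θ =
              ENNReal.ofReal (C ^ θ * (2 : ℝ) ^ ((k : ℝ) * (η + e * θ))) := by
            rw [ENNReal.ofReal_rpow_of_pos (by positivity), ← ENNReal.ofReal_mul (by positivity),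
              Real.mul_rpow hC.le (by positivity), ← Real.rpow_mul (by norm_num), mul_add,
              Real.rpow_add (by norm_num), mul_assoc (k : ℝ) e θ]
            congr 1; ring
          rw [ENNReal.mul_rpow_of_nonneg _ _ hθ0.le, ← e1]
          generalize wDist volume w f ((2 : ℝ) ^ k / 4 * l) = X
          rw [div_eq_mul_inv]
          ring
    calc _ ≤ ∫⁻ l in Ioi (0 : ℝ), B * ∑' k : ℕ, ENNReal.ofReal (C ^ θ * (2 : ℝ) ^ ((k : ℝ) * (η + e * θ))) *
          (ENNReal.ofReal l ^ Q * wDist volume w f ((2 : ℝ) ^ k / 4 * l) ^ θ / ENNReal.ofReal l) :=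
          setLIntegral_mono' measurableSet_Ioi h1
      _ = B * ∑' k : ℕ, ENNReal.ofReal (C ^ θ * (2 : ℝ) ^ ((k : ℝ) * (η + e * θ))) *
          (ENNReal.ofReal (((2 : ℝ) ^ k / 4) ^ (-Q)) * ∫⁻ l in Ioi (0 : ℝ),
            ENNReal.ofReal l ^ Q * wDist volume w f l ^ θ / ENNReal.ofReal l) := by
          rw [lintegral_const_mul' _ _ hB, lintegral_tsum fun k => by
            have := hmeas.comp (measurable_const_mul ((2 : ℝ) ^ k / 4))
            refine Measurable.aemeasurable ?_
            refine Measurable.const_mul (Measurable.div (Measurable.mul (by fun_prop) ?_) (by fun_prop)) _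
            exact this.pow_const θ]
          congr 1
          refine tsum_congr fun k => ?_
          rw [lintegral_const_mul' _ _ ENNReal.ofReal_ne_top,
            scaling_lint (by positivity) (fun l => wDist volume w f l ^ θ)]
      _ = _ := by
          rw [hAA, mul_assoc, mul_assoc]
          congr 1
          rw [hS, ← ENNReal.tsum_mul_right, ← ENNReal.tsum_mul_left]
          refine tsum_congr fun k => ?_
          rw [← mul_assoc, ← mul_assoc, ← ENNReal.ofReal_mul (by positivity), ← ENNReal.ofReal_mul (by positivity)]
          congr 2
          rw [show (2 : ℝ) ^ k / 4 = 2 ^ (k : ℝ) * 4⁻¹ by rw [Real.rpow_natCast]; field_simp,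
            Real.mul_rpow (by positivity) (by positivity), Real.inv_rpow (by positivity),
            Real.rpow_neg (show (0:ℝ) ≤ 4 by positivity) Q, inv_inv, ← Real.rpow_mul (by norm_num),
            show (k : ℝ) * (-η) = k * (η + e * θ) + k * (-Q) by rw [hη]; ring, Real.rpow_add (by norm_num)]
          ring

/-- Chung–Hunt–Kurtz: `M` is bounded on `L^{p,q}(w)` iff `w ∈ A_p`. -/
theorem maximal_lorentz_bounded_iff_Ap (n : ℕ) (p : ℝ) (hp : 1 < p)
    (q : ℝ≥0∞) (hq : 1 ≤ q)
    (w : (Fin n → ℝ) → ℝ≥0∞) (hw : Measurable w) :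
    (∃ C : ℝ≥0∞, C ≠ ∞ ∧ ∀ f : (Fin n → ℝ) → ℝ≥0∞, Measurable f →
        lorentzNorm volume w p q (maximal f) ≤ C * lorentzNorm volume w p q f) ↔
      ApConst n p w ≠ ∞ := by
  exact ⟨fun ⟨_, hC, H⟩ => necessity hp hq hw hC H, fun h => sufficiency hp hq hw h⟩
end
end

section
/- Let w be a weight on ℝⁿ with [w]_{A_{∞,ℛ}}<∞ and let 1<ρ_w<∞ be defined by ρ_w' = 2^{n+1}[w]_{A_{∞,ℛ}}. Then for every rectangle R with sides parallel to the coordinate axes, (⨍_R w^{ρ_w})^{1/ρ_w} ≤ 2 ⨍_R w. -/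
open MeasureTheory ENNReal NNReal Set

noncomputable section

namespace SRH

/-- Abstract layer cake estimate. -/
lemma layer_s4 {X : Type*} [MeasurableSpace X] (μ : Measure X)
    (M F : X → ℝ≥0∞) (hM : Measurable M) (hF : Measurable F)
    (t0 : ℝ) (ht0 : 0 ≤ t0) (C : ℝ≥0∞)
    (h : ∀ t : ℝ, 0 < t → t0 ≤ t →
      ∫⁻ x in {x | ENNReal.ofReal t < M x}, F x ∂μ ≤
        C * ENNReal.ofReal t * μ {x | ENNReal.ofReal t < M x})
    (e : ℝ) (he : 0 < e) (N : ℕ) :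
    ∫⁻ x, F x * (min (M x) N) ^ e ∂μ ≤
      ENNReal.ofReal t0 ^ e * ∫⁻ x, F x ∂μ +
        C * ENNReal.ofReal (e / (1 + e)) * ∫⁻ x, (min (M x) N) ^ (1 + e) ∂μ := by
  set g : X → ℝ := fun x => (min (M x) N).toReal with hg
  have hgm : Measurable g := (hM.min measurable_const).ennreal_toReal
  have hg0 : ∀ x, 0 ≤ g x := fun x => ENNReal.toReal_nonneg
  have hfin : ∀ x, min (M x) (N : ℝ≥0∞) ≠ ∞ := fun x =>
    ne_top_of_le_ne_top (ENNReal.natCast_ne_top N) (min_le_right _ _)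
  have hpow : ∀ (p : ℝ), 0 ≤ p → ∀ x, ENNReal.ofReal (g x ^ p) = (min (M x) N) ^ p := by
    intro p hp x
    rw [← ENNReal.ofReal_rpow_of_nonneg (hg0 x) hp, hg, ENNReal.ofReal_toReal (hfin x)]
  set ν := μ.withDensity F with hν
  have e1 : ∫⁻ x, F x * (min (M x) N) ^ e ∂μ = ∫⁻ x, ENNReal.ofReal (g x ^ e) ∂ν := by
    rw [hν, lintegral_withDensity_eq_lintegral_mul _ hF (by fun_prop)]
    simp only [hpow e he.le, Pi.mul_apply]
  have e2 : ∫⁻ x, (min (M x) N) ^ (1 + e) ∂μ = ∫⁻ x, ENNReal.ofReal (g x ^ (1 + e)) ∂μ := by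
    simp only [hpow (1 + e) (by linarith)]
  have e3 : ENNReal.ofReal t0 ^ e * ∫⁻ x, F x ∂μ = ∫⁻ _, ENNReal.ofReal (t0 ^ e) ∂ν := by
    rw [lintegral_const, hν, withDensity_apply _ MeasurableSet.univ, Measure.restrict_univ,
      ENNReal.ofReal_rpow_of_nonneg ht0 he.le]
  rw [e1, e2, e3,
    lintegral_rpow_eq_lintegral_meas_lt_mul ν (Filter.Eventually.of_forall hg0) hgm.aemeasurable he,
    lintegral_rpow_eq_lintegral_meas_lt_mul μ (Filter.Eventually.of_forall hg0) hgm.aemeasurable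
      (by linarith : 0 < 1 + e),
    lintegral_rpow_eq_lintegral_meas_lt_mul ν (f := fun _ => t0)
      (Filter.Eventually.of_forall fun _ => ht0) aemeasurable_const he]
  have key : ∀ t ∈ Ioi (0 : ℝ), ν {x | t < g x} * ENNReal.ofReal (t ^ (e - 1)) ≤
      ν {_x : X | t < t0} * ENNReal.ofReal (t ^ (e - 1)) +
      C * (μ {x | t < g x} * ENNReal.ofReal (t ^ (1 + e - 1))) := by
    intro t ht
    have ht : 0 < t := ht
    by_cases htt : t < t0
    · refine le_trans ?_ le_self_add
      exact mul_le_mul' (measure_mono fun x _ => htt) le_rfl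
    · refine le_trans ?_ le_add_self
      have hpw : ENNReal.ofReal (t ^ (1 + e - 1)) =
          ENNReal.ofReal t * ENNReal.ofReal (t ^ (e - 1)) := by
        rw [← ENNReal.ofReal_mul ht.le]
        congr 1
        rw [show 1 + e - 1 = 1 + (e - 1) by ring, Real.rpow_add ht, Real.rpow_one]
      have hb : ν {x | t < g x} ≤ C * ENNReal.ofReal t * μ {x | t < g x} := by
        have hlt : ∀ x, t < g x ↔ ENNReal.ofReal t < M x ∧ ENNReal.ofReal t < N := by
          intro x
          rw [← lt_min_iff, ← ENNReal.ofReal_lt_iff_lt_toReal ht.le (hfin x)]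
        by_cases hN : ENNReal.ofReal t < N
        · have : {x | t < g x} = {x | ENNReal.ofReal t < M x} := by
            ext x; simp [hlt, hN]
          rw [this, hν, withDensity_apply _ (measurableSet_lt measurable_const hM)]
          exact h t ht (not_lt.1 htt)
        · have : {x | t < g x} = ∅ := by
            ext x; simp only [mem_ofPred_eq, hlt, hN]; simp
          rw [this]; simp
      calc _ ≤ C * ENNReal.ofReal t * μ {x | t < g x} * ENNReal.ofReal (t ^ (e - 1)) := by gcongr
        _ = _ := by rw [hpw]; ring
  have hmeas : Measurable fun t : ℝ => μ {x | t < g x} * ENNReal.ofReal (t ^ (1 + e - 1)) := by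
    have : Antitone fun t : ℝ => μ {x | t < g x} := fun s t hst =>
      measure_mono fun x hx => lt_of_le_of_lt hst hx
    exact this.measurable.mul (by fun_prop)
  have hC : ENNReal.ofReal e = ENNReal.ofReal (e / (1 + e)) * ENNReal.ofReal (1 + e) := by
    rw [← ENNReal.ofReal_mul (by positivity)]
    congr 1
    field_simp
  calc _ ≤ ENNReal.ofReal e * ∫⁻ t in Ioi (0 : ℝ),
        (ν {_x : X | t < t0} * ENNReal.ofReal (t ^ (e - 1)) +
      C * (μ {x | t < g x} * ENNReal.ofReal (t ^ (1 + e - 1)))) := by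
        gcongr 1
        exact setLIntegral_mono' measurableSet_Ioi key
    _ = _ := by
        rw [lintegral_add_right _ (hmeas.const_mul C), lintegral_const_mul _ hmeas, mul_add]
        congr 1
        rw [hC]
        ring

/-- The abstract argument. -/
lemma abstract_rh {X : Type*} [MeasurableSpace X] (μ : Measure X) [IsFiniteMeasure μ]
    (M w : X → ℝ≥0∞) (hM : Measurable M) (hw : Measurable w)
    (t0 : ℝ) (ht0 : 0 ≤ t0) (K A : ℝ≥0∞)
    (hwM : ∀ᵐ x ∂μ, w x ≤ M x)
    (h1 : ∀ t : ℝ, 0 < t → t0 ≤ t →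
      ∫⁻ x in {x | ENNReal.ofReal t < M x}, M x ∂μ ≤
        (K * A) * ENNReal.ofReal t * μ {x | ENNReal.ofReal t < M x})
    (h2 : ∀ t : ℝ, 0 < t → t0 ≤ t →
      ∫⁻ x in {x | ENNReal.ofReal t < M x}, w x ∂μ ≤
        K * ENNReal.ofReal t * μ {x | ENNReal.ofReal t < M x})
    (h0 : ∫⁻ x, M x ∂μ ≤ A * ∫⁻ x, w x ∂μ)
    (e : ℝ) (he : 0 < e) (hKA : 2 * (K * A) * ENNReal.ofReal (e / (1 + e)) = 1) :
    ∫⁻ x, w x ^ (1 + e) ∂μ ≤ 2 * ENNReal.ofReal t0 ^ e * ∫⁻ x, w x ∂μ := by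
  have main : ∀ N : ℕ, ∫⁻ x, w x * (min (w x) N) ^ e ∂μ ≤
      2 * ENNReal.ofReal t0 ^ e * ∫⁻ x, w x ∂μ := by
    intro N
    set I := ∫⁻ x, (min (M x) N) ^ (1 + e) ∂μ with hI
    have hIfin : I ≠ ∞ := by
      refine ne_top_of_le_ne_top (b := ∫⁻ _, (N : ℝ≥0∞) ^ (1 + e) ∂μ) ?_ ?_
      · rw [lintegral_const]
        exact ENNReal.mul_ne_top (ENNReal.rpow_ne_top_of_nonneg (by linarith)
          (ENNReal.natCast_ne_top N)) (measure_ne_top _ _)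
      · refine lintegral_mono fun x => ?_
        exact ENNReal.rpow_le_rpow (min_le_right _ _) (by linarith)
    have s1 := layer_s4 μ M M hM hM t0 ht0 _ h1 e he N
    have s2 := layer_s4 μ M w hM hw t0 ht0 _ h2 e he N
    rw [← hI] at s1 s2
    have s3 : I ≤ ∫⁻ x, M x * (min (M x) N) ^ e ∂μ := by
      refine lintegral_mono fun x => ?_
      rw [ENNReal.rpow_add_of_nonneg _ _ zero_le_one he.le, ENNReal.rpow_one]
      gcongr
      exact min_le_left _ _
    have s4 : 2 * I ≤ 2 * (ENNReal.ofReal t0 ^ e * ∫⁻ x, M x ∂μ) + I := by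
      calc 2 * I ≤ 2 * (ENNReal.ofReal t0 ^ e * ∫⁻ x, M x ∂μ +
            (K * A) * ENNReal.ofReal (e / (1 + e)) * I) := by gcongr; exact s3.trans s1
        _ = 2 * (ENNReal.ofReal t0 ^ e * ∫⁻ x, M x ∂μ) +
            (2 * (K * A) * ENNReal.ofReal (e / (1 + e))) * I := by ring
        _ = _ := by rw [hKA, one_mul]
    have s5 : I ≤ 2 * (ENNReal.ofReal t0 ^ e * ∫⁻ x, M x ∂μ) := by
      rw [two_mul I] at s4
      exact (ENNReal.add_le_add_iff_right hIfin).1 s4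
    calc ∫⁻ x, w x * (min (w x) N) ^ e ∂μ ≤ ∫⁻ x, w x * (min (M x) N) ^ e ∂μ := by
          refine lintegral_mono_ae ?_
          filter_upwards [hwM] with x hx
          gcongr
      _ ≤ _ := s2
      _ ≤ ENNReal.ofReal t0 ^ e * ∫⁻ x, w x ∂μ + K * ENNReal.ofReal (e / (1 + e)) *
            (2 * (ENNReal.ofReal t0 ^ e * (A * ∫⁻ x, w x ∂μ))) := by
          gcongr
          exact s5.trans (by gcongr)
      _ = ENNReal.ofReal t0 ^ e * ∫⁻ x, w x ∂μ + (2 * (K * A) * ENNReal.ofReal (e / (1 + e))) *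
            (ENNReal.ofReal t0 ^ e * ∫⁻ x, w x ∂μ) := by ring
      _ = _ := by rw [hKA]; ring
  have hsup : ∀ x, w x ^ (1 + e) = ⨆ N : ℕ, w x * (min (w x) N) ^ e := by
    intro x
    rw [← ENNReal.mul_iSup, ENNReal.rpow_add_of_nonneg _ _ zero_le_one he.le, ENNReal.rpow_one]
    congr 1
    have := (ENNReal.orderIsoRpow e he).map_iSup fun N : ℕ => min (w x) (N : ℝ≥0∞)
    simp only [ENNReal.orderIsoRpow_apply] at this
    rw [← this]
    congr 1
    rw [← inf_iSup_eq, ENNReal.iSup_natCast, inf_top_eq]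
  simp_rw [hsup]
  rw [lintegral_iSup]
  · exact iSup_le main
  · intro N
    fun_prop
  · intro N N' hNN x
    dsimp only
    gcongr

end SRH

namespace SRH

variable {n : ℕ}

def idx (a b : Fin n → ℝ) (k : ℕ) (x : Fin n → ℝ) : Fin n → ℤ :=
  fun i => ⌊2 ^ k * ((x i - a i) / (b i - a i))⌋

def lo (a b : Fin n → ℝ) (k : ℕ) (m : Fin n → ℤ) : Fin n → ℝ :=
  fun i => a i + m i * ((b i - a i) / 2 ^ k)

def hi (a b : Fin n → ℝ) (k : ℕ) (m : Fin n → ℤ) : Fin n → ℝ :=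
  fun i => a i + (m i + 1) * ((b i - a i) / 2 ^ k)

def cell (a b : Fin n → ℝ) (k : ℕ) (m : Fin n → ℤ) : Set (Fin n → ℝ) :=
  Set.univ.pi fun i => Set.Ico (lo a b k m i) (hi a b k m i)

def ocell (a b : Fin n → ℝ) (k : ℕ) (m : Fin n → ℤ) : Set (Fin n → ℝ) :=
  Set.univ.pi fun i => Set.Ioo (lo a b k m i) (hi a b k m i)

lemma hi_sub_lo (a b : Fin n → ℝ) (k : ℕ) (m : Fin n → ℤ) (i : Fin n) :
    hi a b k m i - lo a b k m i = (b i - a i) / 2 ^ k := by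
  unfold hi lo; ring

lemma lo_lt_hi {a b : Fin n → ℝ} (hab : ∀ i, a i < b i) (k : ℕ) (m : Fin n → ℤ) (i : Fin n) :
    lo a b k m i < hi a b k m i := by
  have := hi_sub_lo a b k m i
  have h2 : 0 < (b i - a i) / 2 ^ k := div_pos (sub_pos.2 (hab i)) (by positivity)
  linarith

lemma mem_cell {a b : Fin n → ℝ} (hab : ∀ i, a i < b i) (k : ℕ) (m : Fin n → ℤ)
    (x : Fin n → ℝ) : x ∈ cell a b k m ↔ idx a b k x = m := by
  have key : ∀ i, x i ∈ Set.Ico (lo a b k m i) (hi a b k m i) ↔ idx a b k x i = m i := by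
    intro i
    have h := sub_pos.2 (hab i)
    have h2 : 0 < (b i - a i) / 2 ^ k := div_pos h (by positivity)
    unfold idx lo hi
    rw [Int.floor_eq_iff, Set.mem_Ico]
    have e : 2 ^ k * ((x i - a i) / (b i - a i)) = (x i - a i) / ((b i - a i) / 2 ^ k) := by
      field_simp
    rw [e, le_div_iff₀ h2, div_lt_iff₀ h2]
    constructor <;> rintro ⟨h3, h4⟩ <;> constructor <;> linarith
  simp only [cell, Set.mem_univ_pi, key, funext_iff]

lemma isRect_ocell {a b : Fin n → ℝ} (hab : ∀ i, a i < b i) (k : ℕ) (m : Fin n → ℤ) :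
    IsRect n (ocell a b k m) := ⟨lo a b k m, hi a b k m, lo_lt_hi hab k m, rfl⟩

lemma ocell_subset (a b : Fin n → ℝ) (k : ℕ) (m : Fin n → ℤ) :
    ocell a b k m ⊆ cell a b k m :=
  Set.pi_mono fun _ _ => Set.Ioo_subset_Ico_self

lemma ocell_ae_Icc (a b : Fin n → ℝ) (k : ℕ) (m : Fin n → ℤ) :
    ocell a b k m =ᵐ[volume] Set.Icc (lo a b k m) (hi a b k m) :=
  Measure.univ_pi_Ioo_ae_eq_Icc

lemma cell_ae_Icc (a b : Fin n → ℝ) (k : ℕ) (m : Fin n → ℤ) :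
    cell a b k m =ᵐ[volume] Set.Icc (lo a b k m) (hi a b k m) :=
  Measure.univ_pi_Ico_ae_eq_Icc

lemma ocell_ae_cell (a b : Fin n → ℝ) (k : ℕ) (m : Fin n → ℤ) :
    ocell a b k m =ᵐ[volume] cell a b k m :=
  (ocell_ae_Icc a b k m).trans (cell_ae_Icc a b k m).symm

lemma measurableSet_cell (a b : Fin n → ℝ) (k : ℕ) (m : Fin n → ℤ) :
    MeasurableSet (cell a b k m) :=
  MeasurableSet.univ_pi fun _ => measurableSet_Ico

lemma measurableSet_ocell (a b : Fin n → ℝ) (k : ℕ) (m : Fin n → ℤ) :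
    MeasurableSet (ocell a b k m) :=
  MeasurableSet.univ_pi fun _ => measurableSet_Ioo

lemma measurable_idx (a b : Fin n → ℝ) (k : ℕ) : Measurable (idx a b k) := by
  unfold idx
  refine measurable_pi_lambda _ fun i => ?_
  exact Int.measurable_floor.comp (by fun_prop)

lemma volume_cell (a b : Fin n → ℝ) (k : ℕ) (m : Fin n → ℤ) :
    volume (cell a b k m) = ∏ i, ENNReal.ofReal ((b i - a i) / 2 ^ k) := by
  unfold cell
  rw [Real.volume_pi_Ico]
  simp only [hi_sub_lo]

lemma volume_cell_ne_top (a b : Fin n → ℝ) (k : ℕ) (m : Fin n → ℤ) :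
    volume (cell a b k m) ≠ ∞ := by
  rw [volume_cell]
  exact ENNReal.prod_ne_top fun i _ => ENNReal.ofReal_ne_top

lemma volume_cell_ne_zero {a b : Fin n → ℝ} (hab : ∀ i, a i < b i) (k : ℕ) (m : Fin n → ℤ) :
    volume (cell a b k m) ≠ 0 := by
  rw [volume_cell]
  refine Finset.prod_ne_zero_iff.2 fun i _ => ?_
  have := div_pos (sub_pos.2 (hab i)) (by positivity : (0:ℝ) < 2 ^ k)
  simpa using this

lemma volume_cell_succ (a b : Fin n → ℝ) (k : ℕ) (m m' : Fin n → ℤ) :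
    volume (cell a b k m) = 2 ^ n * volume (cell a b (k + 1) m') := by
  rw [volume_cell, volume_cell]
  have : ∀ i, ENNReal.ofReal ((b i - a i) / 2 ^ k) =
      2 * ENNReal.ofReal ((b i - a i) / 2 ^ (k + 1)) := by
    intro i
    rw [← ENNReal.ofReal_ofNat 2, ← ENNReal.ofReal_mul (by norm_num)]
    congr 1
    rw [pow_succ]; field_simp
  simp only [this, Finset.prod_mul_distrib, Finset.prod_const, Finset.card_univ, Fintype.card_fin]

lemma idx_succ {a b : Fin n → ℝ} (k : ℕ) (x : Fin n → ℝ) (i : Fin n) :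
    idx a b k x i = idx a b (k + 1) x i / 2 := by
  unfold idx
  set z := 2 ^ k * ((x i - a i) / (b i - a i))
  have : (2:ℝ) ^ (k + 1) * ((x i - a i) / (b i - a i)) = 2 * z := by rw [pow_succ]; ring
  rw [this]
  have h1 : 2 * ⌊z⌋ ≤ ⌊2 * z⌋ := by
    rw [Int.le_floor]; push_cast; linarith [Int.floor_le z]
  have h2 : ⌊2 * z⌋ < 2 * ⌊z⌋ + 2 := by
    rw [Int.floor_lt]; push_cast; linarith [Int.lt_floor_add_one z]
  omega

lemma idx_mono {a b : Fin n → ℝ} {j k : ℕ} (hjk : j ≤ k) {x y : Fin n → ℝ}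
    (h : idx a b k x = idx a b k y) : idx a b j x = idx a b j y := by
  induction k, hjk using Nat.le_induction with
  | base => exact h
  | succ k _ ih =>
    apply ih
    funext i
    rw [idx_succ k x, idx_succ k y, h]

lemma cell_subset {a b : Fin n → ℝ} (hab : ∀ i, a i < b i) {j k : ℕ} (hjk : j ≤ k)
    (x : Fin n → ℝ) : cell a b k (idx a b k x) ⊆ cell a b j (idx a b j x) := by
  intro y hy
  rw [mem_cell hab] at hy ⊢
  exact idx_mono hjk hy

lemma mem_cell_self {a b : Fin n → ℝ} (hab : ∀ i, a i < b i) (k : ℕ) (x : Fin n → ℝ) :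
    x ∈ cell a b k (idx a b k x) := (mem_cell hab k _ x).2 rfl

lemma ae_mem_ocell {a b : Fin n → ℝ} (hab : ∀ i, a i < b i) :
    ∀ᵐ x, ∀ k, x ∈ ocell a b k (idx a b k x) := by
  rw [ae_all_iff]
  intro k
  have : ∀ᵐ x, ∀ m, (x ∈ ocell a b k m ↔ x ∈ cell a b k m) := by
    rw [ae_all_iff]
    intro m
    exact (ocell_ae_cell a b k m).mem_iff
  filter_upwards [this] with x hx
  exact (hx _).2 (mem_cell_self hab k x)

/-- conditional expectation at generation `k` -/
def E (a b : Fin n → ℝ) (w : (Fin n → ℝ) → ℝ≥0∞) (k : ℕ) (x : Fin n → ℝ) : ℝ≥0∞ :=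
  setAvg (cell a b k (idx a b k x)) w

/-- dyadic maximal function -/
def Md (a b : Fin n → ℝ) (w : (Fin n → ℝ) → ℝ≥0∞) (x : Fin n → ℝ) : ℝ≥0∞ :=
  ⨆ k, E a b w k x

lemma measurable_E (a b : Fin n → ℝ) (w : (Fin n → ℝ) → ℝ≥0∞) (k : ℕ) :
    Measurable (E a b w k) := by
  have : Measurable fun m : Fin n → ℤ => setAvg (cell a b k m) w := measurable_of_countable _
  exact this.comp (measurable_idx a b k)

lemma measurable_Md (a b : Fin n → ℝ) (w : (Fin n → ℝ) → ℝ≥0∞) : Measurable (Md a b w) :=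
  Measurable.iSup fun k => measurable_E a b w k

lemma setAvg_ocell (a b : Fin n → ℝ) (w : (Fin n → ℝ) → ℝ≥0∞) (k : ℕ) (m : Fin n → ℤ) :
    setAvg (ocell a b k m) w = setAvg (cell a b k m) w := by
  unfold setAvg
  rw [setLIntegral_congr (ocell_ae_cell a b k m), measure_congr (ocell_ae_cell a b k m)]

/-- The tail of the dyadic maximal function is controlled by the strong maximal function -/
lemma E_le_maximalR {a b : Fin n → ℝ} (hab : ∀ i, a i < b i) (w : (Fin n → ℝ) → ℝ≥0∞)
    {k j : ℕ} (hkj : k ≤ j) {x : Fin n → ℝ} (hx : ∀ k, x ∈ ocell a b k (idx a b k x)) :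
    E a b w j x ≤ maximalR ((ocell a b k (idx a b k x)).indicator w) x := by
  refine le_trans ?_ (le_iSup₂_of_le (ocell a b j (idx a b j x)) (isRect_ocell hab j _)
    (le_iSup_of_le (hx j) le_rfl))
  rw [setAvg_ocell]
  unfold E setAvg
  gcongr 1
  have hsub := cell_subset hab hkj x
  have e : ∫⁻ y in cell a b j (idx a b j x), w y =
      ∫⁻ y in cell a b j (idx a b j x), (cell a b k (idx a b k x)).indicator w y := by
    refine setLIntegral_congr_fun (measurableSet_cell _ _ _ _) fun y hy => ?_
    rw [Set.indicator_of_mem (hsub hy)]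
  rw [e]
  refine le_of_eq (lintegral_congr_ae (ae_restrict_of_ae ?_))
  exact (indicator_ae_eq_of_ae_eq_set (ocell_ae_cell a b k _)).symm

lemma lintegral_Md_cell {a b : Fin n → ℝ} (hab : ∀ i, a i < b i) (w : (Fin n → ℝ) → ℝ≥0∞)
    (hfin : AinfRConst n w ≠ ∞) (k : ℕ) (x₀ : Fin n → ℝ)
    (hsel : ∀ j < k, E a b w j x₀ ≤ E a b w k x₀)
    (hwf : ∫⁻ y in cell a b k (idx a b k x₀), w y ≠ ∞) :
    ∫⁻ y in cell a b k (idx a b k x₀), Md a b w y ≤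
      AinfRConst n w * ∫⁻ y in cell a b k (idx a b k x₀), w y := by
  set m := idx a b k x₀ with hm
  have h1 : ∫⁻ y in cell a b k m, Md a b w y ≤
      ∫⁻ y in cell a b k m, maximalR ((ocell a b k m).indicator w) y := by
    refine lintegral_mono_ae ?_
    refine (ae_restrict_iff' (measurableSet_cell _ _ _ _)).2 ?_
    filter_upwards [ae_mem_ocell hab] with y hy hyc
    have hym : idx a b k y = m := (mem_cell hab k m y).1 hyc
    refine iSup_le fun j => ?_
    have hbase : ∀ j, k ≤ j → E a b w j y ≤ maximalR ((ocell a b k m).indicator w) y := by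
      intro j hj
      have := E_le_maximalR hab w hj hy
      rwa [hym] at this
    rcases le_or_gt k j with hj | hj
    · exact hbase j hj
    · refine le_trans ?_ (hbase k le_rfl)
      have e1 : E a b w j y = E a b w j x₀ := by
        unfold E; rw [idx_mono hj.le (hym.trans hm)]
      have e2 : E a b w k y = E a b w k x₀ := by
        unfold E; rw [hym.trans hm]
      rw [e1, e2]
      exact hsel j hj
  refine h1.trans ?_
  rw [← setLIntegral_congr (ocell_ae_cell a b k m)] at hwf ⊢
  rw [← setLIntegral_congr (ocell_ae_cell a b k m)]
  have h2 : (∫⁻ y in ocell a b k m, maximalR ((ocell a b k m).indicator w) y) /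
      ∫⁻ y in ocell a b k m, w y ≤ AinfRConst n w :=
    le_iSup₂_of_le (ocell a b k m) (isRect_ocell hab k m) le_rfl
  exact (ENNReal.div_le_iff_le_mul (Or.inr hfin) (Or.inl hwf)).1 h2

/-- Decomposition of level sets -/
lemma level_s4 {a b : Fin n → ℝ} (hab : ∀ i, a i < b i) (w F : (Fin n → ℝ) → ℝ≥0∞)
    (t C : ℝ≥0∞)
    (ht : setAvg (cell a b 0 0) w ≤ t)
    (h : ∀ (k : ℕ) (x : Fin n → ℝ), idx a b 0 x = 0 → t < E a b w (k + 1) x →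
      (∀ j < k + 1, E a b w j x ≤ t) →
      ∫⁻ y in cell a b (k + 1) (idx a b (k + 1) x), F y ≤
        C * volume (cell a b (k + 1) (idx a b (k + 1) x))) :
    ∫⁻ x in {x | t < Md a b w x}, F x ∂(volume.restrict (cell a b 0 0)) ≤
      C * (volume.restrict (cell a b 0 0)) {x | t < Md a b w x} := by
  classical
  have hmeas : MeasurableSet {x | t < Md a b w x} :=
    measurableSet_lt measurable_const (measurable_Md a b w)
  rw [Measure.restrict_restrict hmeas, Measure.restrict_apply hmeas]
  let S : ℕ × (Fin n → ℤ) → Set (Fin n → ℝ) := fun p =>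
    {x | idx a b p.1 x = p.2 ∧ idx a b 0 x = 0 ∧ t < E a b w p.1 x ∧ ∀ j < p.1, E a b w j x ≤ t}
  have hunion : {x | t < Md a b w x} ∩ cell a b 0 0 = ⋃ p, S p := by
    ext x
    simp only [Set.mem_inter_iff, Set.mem_iUnion, mem_cell hab, S, Set.mem_ofPred_eq, Md]
    constructor
    · rintro ⟨h1, h2⟩
      rw [lt_iSup_iff] at h1
      refine ⟨(Nat.find h1, idx a b (Nat.find h1) x), rfl, h2, Nat.find_spec h1, ?_⟩
      intro j hj
      exact not_lt.1 (Nat.find_min h1 hj)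
    · rintro ⟨p, h1, h2, h3, h4⟩
      exact ⟨lt_iSup_iff.2 ⟨_, h3⟩, h2⟩
  have hS : ∀ p, S p = ∅ ∨ ∃ k x, idx a b 0 x = 0 ∧ t < E a b w (k + 1) x ∧
      (∀ j < k + 1, E a b w j x ≤ t) ∧ S p = cell a b (k + 1) (idx a b (k + 1) x) := by
    rintro ⟨k, m⟩
    rcases Set.eq_empty_or_nonempty (S (k, m)) with h0 | ⟨x, hx⟩
    · exact Or.inl h0
    · right
      obtain ⟨h1, h2, h3, h4⟩ := hx
      dsimp only at h1 h3 h4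
      cases k with
      | zero =>
        exfalso
        unfold E at h3
        rw [h2] at h3
        exact absurd ht (not_le.2 h3)
      | succ k =>
        refine ⟨k, x, h2, h3, h4, ?_⟩
        ext y
        rw [mem_cell hab]
        constructor
        · rintro ⟨h5, -⟩
          exact h5.trans h1.symm
        · intro h5
          have hE : ∀ j ≤ k + 1, E a b w j y = E a b w j x := by
            intro j hj
            unfold E
            rw [idx_mono hj h5]
          refine ⟨h5.trans h1, (idx_mono (Nat.zero_le _) h5).trans h2, ?_, ?_⟩
          · dsimp only
            rw [hE _ le_rfl]; exact h3
          · intro j hj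
            rw [hE j (le_of_lt hj)]; exact h4 j hj
  have hSm : ∀ p, MeasurableSet (S p) := by
    intro p
    rcases hS p with h0 | ⟨k, x, -, -, -, h0⟩ <;> rw [h0]
    · exact MeasurableSet.empty
    · exact measurableSet_cell _ _ _ _
  have hdisj : Pairwise (Function.onFun Disjoint S) := by
    rintro ⟨k, m⟩ ⟨k', m'⟩ hne
    refine Set.disjoint_left.2 fun x h1 h2 => hne ?_
    obtain ⟨h1, -, h3, h4⟩ := h1
    obtain ⟨h1', -, h3', h4'⟩ := h2
    dsimp only at *
    have : k = k' := by
      rcases lt_trichotomy k k' with hk | hk | hk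
      · exact absurd (h4' k hk) (not_le.2 h3)
      · exact hk
      · exact absurd (h4 k' hk) (not_le.2 h3')
    subst this
    rw [← h1, ← h1']
  rw [hunion, lintegral_iUnion hSm hdisj, measure_iUnion hdisj hSm, ← ENNReal.tsum_mul_left]
  refine ENNReal.tsum_le_tsum fun p => ?_
  rcases hS p with h0 | ⟨k, x, h1, h2, h3, h0⟩ <;> rw [h0]
  · simp
  · exact h k x h1 h2 h3

lemma w_cell_le {a b : Fin n → ℝ} (hab : ∀ i, a i < b i) (w : (Fin n → ℝ) → ℝ≥0∞)
    (t : ℝ≥0∞) (k : ℕ) (x : Fin n → ℝ) (h : E a b w k x ≤ t) :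
    ∫⁻ y in cell a b (k + 1) (idx a b (k + 1) x), w y ≤
      2 ^ n * t * volume (cell a b (k + 1) (idx a b (k + 1) x)) := by
  calc _ ≤ ∫⁻ y in cell a b k (idx a b k x), w y :=
        lintegral_mono_set (cell_subset hab (Nat.le_succ k) x)
    _ ≤ t * volume (cell a b k (idx a b k x)) := by
        unfold E setAvg at h
        exact (ENNReal.div_le_iff_le_mul (Or.inl (volume_cell_ne_zero hab k _))
          (Or.inl (volume_cell_ne_top a b k _))).1 h
    _ = _ := by rw [volume_cell_succ a b k _ (idx a b (k + 1) x)]; ring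

/-- Lebesgue differentiation along dyadic cells. -/
lemma ae_le_Md {a b : Fin n → ℝ} (hab : ∀ i, a i < b i) (w : (Fin n → ℝ) → ℝ≥0∞)
    (hw : Measurable w) (hwf : ∫⁻ y in cell a b 0 0, w y ≠ ∞) :
    ∀ᵐ x ∂(volume.restrict (cell a b 0 0)), w x ≤ Md a b w x := by
  set L : ℝ := 1 + ∑ i, (b i - a i) with hL
  have hLi : ∀ i, b i - a i ≤ L := by
    intro i
    have := Finset.single_le_sum (f := fun i => b i - a i)
      (fun i _ => (sub_pos.2 (hab i)).le) (Finset.mem_univ i)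
    linarith
  have hL0 : 0 < L := by
    have : 0 ≤ ∑ i, (b i - a i) := Finset.sum_nonneg fun i _ => (sub_pos.2 (hab i)).le
    linarith
  have hP : 0 < ∏ i, (b i - a i) := Finset.prod_pos fun i _ => sub_pos.2 (hab i)
  set C : ℝ≥0 := (3 ^ n + (6 * L) ^ n / ∏ i, (b i - a i) : ℝ).toNNReal with hC
  have hCr : (C : ℝ≥0∞) = ENNReal.ofReal (3 ^ n + (6 * L) ^ n / ∏ i, (b i - a i)) := rfl
  have hball : ∀ (x : Fin n → ℝ) (r : ℝ), 0 ≤ r →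
      volume (Metric.closedBall x r) = ENNReal.ofReal ((2 * r) ^ n) := by
    intro x r hr
    rw [Real.volume_pi_closedBall x hr, Fintype.card_fin]
  let v := Vitali.vitaliFamily (volume : Measure (Fin n → ℝ)) C (by
    intro x
    refine Filter.Eventually.frequently ?_
    filter_upwards [self_mem_nhdsWithin] with r hr
    have hr : 0 < r := hr
    rw [hball x _ hr.le, hball x _ (by positivity), hCr, ← ENNReal.ofReal_mul (by positivity)]
    apply ENNReal.ofReal_le_ofReal
    rw [show 2 * (3 * r) = 3 * (2 * r) by ring, mul_pow]
    gcongr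
    have : 0 ≤ (6 * L) ^ n / ∏ i, (b i - a i) := by positivity
    linarith)
  have hd := v.ae_tendsto_lintegral_div' (f := (cell a b 0 0).indicator w)
    (hw.indicator (measurableSet_cell _ _ _ _))
    (by rwa [lintegral_indicator (measurableSet_cell _ _ _ _)])
  rw [ae_restrict_iff' (measurableSet_cell _ _ _ _)]
  filter_upwards [hd] with x hx hxc
  have hx0 : idx a b 0 x = 0 := (mem_cell hab 0 0 x).1 hxc
  have hsub : ∀ k, Set.Icc (lo a b k (idx a b k x)) (hi a b k (idx a b k x)) ⊆
      Metric.closedBall x (L / 2 ^ k) := by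
    intro k y hy
    have hxk := mem_cell_self hab k x
    rw [Metric.mem_closedBall, dist_pi_le_iff (by positivity)]
    intro i
    have h1 := (Set.mem_univ_pi.1 hxk i)
    have h2 := hy.1 i
    have h3 := hy.2 i
    have h4 := hi_sub_lo a b k (idx a b k x) i
    have h5 : (b i - a i) / 2 ^ k ≤ L / 2 ^ k := by gcongr; exact hLi i
    rw [Real.dist_eq, abs_le]
    constructor <;> linarith [h1.1, h1.2]
  have htend : Filter.Tendsto
      (fun k => Set.Icc (lo a b k (idx a b k x)) (hi a b k (idx a b k x)))
      Filter.atTop (v.filterAt x) := by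
    rw [VitaliFamily.tendsto_filterAt_iff]
    constructor
    · refine Filter.Eventually.of_forall fun k => ?_
      refine ⟨isClosed_Icc, ?_, L / 2 ^ k, hsub k, ?_⟩
      · rw [← Set.pi_univ_Icc, interior_pi_set Set.finite_univ]
        simp only [interior_Icc]
        exact Set.univ_pi_nonempty_iff.2 fun i => Set.nonempty_Ioo.2 (lo_lt_hi hab k _ i)
      · rw [hball x _ (by positivity), ← measure_congr (cell_ae_Icc a b k _), volume_cell,
          ← ENNReal.ofReal_prod_of_nonneg (fun i _ =>
            div_nonneg (sub_pos.2 (hab i)).le (by positivity)), hCr,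
          ← ENNReal.ofReal_mul (by positivity)]
        apply ENNReal.ofReal_le_ofReal
        rw [Finset.prod_div_distrib, Finset.prod_const, Finset.card_univ, Fintype.card_fin]
        have e : (2 * (3 * (L / 2 ^ k))) ^ n =
            ((6 * L) ^ n / ∏ i, (b i - a i)) * ((∏ i, (b i - a i)) / (2 ^ k) ^ n) := by
          rw [show 2 * (3 * (L / 2 ^ k)) = (6 * L) / 2 ^ k by ring, div_pow]
          field_simp
        rw [e]
        gcongr
        have : (0:ℝ) < 3 ^ n := by positivity
        linarith
    · intro ε hε
      have ht : Filter.Tendsto (fun k : ℕ => L / 2 ^ k) Filter.atTop (nhds 0) :=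
        tendsto_const_nhds.div_atTop (tendsto_pow_atTop_atTop_of_one_lt (by norm_num))
      filter_upwards [ht.eventually (gt_mem_nhds hε)] with k hk
      exact (hsub k).trans (Metric.closedBall_subset_closedBall hk.le)
  have hlim := hx.comp htend
  rw [Set.indicator_of_mem hxc] at hlim
  refine le_of_tendsto' hlim fun k => ?_
  refine le_trans (le_of_eq ?_) (le_iSup (fun k => E a b w k x) k)
  simp only [Function.comp, E, setAvg]
  rw [← setLIntegral_congr (cell_ae_Icc a b k _), ← measure_congr (cell_ae_Icc a b k _)]
  congr 1
  refine setLIntegral_congr_fun (measurableSet_cell _ _ _ _) fun y hy => ?_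
  have := cell_subset hab (Nat.zero_le k) x hy
  rw [hx0] at this
  exact Set.indicator_of_mem this _

end SRH

/-- Sharp reverse Hölder inequality for `A_{∞,ℛ}` weights: if
`ρ_w' = 2^{n+1}[w]_{A_{∞,ℛ}}`, then `(⨍_R w^{ρ_w})^{1/ρ_w} ≤ 2 ⨍_R w` for every rectangle. -/
theorem sharp_reverse_holder_strong (n : ℕ)
    (w : (Fin n → ℝ) → ℝ≥0∞) (hw : Measurable w) (hfin : AinfRConst n w ≠ ∞)
    (ρ : ℝ) (hρ : 1 < ρ)
    (hdef : ENNReal.ofReal (ρ / (ρ - 1)) = 2 ^ (n + 1) * AinfRConst n w) :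
    ∀ R : Set (Fin n → ℝ), IsRect n R →
      (setAvg R fun x => w x ^ ρ) ^ (1 / ρ) ≤ 2 * setAvg R w := by
  rintro R ⟨a, b, hab, rfl⟩
  have hR : (Set.univ.pi fun i => Set.Ioo (a i) (b i)) = SRH.ocell a b 0 0 := by
    unfold SRH.ocell SRH.lo SRH.hi
    simp
  rw [hR, SRH.setAvg_ocell, SRH.setAvg_ocell]
  set Q := SRH.cell a b 0 0 with hQ
  have hQ0 : volume Q ≠ 0 := SRH.volume_cell_ne_zero hab 0 0
  have hQt : volume Q ≠ ∞ := SRH.volume_cell_ne_top a b 0 0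
  by_cases hwf : ∫⁻ y in Q, w y = ∞
  · have : setAvg Q w = ∞ := by
      unfold setAvg
      rw [hwf, ENNReal.top_div_of_ne_top hQt]
    rw [this]
    simp
  have hT : setAvg Q w ≠ ∞ := ENNReal.div_ne_top hwf hQ0
  set A := AinfRConst n w with hA
  set e : ℝ := ρ - 1 with he
  have he0 : 0 < e := by linarith
  have hρe : ρ = 1 + e := by linarith
  haveI : IsFiniteMeasure (volume.restrict Q) := ⟨by
    rw [Measure.restrict_apply_univ]; exact lt_top_iff_ne_top.2 hQt⟩
  have hT' : ENNReal.ofReal (setAvg Q w).toReal = setAvg Q w := ENNReal.ofReal_toReal hT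
  have hle : ∀ t : ℝ, (setAvg Q w).toReal ≤ t → setAvg Q w ≤ ENNReal.ofReal t := by
    intro t ht
    rw [← hT']
    exact ENNReal.ofReal_le_ofReal ht
  have main := SRH.abstract_rh (volume.restrict Q) (SRH.Md a b w) w (SRH.measurable_Md a b w) hw
    (setAvg Q w).toReal ENNReal.toReal_nonneg (2 ^ n) A
    (SRH.ae_le_Md hab w hw hwf) ?_ ?_ ?_ e he0 ?_
  · rw [hT'] at main
    have hdiv : setAvg Q (fun x => w x ^ ρ) ≤ 2 * setAvg Q w ^ ρ := by
      unfold setAvg at main ⊢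
      rw [ENNReal.div_le_iff_le_mul (Or.inl hQ0) (Or.inl hQt)]
      rw [hρe]
      refine main.trans (le_of_eq ?_)
      rw [ENNReal.rpow_add_of_nonneg _ _ zero_le_one he0.le, ENNReal.rpow_one]
      have : (∫⁻ x in Q, w x) = (∫⁻ x in Q, w x) / volume Q * volume Q :=
        (ENNReal.div_mul_cancel hQ0 hQt).symm
      nth_rewrite 2 [this]
      ring
    have h2 : (2 : ℝ≥0∞) ≤ 2 ^ ρ := by
      conv_lhs => rw [← ENNReal.rpow_one 2]
      exact ENNReal.rpow_le_rpow_of_exponent_le (by norm_num) hρ.le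
    calc _ ≤ ((2 * setAvg Q w) ^ ρ) ^ (1 / ρ) := by
          refine ENNReal.rpow_le_rpow (hdiv.trans ?_) (by positivity)
          rw [ENNReal.mul_rpow_of_nonneg _ _ (by linarith)]
          gcongr
      _ = _ := by
          rw [← ENNReal.rpow_mul, mul_one_div_cancel (by linarith), ENNReal.rpow_one]
  · intro t ht0 ht
    refine SRH.level_s4 hab w (SRH.Md a b w) _ _ (hle t ht) ?_
    intro k x hx h1 h2
    have hwx := SRH.w_cell_le hab w _ k x (h2 k (Nat.lt_succ_self k))
    have hfx : ∫⁻ y in SRH.cell a b (k + 1) (SRH.idx a b (k + 1) x), w y ≠ ∞ := by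
      refine ne_top_of_le_ne_top hwf (lintegral_mono_set ?_)
      have := SRH.cell_subset hab (Nat.zero_le (k + 1)) x
      rwa [hx] at this
    refine (SRH.lintegral_Md_cell hab w hfin (k + 1) x
      (fun j hj => (h2 j hj).trans h1.le) hfx).trans ?_
    calc _ ≤ A * (2 ^ n * ENNReal.ofReal t *
          volume (SRH.cell a b (k + 1) (SRH.idx a b (k + 1) x))) := by gcongr
      _ = _ := by ring
  · intro t ht0 ht
    refine SRH.level_s4 hab w w _ _ (hle t ht) ?_
    intro k x hx h1 h2
    exact SRH.w_cell_le hab w _ k x (h2 k (Nat.lt_succ_self k))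
  · have hx : SRH.idx a b 0 a = 0 := by
      funext i; simp [SRH.idx]
    have := SRH.lintegral_Md_cell hab w hfin 0 a (by simp) (by rw [hx]; exact hwf)
    rwa [hx] at this
  · have : 2 * (2 ^ n * A) = 2 ^ (n + 1) * A := by ring
    rw [this, ← hdef, ← hρe, ← ENNReal.ofReal_mul (by positivity)]
    rw [div_mul_div_cancel₀ (by positivity), div_self (by positivity), ENNReal.ofReal_one]
end
end
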